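/- Fix reals 0<a<1, η,θ>0 and s∈ℝ, and let c₁=v_c and c₂ be the saddle-point constants associated to (a,η,θ). For ε>0 set q=e^{−ε} and let Λ be distributed according to the Muttalib–Borodin measure on (∞,∞)-based plane partitions with parameters (q,a,η,θ). Then lim_{ε→0+} P( (Λ_{1,1} − c₁·ε^{−1})/(c₂·ε^{−1/3}) < s ) = F_TW(s), the Tracy–Widom GUE distribution. -/

import Mathlib

open MeasureTheory Filter Topology Set

noncomputable section



/-- An `(M,N)`-based plane partition, with 0-based indices: the entry `part i j`
corresponds to `Λ_{i+1,j+1}`. -/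
structure PlanePartition (M N : ℕ∞) where
  part : ℕ → ℕ → ℕ
  antitone_fst : ∀ i j, part (i + 1) j ≤ part i j
  antitone_snd : ∀ i j, part i (j + 1) ≤ part i j
  supp_fst : ∀ i j : ℕ, M ≤ (i : ℕ∞) → part i j = 0
  supp_snd : ∀ i j : ℕ, N ≤ (j : ℕ∞) → part i j = 0
  finite_supp : {p : ℕ × ℕ | part p.1 p.2 ≠ 0}.Finite

/-- Left volume: sum of the entries strictly to the left of the diagonal. -/
def PlanePartition.leftVol {M N : ℕ∞} (Λ : PlanePartition M N) : ℕ :=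
  ∑ᶠ p : ℕ × ℕ, if p.2 < p.1 then Λ.part p.1 p.2 else 0

/-- Central volume (trace): sum of the diagonal entries. -/
def PlanePartition.centralVol {M N : ℕ∞} (Λ : PlanePartition M N) : ℕ :=
  ∑ᶠ i : ℕ, Λ.part i i

/-- Right volume: sum of the entries strictly to the right of the diagonal. -/
def PlanePartition.rightVol {M N : ℕ∞} (Λ : PlanePartition M N) : ℕ :=
  ∑ᶠ p : ℕ × ℕ, if p.1 < p.2 then Λ.part p.1 p.2 else 0

/-- The Muttalib–Borodin weight `Q^{left vol} (a √(Q Q̃))^{central vol} Q̃^{right vol}`,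
where `Q = q^η` and `Q̃ = q^θ`. -/
def mbWeight (q a η θ : ℝ) {M N : ℕ∞} (Λ : PlanePartition M N) : ℝ :=
  (q ^ η) ^ Λ.leftVol * (a * Real.sqrt ((q ^ η) * (q ^ θ))) ^ Λ.centralVol *
    (q ^ θ) ^ Λ.rightVol

/-- The probability of the event `E` under the Muttalib–Borodin measure on
`(M,N)`-based plane partitions. -/
def mbProb (q a η θ : ℝ) (M N : ℕ∞) (E : Set (PlanePartition M N)) : ℝ :=
  (∑' Λ : E, mbWeight q a η θ Λ.1) / (∑' Λ : PlanePartition M N, mbWeight q a η θ Λ)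

/-- The Fredholm series `det(1-K)_{L²(X)}
  = 1 + ∑_{m ≥ 1} ((-1)^m/m!) ∫_{X^m} det[K(x_i,x_j)] dx₁⋯dx_m`. -/
def fredholmDet (K : ℝ → ℝ → ℂ) (X : Set ℝ) : ℂ :=
  1 + ∑' m : ℕ,
    ((-1 : ℂ) ^ (m + 1) / (m + 1).factorial) *
      ∫ x : Fin (m + 1) → ℝ in {x | ∀ i, x i ∈ X},
        Matrix.det (Matrix.of fun i j => K (x i) (x j))

/-- `F_he(ζ) = Γ(α/(2η) - ζ/η + 1/2) / Γ(α/(2θ) + ζ/θ + 1/2)`. -/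
def Fhe (α η θ : ℝ) (ζ : ℂ) : ℂ :=
  Complex.Gamma (α / (2 * η) - ζ / η + 1 / 2) / Complex.Gamma (α / (2 * θ) + ζ / θ + 1 / 2)

/-- The hard-edge kernel `K_he(x,y)`, a double contour integral over the vertical lines
`δ + iℝ` (in `ζ`) and `-δ + iℝ` (in `ω`), with the (valid) choice `δ = min(η,θ)/4`. -/
def Khe (α η θ : ℝ) (x y : ℝ) : ℂ :=
  (((x * y) ^ (-(1 / 2) : ℝ) : ℝ) : ℂ) * ((2 * Real.pi * Complex.I) ^ 2)⁻¹ *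
    ∫ t : ℝ, (∫ s : ℝ,
      (Fhe α η θ (min η θ / 4 + t * Complex.I) / Fhe α η θ (-(min η θ / 4) + s * Complex.I)) *
        (x : ℂ) ^ (min η θ / 4 + t * Complex.I) * (y : ℂ) ^ (-(-(min η θ / 4) + s * Complex.I)) /
        ((min η θ / 4 + t * Complex.I) - (-(min η θ / 4) + s * Complex.I)) * Complex.I) *
      Complex.I

/-- `K̃_he(x,y) = e^{-x/2-y/2} K_he(e^{-x}, e^{-y})`. -/
def Kthe (α η θ : ℝ) (x y : ℝ) : ℂ :=
  Real.exp (-x / 2 - y / 2) * Khe α η θ (Real.exp (-x)) (Real.exp (-y))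




/-- The infinite q-Pochhammer symbol `(x;u)_∞ = ∏_{i ≥ 0} (1 - x u^i)` in `ℂ`. -/
def qPochInf (x u : ℂ) : ℂ := ∏' i : ℕ, (1 - x * u ^ i)

/-- The point `r e^{iφ}` on the circle of radius `r`. -/
def zCirc (r φ : ℝ) : ℂ := (r : ℂ) * Complex.exp (φ * Complex.I)

/-- `F_d(z) = (√a Q̃^{1/2}/z; Q̃)_∞ / (√a Q^{1/2} z; Q)_∞` with `Q = q^η`, `Q̃ = q^θ`
(the case `M = N = ∞`). -/
def Fd (q a η θ : ℝ) (z : ℂ) : ℂ :=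
  qPochInf (((Real.sqrt a * (q ^ θ) ^ ((1 : ℝ) / 2) : ℝ) : ℂ) / z) ((q ^ θ : ℝ) : ℂ) /
    qPochInf (((Real.sqrt a * (q ^ η) ^ ((1 : ℝ) / 2) : ℝ) : ℂ) * z) ((q ^ η : ℝ) : ℂ)

/-- A (valid) choice of the contour parameter `δ` for the discrete kernel:
`√a Q̃^{1/2} < 1 - δ` and `(1 + δ) √a Q^{1/2} < 1`. -/
def ddelta (q a η θ : ℝ) : ℝ :=
  min ((1 - Real.sqrt a * (q ^ θ) ^ ((1 : ℝ) / 2)) / 2)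
    (((Real.sqrt a * (q ^ η) ^ ((1 : ℝ) / 2))⁻¹ - 1) / 2)

/-- The discrete kernel `K_d(k,ℓ)` with `M = N = ∞`, evaluated at the half-integers
`k = κ + 1/2` and `ℓ = l + 1/2`; note that then `z^{-k+1/2} = z^{-κ}` and
`w^{ℓ+1/2} = w^{l+1}` are integer powers. -/
def Kd (q a η θ : ℝ) (κ l : ℤ) : ℂ :=
  ((2 * Real.pi : ℂ) ^ 2)⁻¹ *
    ∫ φ in Set.Ioc (-Real.pi) Real.pi, ∫ ψ in Set.Ioc (-Real.pi) Real.pi,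
      Fd q a η θ (zCirc (1 + ddelta q a η θ) φ) / Fd q a η θ (zCirc (1 - ddelta q a η θ) ψ) *
        zCirc (1 + ddelta q a η θ) φ ^ (-κ) * zCirc (1 - ddelta q a η θ) ψ ^ (l + 1) /
        (zCirc (1 + ddelta q a η θ) φ - zCirc (1 - ddelta q a η θ) ψ)

/-- The Airy kernel, as a double contour integral over the vertical lines `1 + iℝ`
(in `ζ`) and `-1 + iℝ` (in `ω`). -/
def airyKernel (x y : ℝ) : ℂ :=
  ((2 * Real.pi * Complex.I) ^ 2)⁻¹ *
    ∫ t : ℝ, (∫ s : ℝ,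
      Complex.exp ((1 + t * Complex.I) ^ 3 / 3 - x * (1 + t * Complex.I)) *
        Complex.exp (-(-1 + s * Complex.I) ^ 3 / 3 + y * (-1 + s * Complex.I)) /
        ((1 + t * Complex.I) - (-1 + s * Complex.I)) * Complex.I) * Complex.I

/-- The dilogarithm `Li₂(t) = ∑_{k ≥ 1} t^k / k²`. -/
def Li2 (t : ℝ) : ℝ := ∑' k : ℕ, t ^ (k + 1) / ((k : ℝ) + 1) ^ 2

/-- The saddle point `z_c` associated to `(a, η, θ)` (with `b = √a`). -/
def zc (a η θ : ℝ) : ℝ :=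
  (Real.sqrt a * (θ - η) + Real.sqrt (4 * η * θ + a * (θ - η) ^ 2)) / (2 * θ)

/-- `v_c = -η⁻¹ log(1 - b z_c) - θ⁻¹ log(1 - b / z_c)`; this is the constant `c₁`. -/
def vc (a η θ : ℝ) : ℝ :=
  -η⁻¹ * Real.log (1 - Real.sqrt a * zc a η θ) - θ⁻¹ * Real.log (1 - Real.sqrt a / zc a η θ)

/-- The action `S(z) = η⁻¹ Li₂(b z) - θ⁻¹ Li₂(b / z) - v_c log z`. -/
def Sfun (a η θ : ℝ) (z : ℝ) : ℝ :=
  η⁻¹ * Li2 (Real.sqrt a * z) - θ⁻¹ * Li2 (Real.sqrt a / z) - vc a η θ * Real.log z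

/-- The constant `c₂ = ((1/2) ((z d/dz)³ S)(z_c))^{1/3}`. -/
def c2const (a η θ : ℝ) : ℝ :=
  ((1 / 2) * ((fun f : ℝ → ℝ => fun z => z * deriv f z)^[3] (Sfun a η θ)) (zc a η θ)) ^
    ((1 : ℝ) / 3)

/-- The finite q-Pochhammer symbol `(x;u)_n = ∏_{0 ≤ i < n} (1 - x u^i)` in `ℝ`. -/
def qPoch (x u : ℝ) (n : ℕ) : ℝ := ∏ i ∈ Finset.range n, (1 - x * u ^ i)

/-- The density (unnormalized) of the continuous Muttalib–Borodin ensemble. -/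
def mbDensity (α η θ : ℝ) (M N : ℕ) (x : Fin M → ℝ) : ℝ :=
  (∏ i : Fin M, ∏ j : Fin M,
      if i < j then (x j ^ η - x i ^ η) * (x j ^ θ - x i ^ θ) else 1) *
    ∏ i : Fin M, x i ^ (α + (η + θ) / 2 - 1) * (1 - x i ^ θ) ^ (N - M)

/-- The probability of the event `E` under the continuous Muttalib–Borodin ensemble with
parameters `(α, η, θ, M, N)`, defined as a ratio of integrals over ordered tuples
`0 < x₁ < ⋯ < x_M < 1`. -/
def contMBProb (α η θ : ℝ) (M N : ℕ) (E : Set (Fin M → ℝ)) : ℝ :=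
  (∫ x in {x : Fin M → ℝ | (∀ i, 0 < x i ∧ x i < 1) ∧ StrictMono x ∧ x ∈ E},
      mbDensity α η θ M N x) /
    ∫ x in {x : Fin M → ℝ | (∀ i, 0 < x i ∧ x i < 1) ∧ StrictMono x},
      mbDensity α η θ M N x

/-- A step of a ↘-path: one coordinate increases by exactly 1. -/
def DRStep (p q : ℕ × ℕ) : Prop :=
  (q.1 = p.1 + 1 ∧ q.2 = p.2) ∨ (q.1 = p.1 ∧ q.2 = p.2 + 1)

/-- A step of a ↗-path: the first coordinate decreases by 1, or the second increases by 1. -/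
def URStep (p q : ℕ × ℕ) : Prop :=
  (q.1 + 1 = p.1 ∧ q.2 = p.2) ∨ (q.1 = p.1 ∧ q.2 = p.2 + 1)

/-- Bessel function of the first kind (series form), for `t > 0`. -/
def besselJ (α t : ℝ) : ℝ :=
  ∑' k : ℕ, (-1 : ℝ) ^ k * (t / 2) ^ (2 * (k : ℝ) + α) /
    ((k.factorial : ℝ) * Real.Gamma ((k : ℝ) + α + 1))



lemma sum_symm_eq {ι : Type*} [Fintype ι] [LinearOrder ι] (m : ℕ) (φ : (Fin m → ι) → ℝ)
    (hsym : ∀ f (σ : Equiv.Perm (Fin m)), φ (f ∘ σ) = φ f)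
    (h0 : ∀ f, ¬ Function.Injective f → φ f = 0) :
    ∑ f, φ f = (m.factorial : ℝ) * ∑ f : Fin m → ι with StrictMono f, φ f := by
  classical
  have h1 : ∑ f, φ f = ∑ f : Fin m → ι with Function.Injective f, φ f := by
    rw [Finset.sum_filter]
    refine Finset.sum_congr rfl fun f _ => ?_
    split_ifs with h
    · rfl
    · exact h0 f h
  rw [h1]
  have h2 : ∑ f : Fin m → ι with Function.Injective f, φ f =
      ∑ p ∈ (Finset.univ.filter (fun f : Fin m → ι => StrictMono f)) ×ˢ
        (Finset.univ : Finset (Equiv.Perm (Fin m))), φ p.1 := by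
    refine Finset.sum_bij' (fun f _ => (f ∘ Tuple.sort f, (Tuple.sort f)⁻¹))
      (fun p _ => p.1 ∘ p.2) ?_ ?_ ?_ ?_ ?_
    · intro f hf
      simp only [Finset.mem_filter, Finset.mem_univ, true_and] at hf
      simp only [Finset.mem_product, Finset.mem_filter, Finset.mem_univ, true_and, and_true]
      exact (Tuple.monotone_sort f).strictMono_of_injective (hf.comp (Equiv.injective _))
    · intro p hp
      simp only [Finset.mem_product, Finset.mem_filter, Finset.mem_univ, true_and, and_true] at hp
      simp only [Finset.mem_filter, Finset.mem_univ, true_and]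
      exact hp.injective.comp (Equiv.injective _)
    · intro f hf
      ext i; simp
    · intro p hp
      simp only [Finset.mem_product, Finset.mem_filter, Finset.mem_univ, true_and, and_true] at hp
      have hs : Tuple.sort (p.1 ∘ p.2) = p.2⁻¹ := by
        have hm : Monotone ((p.1 ∘ p.2) ∘ (p.2⁻¹ : Equiv.Perm (Fin m))) := by
          have : (p.1 ∘ p.2) ∘ (p.2⁻¹ : Equiv.Perm (Fin m)) = p.1 := by ext i; simp
          rw [this]; exact hp.monotone
        have := (Tuple.comp_sort_eq_comp_iff_monotone (f := p.1 ∘ p.2) (σ := p.2⁻¹)).2 hm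
        have hinj : Function.Injective (p.1 ∘ p.2) := hp.injective.comp (Equiv.injective _)
        ext i
        have h3 := congrFun this i
        exact congrArg Fin.val (hinj h3.symm)
      ext i
      · simp [hs]
      · simp [hs]
    · intro f hf
      exact (hsym f _).symm
  rw [h2, Finset.sum_product, Finset.mul_sum]
  refine Finset.sum_congr rfl fun f _ => ?_
  simp [Fintype.card_perm]

lemma det_comp_perm {m : ℕ} {ι : Type*} (K : ι → ι → ℝ) (f : Fin m → ι)
    (σ : Equiv.Perm (Fin m)) :
    (Matrix.of fun i j => K ((f ∘ σ) i) ((f ∘ σ) j)).det =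
      (Matrix.of fun i j => K (f i) (f j)).det := by
  exact Matrix.det_submatrix_equiv_self σ (Matrix.of fun i j => K (f i) (f j))

/-- finite Fredholm expansion -/
lemma fredholm_fin {ι : Type*} [Fintype ι] [LinearOrder ι] (K : Matrix ι ι ℝ) (D : ℕ)
    (hD : Fintype.card ι < D) :
    (1 - K).det = ∑ m ∈ Finset.range D, ((-1 : ℝ) ^ m / m.factorial) *
      ∑ f : Fin m → ι, (Matrix.of fun i j => K (f i) (f j)).det := by
  classical
  have h1 : (1 - K).det = (Matrix.det (1 + (Polynomial.X : Polynomial ℝ) •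
      K.map Polynomial.C)).eval (-1) := by
    have := RingHom.map_det (Polynomial.evalRingHom (-1 : ℝ))
      (1 + (Polynomial.X : Polynomial ℝ) • K.map Polynomial.C)
    rw [Polynomial.coe_evalRingHom] at this
    rw [this]
    congr 1
    ext i j
    simp [Matrix.one_apply]
    split_ifs <;> simp [sub_eq_add_neg]
  set p := (Matrix.det (1 + (Polynomial.X : Polynomial ℝ) • K.map Polynomial.C)) with hp
  have hminor : ∀ k, p.coeff k = (k.factorial : ℝ)⁻¹ *
      ∑ f : Fin k → ι, (Matrix.of fun i j => K (f i) (f j)).det := by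
    intro k
    rw [hp, Matrix.coeff_det_one_add_X_smul_eq_sum_minors]
    rw [sum_symm_eq k (fun f => (Matrix.of fun i j => K (f i) (f j)).det)
      (fun f σ => det_comp_perm K f σ)]
    · rw [← mul_assoc, inv_mul_cancel₀ (by positivity), one_mul]
      refine Finset.sum_bij' (fun s hs => (fun i => s.orderIsoOfFin
        (Finset.mem_powersetCard.1 hs).2 i : Fin k → ι)) (fun f _ => Finset.univ.image f)
        ?_ ?_ ?_ ?_ ?_
      · intro s hs
        simp only [Finset.mem_filter, Finset.mem_univ, true_and]
        intro i j hij
        exact (s.orderIsoOfFin _).strictMono hij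
      · intro f hf
        simp only [Finset.mem_filter, Finset.mem_univ, true_and] at hf
        simp [Finset.mem_powersetCard, Finset.card_image_of_injective _ hf.injective]
      · intro s hs
        ext x
        simp only [Finset.mem_image, Finset.mem_univ, true_and]
        constructor
        · rintro ⟨i, rfl⟩; exact (s.orderIsoOfFin _ i).2
        · intro hx
          exact ⟨(s.orderIsoOfFin (Finset.mem_powersetCard.1 hs).2).symm ⟨x, hx⟩, by simp⟩
      · intro f hf
        simp only [Finset.mem_filter, Finset.mem_univ, true_and] at hf
        have hc : (Finset.univ.image f).card = k := by
          simp [Finset.card_image_of_injective _ hf.injective]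
        have := Finset.orderEmbOfFin_unique hc (f := f) (fun x => by simp) hf
        exact this.symm
      · intro s hs
        symm
        exact Matrix.det_submatrix_equiv_self
          (s.orderIsoOfFin (Finset.mem_powersetCard.1 hs).2).toEquiv
          (K.submatrix (Subtype.val : s → ι) (Subtype.val : s → ι))
    · intro f hf
      simp only [Function.Injective, not_forall] at hf
      obtain ⟨i, j, hij, hne⟩ := hf
      exact Matrix.det_zero_of_row_eq hne (by ext l; simp [hij])
  have hdeg : p.natDegree < D := by
    refine lt_of_le_of_lt ?_ hD
    rw [Polynomial.natDegree_le_iff_coeff_eq_zero]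
    intro N hN
    rw [hp, Matrix.coeff_det_one_add_X_smul_eq_sum_minors]
    rw [Finset.powersetCard_eq_empty.2 (by simpa using hN), Finset.sum_empty]
  rw [h1, Polynomial.eval_eq_sum_range' hdeg]
  refine Finset.sum_congr rfl fun m _ => ?_
  rw [hminor]; ring

lemma cauchy_binet {M : ℕ} {ι : Type*} [Fintype ι] [LinearOrder ι] (A B : Fin M → ι → ℝ) :
    (Matrix.of fun i j => ∑ l, A i l * B j l).det =
      ∑ f : Fin M → ι with StrictMono f, (Matrix.of fun i j => A i (f j)).det *
        (Matrix.of fun i j => B i (f j)).det := by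
  classical
  have hdet0 : ∀ (A : Fin M → ι → ℝ) (f : Fin M → ι), ¬ Function.Injective f →
      (Matrix.of fun i j => A i (f j)).det = 0 := by
    intro A f hf
    simp only [Function.Injective, not_forall] at hf
    obtain ⟨i, j, hij, hne⟩ := hf
    exact Matrix.det_zero_of_column_eq hne (by intro l; simp [hij])
  have hdetp : ∀ (A : Fin M → ι → ℝ) (f : Fin M → ι) (σ : Equiv.Perm (Fin M)),
      (Matrix.of fun i j => A i ((f ∘ σ) j)).det =
        Equiv.Perm.sign σ * (Matrix.of fun i j => A i (f j)).det := by
    intro A f σ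
    exact Matrix.det_permute' σ (Matrix.of fun i j => A i (f j))
  have hsq : ∀ σ : Equiv.Perm (Fin M),
      ((Equiv.Perm.sign σ : ℤ) : ℝ) * ((Equiv.Perm.sign σ : ℤ) : ℝ) = 1 := by
    intro σ
    rcases Int.units_eq_one_or (Equiv.Perm.sign σ) with h | h <;> rw [h] <;> simp
  have key := sum_symm_eq M (fun f : Fin M → ι => (Matrix.of fun i j => A i (f j)).det *
        (Matrix.of fun i j => B i (f j)).det) (by
      intro f σ
      rw [hdetp, hdetp]
      linear_combination ((Matrix.of fun i j => A i (f j)).det *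
        (Matrix.of fun i j => B i (f j)).det) * hsq σ)
      (by intro f hf; simp only [hdet0 A f hf, zero_mul])
  have hpos : (M.factorial : ℝ) ≠ 0 := by positivity
  apply mul_left_cancel₀ hpos
  rw [← key]
  have h1 : (Matrix.of fun i j => ∑ l, A i l * B j l).det =
      ∑ f : Fin M → ι, (∏ i, A i (f i)) * (Matrix.of fun i j => B i (f j)).det := by
    have : (Matrix.of fun i j => ∑ l, A i l * B j l) =
        (fun i => ∑ l, A i l • (fun j => B j l)) := by
      ext i j; simp [Finset.sum_apply]
    rw [this]
    change Matrix.detRowAlternating _ = _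
    rw [← AlternatingMap.coe_multilinearMap, MultilinearMap.map_sum]
    refine Finset.sum_congr rfl fun f _ => ?_
    rw [MultilinearMap.map_smul_univ, smul_eq_mul]
    congr 1
    rw [← Matrix.det_transpose]
    rfl
  rw [h1]
  have h2 : ∀ f : Fin M → ι, (Matrix.of fun i j => A i (f j)).det *
        (Matrix.of fun i j => B i (f j)).det =
      ∑ σ : Equiv.Perm (Fin M), (∏ i, A i ((f ∘ σ.symm) i)) *
        (Matrix.of fun i j => B i ((f ∘ σ.symm) j)).det := by
    intro f
    rw [Matrix.det_apply', Finset.sum_mul]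
    refine Finset.sum_congr rfl fun σ _ => ?_
    rw [hdetp B f σ.symm]
    have : ∏ i, A i ((f ∘ σ.symm) i) = ∏ i, A (σ i) (f i) := by
      rw [← Equiv.prod_comp σ]
      simp
    rw [this, Equiv.Perm.sign_symm]
    simp only [Matrix.of_apply]
    ring
  rw [Finset.sum_congr rfl fun f _ => h2 f, Finset.sum_comm]
  have h3 : ∀ σ : Equiv.Perm (Fin M), ∑ f : Fin M → ι, (∏ i, A i ((f ∘ σ.symm) i)) *
        (Matrix.of fun i j => B i ((f ∘ σ.symm) j)).det =
      ∑ f : Fin M → ι, (∏ i, A i (f i)) * (Matrix.of fun i j => B i (f j)).det := by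
    intro σ
    exact Equiv.sum_comp (Equiv.arrowCongr σ (Equiv.refl ι))
      (fun f : Fin M → ι => (∏ i, A i (f i)) * (Matrix.of fun i j => B i (f j)).det)
  rw [Finset.sum_congr rfl fun σ _ => h3 σ]
  simp [Fintype.card_perm]


open Polynomial in
lemma degree_C_mul_le' {K : Type*} [Field K] (c : K) (p : K[X]) : (C c * p).degree ≤ p.degree := by
  refine (degree_mul_le _ _).trans ?_
  calc _ ≤ 0 + p.degree := add_le_add degree_C_le le_rfl
    _ = _ := zero_add _

open Polynomial in
lemma deg_prod_lin_lt {K : Type*} [Field K] {M : ℕ} (s : Finset (Fin M)) (c d : Fin M → K) (n : ℕ)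
    (hn : s.card < n) :
    (∏ i ∈ s, (C (c i) + C (d i) * X)).degree < (n : WithBot ℕ) := by
  refine lt_of_le_of_lt (degree_prod_le _ _) ?_
  refine lt_of_le_of_lt (b := ((s.card : ℕ) : WithBot ℕ)) ?_ (by exact_mod_cast hn)
  have : ∀ i ∈ s, (C (c i) + C (d i) * X).degree ≤ (1 : WithBot ℕ) := by
    intro i _
    rw [add_comm]
    exact degree_linear_le
  calc _ ≤ ∑ i ∈ s, (1 : WithBot ℕ) := Finset.sum_le_sum this
    _ = _ := by simp

/-- residue coefficients -/
def alph {K : Type*} [Field K] {M : ℕ} (x y : Fin M → K) (i : Fin M) : K :=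
  (∏ j, (1 - x i * y j)) / ∏ l ∈ Finset.univ.erase i, (x i - x l)

lemma prod_erase_sub_ne {K : Type*} [Field K] {M : ℕ} {x : Fin M → K}
    (hx : Function.Injective x) (i : Fin M) : ∏ l ∈ Finset.univ.erase i, (x i - x l) ≠ 0 := by
  rw [Finset.prod_ne_zero_iff]
  intro l hl
  rw [sub_ne_zero]
  intro h
  exact (Finset.ne_of_mem_erase hl) (hx h).symm

open Polynomial in
lemma partial_frac {K : Type*} [Field K] {M : ℕ} (x y : Fin M → K) (hx : Function.Injective x)
    (hx0 : ∀ i, x i ≠ 0) (z : K) :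
    ∏ j, (z - y j) = (∏ j, (-y j)) * ∏ i, (1 - x i * z) +
      ∑ i, alph x y i * z * ∏ l ∈ Finset.univ.erase i, (1 - x l * z) := by
  classical
  set P : K[X] := ∏ j, (C (-y j) + C 1 * X) with hP
  set Q : K[X] := C (∏ j, (-y j)) * ∏ i, (C 1 + C (-x i) * X) +
    ∑ i, C (alph x y i) * ((C 0 + C 1 * X) * ∏ l ∈ Finset.univ.erase i, (C 1 + C (-x l) * X)) with hQ
  have hPQ : P = Q := by
    have hinj : Set.InjOn (fun o : Option (Fin M) => o.elim (0 : K) (fun i => (x i)⁻¹))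
        (Finset.univ : Finset (Option (Fin M))) := by
      rintro (_ | i) _ (_ | j) _ h
      · rfl
      · exact absurd h.symm (inv_ne_zero (hx0 j))
      · exact absurd h (inv_ne_zero (hx0 i))
      · have := hx (inv_injective h); rw [this]
    have hcard : (Finset.univ : Finset (Option (Fin M))).card = M + 1 := by simp
    refine eq_of_degrees_lt_of_eval_index_eq _ hinj ?_ ?_ ?_
    · rw [hcard]; exact deg_prod_lin_lt _ _ _ _ (by simp)
    · rw [hcard]
      refine lt_of_le_of_lt (degree_add_le _ _) (max_lt ?_ ?_)
      · refine lt_of_le_of_lt (degree_C_mul_le' _ _) ?_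
        exact deg_prod_lin_lt _ _ _ _ (by simp)
      · refine lt_of_le_of_lt (degree_sum_le _ _) ?_
        refine (Finset.sup_lt_iff (WithBot.bot_lt_coe (M + 1))).2 ?_
        intro i _
        refine lt_of_le_of_lt (degree_C_mul_le' _ _) ?_
        refine lt_of_le_of_lt (degree_mul_le _ _) ?_
        have h1 : (C (0 : K) + C 1 * X).degree ≤ 1 := by
          rw [add_comm]; exact degree_linear_le
        have h2 : (∏ l ∈ Finset.univ.erase i, (C (1 : K) + C (-x l) * X)).degree < (M : WithBot ℕ) :=
          deg_prod_lin_lt _ _ _ _ (by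
            rw [Finset.card_erase_of_mem (Finset.mem_univ i)]
            have := i.pos
            simp; omega)
        refine lt_of_le_of_lt (add_le_add_left h1 _) ?_
        rw [add_comm]
        push_cast
        exact WithBot.add_lt_add_right (by decide) h2
    · rintro (_ | i) _
      · simp [hP, hQ, eval_prod, eval_finsetSum]
      · simp only [hP, hQ, Option.elim, eval_prod, eval_add, eval_mul, eval_C, eval_X,
          eval_finsetSum, one_mul, zero_add]
        have e1 : ∏ j, (1 + -x j * (x i)⁻¹) = 0 := by
          apply Finset.prod_eq_zero (Finset.mem_univ i)
          field_simp [hx0 i]; ring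
        rw [e1, mul_zero, zero_add, Finset.sum_eq_single i]
        · have e2 : ∏ l ∈ Finset.univ.erase i, (1 + -x l * (x i)⁻¹) =
              (∏ l ∈ Finset.univ.erase i, (x i - x l)) * (x i)⁻¹ ^ (M - 1) := by
            have : (x i)⁻¹ ^ (M - 1) = ∏ l ∈ Finset.univ.erase i, (x i)⁻¹ := by
              rw [Finset.prod_const, Finset.card_erase_of_mem (Finset.mem_univ i)]; simp
            rw [this, ← Finset.prod_mul_distrib]
            refine Finset.prod_congr rfl fun l _ => ?_
            field_simp [hx0 i]; ring
          have e3 : ∏ j, (-y j + (x i)⁻¹) = (∏ j, (1 - x i * y j)) * (x i)⁻¹ ^ M := by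
            have : (x i)⁻¹ ^ M = ∏ j : Fin M, (x i)⁻¹ := by
              rw [Finset.prod_const]; simp
            rw [this, ← Finset.prod_mul_distrib]
            refine Finset.prod_congr rfl fun l _ => ?_
            field_simp [hx0 i]; ring
          rw [e2, e3, alph]
          have hne := prod_erase_sub_ne hx i
          have : (x i)⁻¹ ^ M = (x i)⁻¹ * (x i)⁻¹ ^ (M - 1) := by
            rw [← pow_succ']; congr 1; have := i.pos; omega
          rw [this]
          field_simp
        · intro j _ hj
          have : ∏ l ∈ Finset.univ.erase j, (1 + -x l * (x i)⁻¹) = 0 := by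
            apply Finset.prod_eq_zero (Finset.mem_erase.2 ⟨hj.symm, Finset.mem_univ i⟩)
            field_simp [hx0 i]; ring
          rw [this]; ring
        · simp
  have := congrArg (eval z) hPQ
  simp only [hP, hQ, eval_prod, eval_add, eval_mul, eval_C, eval_X,
          eval_finsetSum, one_mul, zero_add] at this
  calc _ = ∏ j, (-y j + z) := Finset.prod_congr rfl fun j _ => by ring
    _ = _ := this
    _ = _ := by
      congr 1
      · congr 1
        exact Finset.prod_congr rfl fun j _ => by ring
      · refine Finset.sum_congr rfl fun i _ => ?_
        rw [mul_assoc]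
        congr 2
        exact Finset.prod_congr rfl fun j _ => by ring

open Polynomial in
lemma cauchy_interp {K : Type*} [Field K] {M : ℕ} (x y : Fin M → K) (hy : Function.Injective y)
    (hy0 : ∀ i, y i ≠ 0) (hxy : ∀ i j, 1 - x i * y j ≠ 0) (k : Fin M) (z : K) :
    ∏ i ∈ Finset.univ.erase k, (z - x i) =
      ∑ j, alph y x j * (1 - x k * y j)⁻¹ * ∏ l ∈ Finset.univ.erase j, (1 - y l * z) := by
  classical
  set P : K[X] := ∏ i ∈ Finset.univ.erase k, (C (-x i) + C 1 * X) with hP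
  set Q : K[X] := ∑ j, C (alph y x j * (1 - x k * y j)⁻¹) *
    ∏ l ∈ Finset.univ.erase j, (C 1 + C (-y l) * X) with hQ
  have hPQ : P = Q := by
    have hinj : Set.InjOn (fun j => (y j)⁻¹) (Finset.univ : Finset (Fin M)) := by
      intro i _ j _ h
      exact hy (inv_injective h)
    have hcard : (Finset.univ : Finset (Fin M)).card = M := by simp
    have hce : ∀ k : Fin M, (Finset.univ.erase k).card < M := fun k => by
      rw [Finset.card_erase_of_mem (Finset.mem_univ k)]
      have := k.pos
      simp; omega
    refine eq_of_degrees_lt_of_eval_index_eq _ hinj ?_ ?_ ?_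
    · rw [hcard]; exact deg_prod_lin_lt _ _ _ _ (hce k)
    · rw [hcard]
      refine lt_of_le_of_lt (degree_sum_le _ _) ?_
      refine (Finset.sup_lt_iff (WithBot.bot_lt_coe M)).2 ?_
      intro i _
      refine lt_of_le_of_lt (degree_C_mul_le' _ _) ?_
      exact deg_prod_lin_lt _ _ _ _ (hce i)
    · intro j _
      simp only [hP, hQ, eval_prod, eval_add, eval_mul, eval_C, eval_X, eval_finsetSum, one_mul]
      rw [Finset.sum_eq_single j]
      · have e2 : ∏ l ∈ Finset.univ.erase j, (1 + -y l * (y j)⁻¹) =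
              (∏ l ∈ Finset.univ.erase j, (y j - y l)) * (y j)⁻¹ ^ (M - 1) := by
          have : (y j)⁻¹ ^ (M - 1) = ∏ l ∈ Finset.univ.erase j, (y j)⁻¹ := by
            rw [Finset.prod_const, Finset.card_erase_of_mem (Finset.mem_univ j)]; simp
          rw [this, ← Finset.prod_mul_distrib]
          refine Finset.prod_congr rfl fun l _ => ?_
          field_simp [hy0 j]; ring
        have e3 : ∏ i ∈ Finset.univ.erase k, (-x i + (y j)⁻¹) =
            (∏ i ∈ Finset.univ.erase k, (1 - y j * x i)) * (y j)⁻¹ ^ (M - 1) := by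
          have : (y j)⁻¹ ^ (M - 1) = ∏ l ∈ Finset.univ.erase k, (y j)⁻¹ := by
            rw [Finset.prod_const, Finset.card_erase_of_mem (Finset.mem_univ k)]; simp
          rw [this, ← Finset.prod_mul_distrib]
          refine Finset.prod_congr rfl fun l _ => ?_
          field_simp [hy0 j]; ring
        rw [e2, e3, alph, ← Finset.mul_prod_erase Finset.univ _ (Finset.mem_univ k)]
        have hne := prod_erase_sub_ne hy j
        have h1 := hxy k j
        have h2 : 1 - y j * x k ≠ 0 := by rwa [mul_comm]
        rw [mul_comm (x k)]
        field_simp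
      · intro j' _ hj
        have : ∏ l ∈ Finset.univ.erase j', (1 + -y l * (y j)⁻¹) = 0 := by
          apply Finset.prod_eq_zero (Finset.mem_erase.2 ⟨hj.symm, Finset.mem_univ j⟩)
          field_simp [hy0 j]; ring
        rw [this]; ring
      · simp
  have := congrArg (eval z) hPQ
  simp only [hP, hQ, eval_prod, eval_add, eval_mul, eval_C, eval_X,
          eval_finsetSum, one_mul] at this
  calc _ = ∏ i ∈ Finset.univ.erase k, (-x i + z) := Finset.prod_congr rfl fun j _ => by ring
    _ = _ := this
    _ = _ := by
      refine Finset.sum_congr rfl fun i _ => ?_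
      congr 1
      exact Finset.prod_congr rfl fun j _ => by ring

/-- Cauchy matrix -/
def cauM {M : ℕ} (x y : Fin M → ℝ) : Matrix (Fin M) (Fin M) ℝ :=
  Matrix.of fun i j => (1 - x i * y j)⁻¹

lemma cauM_inv {M : ℕ} (x y : Fin M → ℝ) (hx : Function.Injective x) (hy : Function.Injective y)
    (hy0 : ∀ i, y i ≠ 0) (hxy : ∀ i j, 1 - x i * y j ≠ 0) :
    cauM x y * (Matrix.of fun j i => alph y x j * (1 - x i * y j)⁻¹ * alph x y i) = 1 := by
  ext i k
  rw [Matrix.mul_apply, Matrix.one_apply]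
  have h := cauchy_interp x y hy hy0 hxy k (x i)
  have hfac : ∀ j, ∏ l ∈ Finset.univ.erase j, (1 - y l * x i) =
      (∏ l, (1 - x i * y l)) * (1 - x i * y j)⁻¹ := by
    intro j
    rw [← Finset.mul_prod_erase Finset.univ _ (Finset.mem_univ j), mul_comm,
      ← mul_assoc, inv_mul_cancel₀ (hxy i j), one_mul]
    exact Finset.prod_congr rfl fun l _ => by ring
  have hp : ∏ l, (1 - x i * y l) ≠ 0 := Finset.prod_ne_zero_iff.2 fun l _ => hxy i l
  have key : ∑ j, cauM x y i j * (Matrix.of fun j i => alph y x j * (1 - x i * y j)⁻¹ * alph x y i) j k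
      = alph x y k * (∏ l, (1 - x i * y l))⁻¹ * ∏ i' ∈ Finset.univ.erase k, (x i - x i') := by
    rw [h, Finset.mul_sum]
    refine Finset.sum_congr rfl fun j _ => ?_
    rw [hfac]
    simp only [cauM, Matrix.of_apply]
    field_simp
  rw [key]
  split_ifs with hik
  · subst hik
    rw [alph]
    have := prod_erase_sub_ne hx i
    field_simp
  · have : ∏ i' ∈ Finset.univ.erase k, (x i - x i') = 0 :=
      Finset.prod_eq_zero (Finset.mem_erase.2 ⟨hik, Finset.mem_univ i⟩) (sub_self _)
    rw [this, mul_zero]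

lemma cauM_det_sq {M : ℕ} (x y : Fin M → ℝ) (hx : Function.Injective x) (hy : Function.Injective y)
    (hy0 : ∀ i, y i ≠ 0) (hxy : ∀ i j, 1 - x i * y j ≠ 0) :
    (cauM x y).det ^ 2 * ((∏ i, alph x y i) * ∏ j, alph y x j) = 1 := by
  have h := congrArg Matrix.det (cauM_inv x y hx hy hy0 hxy)
  rw [Matrix.det_mul, Matrix.det_one] at h
  have e : (Matrix.of fun j i => alph y x j * (1 - x i * y j)⁻¹ * alph x y i) =
      Matrix.diagonal (alph y x) * (cauM x y).transpose * Matrix.diagonal (alph x y) := by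
    ext j i
    simp [Matrix.diagonal_mul, Matrix.mul_diagonal, cauM]
  rw [e, Matrix.det_mul, Matrix.det_mul, Matrix.det_diagonal, Matrix.det_diagonal,
    Matrix.det_transpose] at h
  rw [← h]; ring

/-- Z bound: det C over Vandermondes squared -/
lemma cauM_det_vand {M : ℕ} (x y : Fin M → ℝ) (hx : Function.Injective x)
    (hy : Function.Injective y)
    (hy0 : ∀ i, y i ≠ 0) (hxy : ∀ i j, 0 < 1 - x i * y j) :
    (cauM x y).det ^ 2 =
      ((Matrix.vandermonde x).det * (Matrix.vandermonde y).det *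
      (∏ i, ∏ j, (1 - x i * y j))⁻¹) ^ 2 := by
  have h := cauM_det_sq x y hx hy hy0 (fun i j => (hxy i j).ne')
  have hsq : ∀ u : Fin M → ℝ, |∏ i, ∏ l ∈ Finset.univ.erase i, (u i - u l)| =
      (Matrix.vandermonde u).det ^ 2 := by
    intro u
    rw [Matrix.det_vandermonde, ← sq_abs, Finset.abs_prod, Finset.abs_prod]
    simp_rw [Finset.abs_prod]
    have : ∀ i : Fin M, ∏ l ∈ Finset.univ.erase i, |u i - u l| =
        (∏ l ∈ Finset.Ioi i, |u l - u i|) * ∏ l ∈ Finset.Iio i, |u i - u l| := by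
      intro i
      have hd : Finset.univ.erase i = Finset.Ioi i ∪ Finset.Iio i := by
        ext l; simp [lt_or_lt_iff_ne, eq_comm, ne_comm]
      rw [hd, Finset.prod_union]
      · congr 1
        exact Finset.prod_congr rfl fun l _ => abs_sub_comm _ _
      · rw [Finset.disjoint_left]
        intro a ha hb
        simp at ha hb
        exact absurd ha (not_lt.2 hb.le)
    simp_rw [this]
    rw [Finset.prod_mul_distrib, sq]
    congr 1
    rw [Finset.prod_comm' (s' := fun l => Finset.Ioi l) (t' := Finset.univ)]
    intro a b; simp
  have hA : ∀ (x y : Fin M → ℝ), Function.Injective x → (∀ i j, 0 < 1 - x i * y j) →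
      |∏ i, alph x y i| * (Matrix.vandermonde x).det ^ 2 = ∏ i, ∏ j, (1 - x i * y j) := by
    intro x y hx hxy
    simp_rw [alph]
    rw [Finset.prod_div_distrib, abs_div, hsq, abs_of_pos (Finset.prod_pos fun i _ =>
      Finset.prod_pos fun j _ => hxy i j)]
    have : (Matrix.vandermonde x).det ≠ 0 := Matrix.det_vandermonde_ne_zero_iff.2 hx
    field_simp
  have h1 := hA x y hx hxy
  have h2 := hA y x hy (fun i j => by rw [mul_comm]; exact hxy j i)
  have h3 : ∏ i, ∏ j, (1 - y i * x j) = ∏ i, ∏ j, (1 - x i * y j) := by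
    rw [Finset.prod_comm]
    exact Finset.prod_congr rfl fun i _ => Finset.prod_congr rfl fun j _ => by ring
  rw [h3] at h2
  have hP : 0 < ∏ i, ∏ j, (1 - x i * y j) := Finset.prod_pos fun i _ =>
      Finset.prod_pos fun j _ => hxy i j
  have h4 := congrArg abs h
  rw [abs_mul, abs_mul, abs_one, abs_of_nonneg (sq_nonneg _)] at h4
  set P := ∏ i, ∏ j, (1 - x i * y j)
  have hv1 : (Matrix.vandermonde x).det ≠ 0 := Matrix.det_vandermonde_ne_zero_iff.2 hx
  have hv2 : (Matrix.vandermonde y).det ≠ 0 := Matrix.det_vandermonde_ne_zero_iff.2 hy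
  set v1 := (Matrix.vandermonde x).det
  set v2 := (Matrix.vandermonde y).det
  have e1 : |∏ i, alph x y i| = P / v1 ^ 2 := by rw [eq_div_iff (by positivity)]; exact h1
  have e2 : |∏ i, alph y x i| = P / v2 ^ 2 := by rw [eq_div_iff (by positivity)]; exact h2
  rw [e1, e2] at h4
  field_simp at h4 ⊢
  linarith


/-- extension of a finite sequence by zero -/
def extz {M : ℕ} (f : Fin M → ℕ) (i : ℕ) : ℕ := if h : i < M then f ⟨i, h⟩ else 0

lemma extz_of_lt {M : ℕ} (f : Fin M → ℕ) {i : ℕ} (h : i < M) : extz f i = f ⟨i, h⟩ := by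
  simp [extz, h]

lemma extz_of_ge {M : ℕ} (f : Fin M → ℕ) {i : ℕ} (h : M ≤ i) : extz f i = 0 := by
  simp [extz, not_lt.2 h]

/-- triangular arrays -/
def Tri (M : ℕ) (l : ℕ → ℕ) (T : ℕ → ℕ → ℕ) : Prop :=
  T 0 = l ∧ (∀ d i, T (d + 1) i ≤ T d i) ∧ (∀ d i, T d (i + 1) ≤ T (d + 1) i) ∧
    ∀ d i, M ≤ d + i → T d i = 0

def triWt (M : ℕ) (T : ℕ → ℕ → ℕ) : ℕ :=
  ∑ d ∈ Finset.range M, ∑ i ∈ Finset.range M, T (d + 1) i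

/-- the recursive sum -/
def Srec (Q : ℝ) : ℕ → (ℕ → ℕ) → ℝ
  | 0, _ => 1
  | M + 1, l => ∑ f ∈ Fintype.piFinset (fun j : Fin M => Finset.Icc (l (j + 1)) (l j)),
      Q ^ (∑ j, f j) * Srec Q M (extz f)

lemma Srec_nonneg {Q : ℝ} (hQ : 0 ≤ Q) (M : ℕ) : ∀ l, 0 ≤ Srec Q M l := by
  induction M with
  | zero => intro l; simp [Srec]
  | succ M ih =>
    intro l; rw [Srec]
    exact Finset.sum_nonneg fun f _ => mul_nonneg (by positivity) (ih _)

def triEquiv (M : ℕ) (l : ℕ → ℕ) (hl : ∀ i, M + 1 ≤ i → l i = 0) :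
    {T // Tri (M + 1) l T} ≃
    Σ f : {f // f ∈ Fintype.piFinset (fun j : Fin M => Finset.Icc (l (j + 1)) (l j))},
      {T // Tri M (extz f.1) T} where
  toFun T := ⟨⟨fun j => T.1 1 j, by
      rw [Fintype.mem_piFinset]
      intro j
      obtain ⟨T, h0, h1, h2, h3⟩ := T
      subst h0
      simp only [Finset.mem_Icc]
      exact ⟨h2 0 j, h1 0 j⟩⟩, ⟨fun d => T.1 (d + 1), by
      obtain ⟨T, h0, h1, h2, h3⟩ := T
      refine ⟨?_, fun d i => h1 _ _, fun d i => h2 _ _, fun d i h => h3 _ _ (by omega)⟩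
      ext i
      by_cases hi : i < M
      · simp [extz, hi]
      · simp [extz, hi]; exact h3 _ _ (by omega)⟩⟩
  invFun p := ⟨fun d => if d = 0 then l else p.2.1 (d - 1), by
      obtain ⟨⟨f, hf⟩, ⟨T, h0, h1, h2, h3⟩⟩ := p
      rw [Fintype.mem_piFinset] at hf
      refine ⟨by simp, ?_, ?_, ?_⟩
      · intro d i
        rcases d with _ | d
        · simp only [zero_add, one_ne_zero, if_false, if_true, Nat.sub_self]
          rw [h0]
          by_cases hi : i < M
          · simp only at *
            rw [extz_of_lt f hi]; exact (Finset.mem_Icc.1 (hf ⟨i, hi⟩)).2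
          · simp only; rw [extz_of_ge f (not_lt.1 hi)]; exact Nat.zero_le _
        · simpa using h1 d i
      · intro d i
        rcases d with _ | d
        · simp only [zero_add, one_ne_zero, if_false, if_true, Nat.sub_self]
          rw [h0]
          by_cases hi : i < M
          · simp only at *
            rw [extz_of_lt f hi]; exact (Finset.mem_Icc.1 (hf ⟨i, hi⟩)).1
          · rw [hl _ (by omega)]; exact Nat.zero_le _
        · simpa using h2 d i
      · intro d i h
        rcases d with _ | d
        · simpa using hl i (by omega)
        · simpa using h3 d i (by omega)⟩
  left_inv T := by
    apply Subtype.ext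
    obtain ⟨T, h0, h1, h2, h3⟩ := T
    funext d
    rcases d with _ | d
    · simp [h0]
    · simp
  right_inv p := by
    apply Sigma.subtype_ext
    · apply Subtype.ext
      obtain ⟨⟨f, hf⟩, ⟨T, h0, h1, h2, h3⟩⟩ := p
      funext j
      simp [h0, extz]
    · rfl

lemma triWt_succ {M : ℕ} {l : ℕ → ℕ} {T : ℕ → ℕ → ℕ} (hT : Tri (M + 1) l T) :
    triWt (M + 1) T = ∑ j : Fin M, T 1 j + triWt M (fun d => T (d + 1)) := by
  obtain ⟨h0, h1, h2, h3⟩ := hT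
  have : ∀ d, ∑ i ∈ Finset.range (M + 1), T (d + 1) i = ∑ i ∈ Finset.range M, T (d + 1) i := by
    intro d
    rw [Finset.sum_range_succ, h3 (d + 1) M (by omega), add_zero]
  unfold triWt
  simp_rw [this]
  rw [Finset.sum_range_succ', add_comm, ← Fin.sum_univ_eq_sum_range]

lemma tri_sum (Q : ℝ) (hQ : 0 < Q) (M : ℕ) : ∀ (l : ℕ → ℕ) (_ : ∀ i, M ≤ i → l i = 0),
    ∑' T : {T // Tri M l T}, ENNReal.ofReal (Q ^ triWt M T.1) = ENNReal.ofReal (Srec Q M l) := by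
  induction M with
  | zero =>
    intro l hl
    have : ∀ T : {T // Tri 0 l T}, T = ⟨fun _ _ => 0, by
        refine ⟨?_, by simp, by simp, by simp⟩
        ext i; exact (hl i (Nat.zero_le _)).symm⟩ := by
      rintro ⟨T, h0, h1, h2, h3⟩
      apply Subtype.ext
      funext d i
      exact h3 d i (Nat.zero_le _)
    rw [tsum_eq_single _ (fun b hb => absurd (this b) hb)]
    simp [triWt, Srec]
  | succ M ih =>
    intro l hl
    rw [← (triEquiv M l hl).symm.tsum_eq, ENNReal.tsum_sigma', Srec,
      ENNReal.ofReal_sum_of_nonneg (fun f _ => mul_nonneg (by positivity) (Srec_nonneg hQ.le _ _))]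
    rw [← Finset.tsum_subtype]
    refine tsum_congr fun f => ?_
    rw [ENNReal.ofReal_mul (by positivity), ← ih (extz f.1) (fun i hi => extz_of_ge _ hi),
      ← ENNReal.tsum_mul_left]
    refine tsum_congr fun T => ?_
    rw [← ENNReal.ofReal_mul (by positivity), ← pow_add]
    have := triWt_succ ((triEquiv M l hl).symm ⟨f, T⟩).2
    rw [this]
    have e := (triEquiv M l hl).apply_symm_apply ⟨f, T⟩
    congr 3
    · refine Finset.sum_congr rfl fun j _ => ?_
      have h1 := T.2.1
      change T.1 0 j = f.1 j
      rw [h1]; simp [extz]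

lemma Srec_succ_det (Q : ℝ) (hQ0 : 0 < Q) (hQ1 : Q < 1) (M : ℕ) : ∃ V : ℝ, V ≠ 0 ∧
    ∀ (l : ℕ → ℕ), (∀ i < M, l (i + 1) ≤ l i) →
    ∑ f ∈ Fintype.piFinset (fun j : Fin M => Finset.Icc (l (j + 1)) (l j)),
      Q ^ (∑ j, f j) * (Matrix.of fun i j : Fin M => Q ^ ((i : ℕ) * (f j + (M - 1 - j)))).det =
    V * (Matrix.of fun i j : Fin (M + 1) => Q ^ ((i : ℕ) * (l j + (M - j)))).det := by
  refine ⟨(∏ j : Fin M, Q ^ (M - 1 - (j : ℕ)))⁻¹ * (∏ i : Fin M, (Q ^ ((i : ℕ) + 1) - 1)⁻¹) *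
    (-1) ^ M, ?_, ?_⟩
  · refine mul_ne_zero (mul_ne_zero ?_ ?_) (by simp)
    · exact inv_ne_zero (Finset.prod_ne_zero_iff.2 fun j _ => by positivity)
    · refine Finset.prod_ne_zero_iff.2 fun j _ => inv_ne_zero ?_
      have : Q ^ ((j : ℕ) + 1) < 1 := pow_lt_one₀ hQ0.le hQ1 (by omega)
      linarith
  intro l hl
  have h1 : ∀ f : Fin M → ℕ, Q ^ (∑ j, f j) *
      (Matrix.of fun i j : Fin M => Q ^ ((i : ℕ) * (f j + (M - 1 - j)))).det =
      (∏ j : Fin M, Q ^ (M - 1 - (j : ℕ)))⁻¹ *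
      (Matrix.of fun j i : Fin M => Q ^ (((i : ℕ) + 1) * (f j + (M - 1 - j)))).det := by
    intro f
    have h2 := Matrix.det_mul_column (fun j : Fin M => Q ^ (f j + (M - 1 - (j : ℕ))))
      (Matrix.of fun j i : Fin M => Q ^ ((i : ℕ) * (f j + (M - 1 - j))))
    have h3 : (Matrix.of fun j i : Fin M => Q ^ (((i : ℕ) + 1) * (f j + (M - 1 - j)))) =
      Matrix.of fun j i => Q ^ (f j + (M - 1 - (j : ℕ))) *
        (Matrix.of fun j i : Fin M => Q ^ ((i : ℕ) * (f j + (M - 1 - j)))) j i := by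
      ext j i; simp only [Matrix.of_apply]; rw [← pow_add]; congr 1; ring
    rw [h3, h2, ← Matrix.det_transpose (Matrix.of fun j i : Fin M => Q ^ ((i : ℕ) * (f j + (M - 1 - j))))]
    have h4 : (Matrix.of fun j i : Fin M => Q ^ ((i : ℕ) * (f j + (M - 1 - j)))).transpose =
      (Matrix.of fun i j : Fin M => Q ^ ((i : ℕ) * (f j + (M - 1 - j)))) := rfl
    rw [h4, Finset.prod_congr rfl fun j _ => pow_add _ _ _, Finset.prod_mul_distrib]
    have : ∏ j : Fin M, Q ^ (M - 1 - (j : ℕ)) ≠ 0 :=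
      Finset.prod_ne_zero_iff.2 fun j _ => by positivity
    rw [Finset.prod_pow_eq_pow_sum _ f]
    field_simp
  rw [Finset.sum_congr rfl fun f _ => h1 f, ← Finset.mul_sum, mul_assoc, mul_assoc]
  congr 1
  have h5 : ∑ f ∈ Fintype.piFinset (fun j : Fin M => Finset.Icc (l (j + 1)) (l j)),
      (Matrix.of fun j i : Fin M => Q ^ (((i : ℕ) + 1) * (f j + (M - 1 - j)))).det =
      (Matrix.of fun j i : Fin M => ∑ m ∈ Finset.Icc (l (j + 1)) (l j),
        Q ^ (((i : ℕ) + 1) * (m + (M - 1 - j)))).det := by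
    have := MultilinearMap.map_sum_finset (Matrix.detRowAlternating (R := ℝ) (n := Fin M)).toMultilinearMap
      (fun (j : Fin M) (m : ℕ) => (fun i : Fin M => Q ^ (((i : ℕ) + 1) * (m + (M - 1 - (j : ℕ))))))
      (fun j : Fin M => Finset.Icc (l (j + 1)) (l j))
    rw [show (Matrix.of fun j i : Fin M => ∑ m ∈ Finset.Icc (l (j + 1)) (l j),
        Q ^ (((i : ℕ) + 1) * (m + (M - 1 - j)))) = (fun j : Fin M => ∑ m ∈ Finset.Icc (l (j + 1)) (l j),
        (fun i : Fin M => Q ^ (((i : ℕ) + 1) * (m + (M - 1 - (j : ℕ)))))) from by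
          ext j i; simp [Finset.sum_apply]]
    exact this.symm
  rw [h5]
  have h6 : ∀ j i : Fin M, ∑ m ∈ Finset.Icc (l (j + 1)) (l j),
        Q ^ (((i : ℕ) + 1) * (m + (M - 1 - j))) = (Q ^ ((i : ℕ) + 1) - 1)⁻¹ *
        (Q ^ (((i : ℕ) + 1) * (l j + (M - j))) - Q ^ (((i : ℕ) + 1) * (l (j + 1) + (M - (j + 1))))) := by
    intro j i
    have hlt : Q ^ ((i : ℕ) + 1) < 1 := pow_lt_one₀ hQ0.le hQ1 (by omega)
    have e : ∀ m, Q ^ (((i : ℕ) + 1) * (m + (M - 1 - j))) =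
        (Q ^ ((i : ℕ) + 1)) ^ m * (Q ^ ((i : ℕ) + 1)) ^ (M - 1 - (j : ℕ)) := by
      intro m; rw [pow_mul, pow_add]
    simp_rw [e]
    rw [← Finset.sum_mul]
    have hle := hl j j.2
    have : Finset.Icc (l (j + 1)) (l j) = Finset.Ico (l (j + 1)) (l j + 1) := by
      ext m; simp
    rw [this, geom_sum_Ico hlt.ne (by omega)]
    rw [pow_mul, pow_mul, show M - (j : ℕ) = (M - 1 - j) + 1 by omega,
      show M - ((j : ℕ) + 1) = (M - 1 - j) by omega]
    have : Q ^ ((i : ℕ) + 1) - 1 ≠ 0 := by linarith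
    field_simp
    ring
  have h7 : (Matrix.of fun j i : Fin M => ∑ m ∈ Finset.Icc (l (j + 1)) (l j),
        Q ^ (((i : ℕ) + 1) * (m + (M - 1 - j)))).det =
      (∏ i : Fin M, (Q ^ ((i : ℕ) + 1) - 1)⁻¹) * ((-1) ^ M *
      (Matrix.of fun j i : Fin M => Q ^ (((i : ℕ) + 1) * (l (j + 1) + (M - (j + 1)))) -
       Q ^ (((i : ℕ) + 1) * (l j + (M - j)))).det) := by
    simp_rw [h6]
    have := Matrix.det_mul_row (fun i : Fin M => (Q ^ ((i : ℕ) + 1) - 1)⁻¹)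
      (Matrix.of fun j i : Fin M => (Q ^ (((i : ℕ) + 1) * (l j + (M - j))) -
        Q ^ (((i : ℕ) + 1) * (l (j + 1) + (M - (j + 1))))))
    simp only [Matrix.of_apply] at this
    rw [this]
    congr 1
    have h8 := Matrix.det_neg (Matrix.of fun j i : Fin M =>
      Q ^ (((i : ℕ) + 1) * (l (j + 1) + (M - (j + 1)))) - Q ^ (((i : ℕ) + 1) * (l j + (M - j))))
    rw [Fintype.card_fin] at h8
    rw [← h8]
    congr 1
    ext j i
    simp
  rw [h7]
  congr 2
  rw [← Matrix.det_transpose (Matrix.of fun i j : Fin (M + 1) => Q ^ ((i : ℕ) * (l j + (M - j))))]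
  rw [Matrix.det_eq_of_forall_row_eq_smul_add_pred (n := M)
    (B := Matrix.of fun j i : Fin (M + 1) => if (j : ℕ) = 0 then Q ^ ((i : ℕ) * (l j + (M - j))) else
      Q ^ ((i : ℕ) * (l j + (M - j))) - Q ^ ((i : ℕ) * (l (j - 1) + (M - (j - 1))))) (fun _ => 1)]
  · rw [Matrix.det_succ_column_zero, Finset.sum_eq_single 0]
    · simp
      congr 1
    · intro j _ hj
      have : (j : ℕ) ≠ 0 := fun h => hj (Fin.ext h)
      simp [hj]
    · simp
  · intro j; simp
  · intro j i
    simp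

lemma Srec_det (Q : ℝ) (hQ0 : 0 < Q) (hQ1 : Q < 1) (M : ℕ) : ∃ V : ℝ, V ≠ 0 ∧
    ∀ (l : ℕ → ℕ), (∀ i, l (i + 1) ≤ l i) → Srec Q M l =
    V * (Matrix.of fun i j : Fin M => Q ^ ((i : ℕ) * (l j + (M - 1 - j)))).det := by
  induction M with
  | zero => exact ⟨1, one_ne_zero, fun l _ => by simp [Srec]⟩
  | succ M ih =>
    obtain ⟨V, hV, ih⟩ := ih
    obtain ⟨V', hV', h'⟩ := Srec_succ_det Q hQ0 hQ1 M
    refine ⟨V * V', mul_ne_zero hV hV', fun l hl => ?_⟩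
    rw [Srec, Nat.add_sub_cancel, mul_assoc, ← h' l (fun i _ => hl i), Finset.mul_sum]
    refine Finset.sum_congr rfl fun f hf => ?_
    rw [Fintype.mem_piFinset] at hf
    rw [ih]
    · rw [mul_left_comm]
      congr 4
      ext i j
      simp [extz]
    · intro i
      by_cases hi : i + 1 < M
      · rw [extz_of_lt _ hi, extz_of_lt _ (by omega)]
        exact ((Finset.mem_Icc.1 (hf ⟨i + 1, hi⟩)).2).trans
          (Finset.mem_Icc.1 (hf ⟨i, by omega⟩)).1
      · rw [extz_of_ge _ (by omega)]; exact Nat.zero_le _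


def inBox (M : ℕ) (Λ : PlanePartition ⊤ ⊤) : Prop := ∀ i j, (M ≤ i ∨ M ≤ j) → Λ.part i j = 0

lemma pp_anti (Λ : PlanePartition ⊤ ⊤) (i j : ℕ) : Λ.part i j ≤ Λ.part 0 0 := by
  have h1 : ∀ i, Λ.part i j ≤ Λ.part 0 j := by
    intro i
    induction i with
    | zero => exact le_rfl
    | succ i ih => exact (Λ.antitone_fst i j).trans ih
  have h2 : ∀ j, Λ.part 0 j ≤ Λ.part 0 0 := by
    intro j
    induction j with
    | zero => exact le_rfl
    | succ j ih => exact (Λ.antitone_snd 0 j).trans ih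
  exact (h1 i).trans (h2 j)

def ppEquiv (M n : ℕ) :
    {Λ : PlanePartition ⊤ ⊤ // inBox M Λ ∧ Λ.part 0 0 ≤ n} ≃
    Σ f : {f // f ∈ Fintype.piFinset (fun _ : Fin M => Finset.range (n + 1))},
      {p : (ℕ → ℕ → ℕ) × (ℕ → ℕ → ℕ) // Tri M (extz f.1) p.1 ∧ Tri M (extz f.1) p.2} where
  toFun Λ := ⟨⟨fun j => Λ.1.part j j, by
      rw [Fintype.mem_piFinset]
      intro j
      rw [Finset.mem_range]
      exact Nat.lt_succ_of_le ((pp_anti _ _ _).trans Λ.2.2)⟩,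
      ⟨(fun d i => Λ.1.part (i + d) i, fun d i => Λ.1.part i (i + d)), by
      obtain ⟨Λ, hb, hn⟩ := Λ
      have hdiag : (fun i => Λ.part i i) = extz (fun j : Fin M => Λ.part j j) := by
        ext i
        by_cases hi : i < M
        · simp [extz, hi]
        · simp [extz, hi]; exact hb _ _ (by omega)
      refine ⟨⟨hdiag, fun d i => Λ.antitone_fst _ _, fun d i => ?_, fun d i h => hb _ _ (by omega)⟩,
        ⟨hdiag, fun d i => Λ.antitone_snd _ _, fun d i => ?_, fun d i h => hb _ _ (by omega)⟩⟩
      · have := Λ.antitone_snd (i + d + 1) i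
        simp only
        rw [show i + 1 + d = i + d + 1 by ring, show i + (d + 1) = i + d + 1 by ring]
        exact this
      · have := Λ.antitone_fst i (i + d + 1)
        simp only
        rw [show i + 1 + d = i + d + 1 by ring, show i + (d + 1) = i + d + 1 by ring]
        exact this⟩⟩
  invFun p := ⟨{
      part := fun i j => if j ≤ i then p.2.1.1 (i - j) j else p.2.1.2 (j - i) i
      antitone_fst := by
        obtain ⟨⟨f, hf⟩, ⟨⟨L, R⟩, ⟨h0, h1, h2, h3⟩, ⟨g0, g1, g2, g3⟩⟩⟩ := p
        change L 0 = extz f at h0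
        change R 0 = extz f at g0
        intro i j
        simp only at *
        rcases lt_trichotomy i j with h | h | h
        · rw [if_neg (not_le.2 h)]
          obtain ⟨d, rfl⟩ := Nat.exists_eq_add_of_lt h
          have := g2 d i
          rw [show i + d + 1 - i = d + 1 by omega]
          by_cases h4 : d = 0
          · subst h4
            simpa [h0, g0] using this
          · rw [if_neg (by omega), show i + d + 1 - (i + 1) = d by omega]
            exact this
        · subst h
          have := h1 0 i
          simpa using this
        · rw [if_pos (by omega), if_pos (by omega), show i + 1 - j = (i - j) + 1 by omega]
          exact h1 _ _
      antitone_snd := by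
        obtain ⟨⟨f, hf⟩, ⟨⟨L, R⟩, ⟨h0, h1, h2, h3⟩, ⟨g0, g1, g2, g3⟩⟩⟩ := p
        change L 0 = extz f at h0
        change R 0 = extz f at g0
        intro i j
        simp only at *
        rcases lt_trichotomy i j with h | h | h
        · rw [if_neg (by omega), if_neg (by omega), show j + 1 - i = (j - i) + 1 by omega]
          exact g1 _ _
        · subst h
          have := g1 0 i
          simpa [h0, g0] using this
        · obtain ⟨d, rfl⟩ := Nat.exists_eq_add_of_lt h
          rw [if_pos (by omega), if_pos (by omega), show j + d + 1 - (j + 1) = d by omega,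
            show j + d + 1 - j = d + 1 by omega]
          exact h2 _ _
      supp_fst := by intro i j h; simp at h
      supp_snd := by intro i j h; simp at h
      finite_supp := by
        obtain ⟨⟨f, hf⟩, ⟨⟨L, R⟩, ⟨h0, h1, h2, h3⟩, ⟨g0, g1, g2, g3⟩⟩⟩ := p
        change L 0 = extz f at h0
        change R 0 = extz f at g0
        apply Set.Finite.subset (Finset.finite_toSet (Finset.range M ×ˢ Finset.range M))
        rintro ⟨i, j⟩ h
        simp only [Set.mem_ofPred_eq] at h
        simp only [Finset.coe_product, Finset.coe_range, Set.mem_prod, Set.mem_Iio]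
        by_contra hc
        apply h
        split_ifs with hij
        · exact h3 _ _ (by omega)
        · exact g3 _ _ (by omega) }, by
        obtain ⟨⟨f, hf⟩, ⟨⟨L, R⟩, ⟨h0, h1, h2, h3⟩, ⟨g0, g1, g2, g3⟩⟩⟩ := p
        change L 0 = extz f at h0
        change R 0 = extz f at g0
        constructor
        · intro i j h
          simp only
          split_ifs with hij
          · exact h3 _ _ (by omega)
          · exact g3 _ _ (by omega)
        · simp only at *
          simp only [le_refl, if_true, Nat.sub_self]
          rw [h0]
          by_cases hM : 0 < M
          · rw [extz_of_lt _ hM]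
            rw [Fintype.mem_piFinset] at hf
            exact Nat.le_of_lt_succ (Finset.mem_range.1 (hf ⟨0, hM⟩))
          · rw [extz_of_ge _ (by omega)]; exact Nat.zero_le _⟩
  left_inv Λ := by
    apply Subtype.ext
    obtain ⟨Λ, hb, hn⟩ := Λ
    obtain ⟨p, h1, h2, h3, h4, h5⟩ := Λ
    simp only [PlanePartition.mk.injEq]
    funext i j
    split_ifs with h
    · rw [show j + (i - j) = i by omega]
    · rw [show i + (j - i) = j by omega]
  right_inv p := by
    obtain ⟨⟨f, hf⟩, ⟨⟨L, R⟩, ⟨h0, h1, h2, h3⟩, ⟨g0, g1, g2, g3⟩⟩⟩ := p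
    change L 0 = extz f at h0
    change R 0 = extz f at g0
    apply Sigma.subtype_ext
    · apply Subtype.ext
      funext j
      simp only at *
      simp [h0, extz]
    · simp only at *
      refine Prod.ext ?_ ?_
      · funext d i
        simp
      · funext d i
        simp only
        split_ifs with h
        · have : d = 0 := by omega
          subst this
          simp [h0, g0]
        · simp

lemma leftVol_eq (M : ℕ) (Λ : PlanePartition ⊤ ⊤) (hb : inBox M Λ) :
    Λ.leftVol = triWt M (fun d i => Λ.part (i + d) i) := by
  unfold PlanePartition.leftVol triWt
  rw [← Finset.sum_product']
  rw [finsum_eq_sum_of_support_subset (s := (Finset.range M ×ˢ Finset.range M).image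
    (fun p => (p.2 + p.1 + 1, p.2)))]
  · rw [Finset.sum_image]
    · refine Finset.sum_congr rfl fun p _ => ?_
      simp only
      rw [if_pos (by omega)]
      rfl
    · rintro ⟨a, b⟩ _ ⟨c, d⟩ _ h
      simp only [Prod.mk.injEq] at h ⊢
      omega
  · rintro ⟨i, j⟩ h
    simp only [Function.mem_support] at h
    split_ifs at h with hij
    · simp only [Finset.coe_image, Set.mem_image, Finset.mem_coe, Finset.mem_product,
        Finset.mem_range]
      by_cases hM : M ≤ i ∨ M ≤ j
      · exact absurd (hb _ _ hM) h
      · exact ⟨(i - j - 1, j), by simp only; omega, Prod.ext (show j + (i - j - 1) + 1 = i by omega) rfl⟩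
    · exact absurd rfl h

lemma rightVol_eq (M : ℕ) (Λ : PlanePartition ⊤ ⊤) (hb : inBox M Λ) :
    Λ.rightVol = triWt M (fun d i => Λ.part i (i + d)) := by
  unfold PlanePartition.rightVol triWt
  rw [← Finset.sum_product']
  rw [finsum_eq_sum_of_support_subset (s := (Finset.range M ×ˢ Finset.range M).image
    (fun p => (p.2, p.2 + p.1 + 1)))]
  · rw [Finset.sum_image]
    · refine Finset.sum_congr rfl fun p _ => ?_
      simp only
      rw [if_pos (by omega)]
      rfl
    · rintro ⟨a, b⟩ _ ⟨c, d⟩ _ h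
      simp only [Prod.mk.injEq] at h ⊢
      omega
  · rintro ⟨i, j⟩ h
    simp only [Function.mem_support] at h
    split_ifs at h with hij
    · simp only [Finset.coe_image, Set.mem_image, Finset.mem_coe, Finset.mem_product,
        Finset.mem_range]
      by_cases hM : M ≤ i ∨ M ≤ j
      · exact absurd (hb _ _ hM) h
      · exact ⟨(j - i - 1, i), by simp only; omega, Prod.ext rfl (show i + (j - i - 1) + 1 = j by omega)⟩
    · exact absurd rfl h

lemma centralVol_eq (M : ℕ) (Λ : PlanePartition ⊤ ⊤) (hb : inBox M Λ) :
    Λ.centralVol = ∑ j : Fin M, Λ.part j j := by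
  unfold PlanePartition.centralVol
  rw [finsum_eq_sum_of_support_subset (s := Finset.range M)]
  · exact (Fin.sum_univ_eq_sum_range (fun i => Λ.part i i) M).symm
  · intro i h
    simp only [Function.mem_support] at h
    simp only [Finset.coe_range, Set.mem_Iio]
    by_contra hc
    exact h (hb _ _ (by omega))

/-- abstract weight -/
def wgt (Q c Q' : ℝ) (Λ : PlanePartition ⊤ ⊤) : ℝ := Q ^ Λ.leftVol * c ^ Λ.centralVol * Q' ^ Λ.rightVol

lemma box_sum (Q c Q' : ℝ) (hQ : 0 < Q) (hc : 0 < c) (hQ' : 0 < Q') (M n : ℕ) :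
    ∑' Λ : {Λ : PlanePartition ⊤ ⊤ // inBox M Λ ∧ Λ.part 0 0 ≤ n}, ENNReal.ofReal (wgt Q c Q' Λ.1) =
    ENNReal.ofReal (∑ f ∈ Fintype.piFinset (fun _ : Fin M => Finset.range (n + 1)),
      c ^ (∑ j, f j) * (Srec Q M (extz f) * Srec Q' M (extz f))) := by
  rw [← (ppEquiv M n).symm.tsum_eq, ENNReal.tsum_sigma',
      ENNReal.ofReal_sum_of_nonneg (fun f _ => mul_nonneg (by positivity)
        (mul_nonneg (Srec_nonneg hQ.le _ _) (Srec_nonneg hQ'.le _ _)))]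
  rw [← Finset.tsum_subtype]
  refine tsum_congr fun f => ?_
  rw [ENNReal.ofReal_mul (by positivity), ENNReal.ofReal_mul (Srec_nonneg hQ.le _ _),
    ← tri_sum Q hQ M (extz f.1) (fun i hi => extz_of_ge _ hi),
    ← tri_sum Q' hQ' M (extz f.1) (fun i hi => extz_of_ge _ hi)]
  rw [← ENNReal.tsum_mul_right, ← ENNReal.tsum_mul_left]
  simp_rw [← ENNReal.tsum_mul_left]
  rw [← ENNReal.tsum_prod, ← (Equiv.subtypeProdEquivProd).tsum_eq]
  refine tsum_congr fun p => ?_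
  rw [← ENNReal.ofReal_mul (by positivity), ← ENNReal.ofReal_mul (by positivity)]
  congr 1
  have hΛ := ((ppEquiv M n).symm ⟨f, p⟩).2.1
  rw [wgt, leftVol_eq M _ hΛ, rightVol_eq M _ hΛ, centralVol_eq M _ hΛ]
  have e := (ppEquiv M n).apply_symm_apply ⟨f, p⟩
  generalize (ppEquiv M n).symm ⟨f, p⟩ = Λ at *
  obtain ⟨e1, e2⟩ := Sigma.mk.inj_iff.1 e
  subst e1
  have e3 := eq_of_heq e2
  subst e3
  simp only [Equiv.subtypeProdEquivProd, Equiv.coe_fn_mk]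
  ring

lemma Srec_eq_zero (Q : ℝ) (hQ : 0 < Q) (M : ℕ) (f : Fin M → ℕ) (hf : ¬ Antitone f) :
    Srec Q M (extz f) = 0 := by
  have h := tri_sum Q hQ M (extz f) (fun i hi => extz_of_ge _ hi)
  have : IsEmpty {T // Tri M (extz f) T} := by
    constructor
    rintro ⟨T, h0, h1, h2, h3⟩
    apply hf
    have hanti : Antitone (extz f) := antitone_nat_of_succ_le fun i => by
      have a := h1 0 i
      have b := h2 0 i
      rw [h0] at a b
      exact b.trans a
    intro i j hij
    have := hanti (show (i : ℕ) ≤ j from hij)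
    rwa [extz_of_lt _ i.2, extz_of_lt _ j.2] at this
  rw [tsum_empty] at h
  have := ENNReal.ofReal_eq_zero.1 h.symm
  exact le_antisymm this (Srec_nonneg hQ.le _ _)


lemma strictMono_fin_gap {M N : ℕ} (g : Fin M → Fin N) (hg : StrictMono g) :
    ∀ (d : ℕ) (k k' : Fin M), (k : ℕ) + d = k' → (g k : ℕ) + d ≤ g k' := by
  intro d
  induction d with
  | zero => intro k k' h; have : k = k' := Fin.ext (by simpa using h); simp [this]
  | succ d ih =>
    intro k k' h
    have h1 := ih k ⟨k + d, by omega⟩ rfl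
    have h2 : g ⟨k + d, by omega⟩ < g k' := hg (by rw [Fin.lt_def]; simp only; omega)
    have h3 : (g ⟨k + d, by omega⟩ : ℕ) < g k' := h2
    omega

lemma antitone_sum_eq (M n : ℕ) (F : (Fin M → ℕ) → ℝ) :
    ∑ f ∈ Fintype.piFinset (fun _ : Fin M => Finset.range (n + 1)) with Antitone f,
      F (fun j => f (Fin.rev j) + j) =
    ∑ g : Fin M → Fin (n + M) with StrictMono g, F (fun j => g j) := by
  refine Finset.sum_bij' (fun f hf k => ⟨f (Fin.rev k) + k, ?_⟩)
    (fun g _ j => (g (Fin.rev j) : ℕ) - (Fin.rev j : ℕ)) ?_ ?_ ?_ ?_ ?_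
  · simp only [Finset.mem_filter, Fintype.mem_piFinset, Finset.mem_range] at hf
    have := hf.1 (Fin.rev k)
    have := k.2
    omega
  · intro f hf
    simp only [Finset.mem_filter, Fintype.mem_piFinset, Finset.mem_range, Finset.mem_univ,
      true_and] at hf ⊢
    intro k k' h
    rw [Fin.lt_def]
    have h1 : f (Fin.rev k) ≤ f (Fin.rev k') := hf.2 (Fin.rev_le_rev.2 h.le)
    have : (k : ℕ) < k' := h
    simp only
    omega
  · intro g hg
    simp only [Finset.mem_filter, Fintype.mem_piFinset, Finset.mem_range, Finset.mem_univ,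
      true_and] at hg ⊢
    refine ⟨fun j => ?_, fun j j' h => ?_⟩
    · have h1 := strictMono_fin_gap g hg (M - 1 - (Fin.rev j : ℕ)) (Fin.rev j) ⟨M - 1, by have := j.2; omega⟩
        (by simp only; have := (Fin.rev j).2; omega)
      have h2 := (g ⟨M - 1, by have := j.2; omega⟩).2
      have := (Fin.rev j).2
      omega
    · have hr : (Fin.rev j' : ℕ) ≤ Fin.rev j := Fin.rev_le_rev.2 h
      have h1 := strictMono_fin_gap g hg ((Fin.rev j : ℕ) - Fin.rev j') (Fin.rev j') (Fin.rev j)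
        (by omega)
      have h2 := strictMono_fin_gap g hg (Fin.rev j' : ℕ) ⟨0, by have := j.2; omega⟩ (Fin.rev j') (by simp)
      simp only
      omega
  · intro f hf
    funext j
    simp
  · intro g hg
    simp only [Finset.mem_filter, Finset.mem_univ, true_and] at hg
    funext k
    apply Fin.ext
    have h2 := strictMono_fin_gap g hg (k : ℕ) ⟨0, by have := k.2; omega⟩ k (by simp)
    simp only [Fin.rev_rev]
    omega
  · intro f hf
    rfl

lemma box_det (Q c Q' p p' : ℝ) (hQ : 0 < Q) (hQ1 : Q < 1) (hQ' : 0 < Q') (hQ1' : Q' < 1)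
    (hc : 0 < c) (hp : c = p * p') (M : ℕ) :
    ∃ κ : ℝ, ∀ n : ℕ, ∑ f ∈ Fintype.piFinset (fun _ : Fin M => Finset.range (n + 1)),
      c ^ (∑ j, f j) * (Srec Q M (extz f) * Srec Q' M (extz f)) =
      κ * (Matrix.of fun i j : Fin M => ∑ l : Fin (n + M),
        (p * Q ^ (i : ℕ)) ^ (l : ℕ) * (p' * Q' ^ (j : ℕ)) ^ (l : ℕ)).det := by
  obtain ⟨V, hV, h⟩ := Srec_det Q hQ hQ1 M
  obtain ⟨V', hV', h'⟩ := Srec_det Q' hQ' hQ1' M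
  refine ⟨V * V' * (c ^ (∑ j : Fin M, (j : ℕ)))⁻¹, fun n => ?_⟩
  rw [cauchy_binet (ι := Fin (n + M)) (fun (i : Fin M) l => (p * Q ^ (i : ℕ)) ^ (l : ℕ))
    (fun (j : Fin M) l => (p' * Q' ^ (j : ℕ)) ^ (l : ℕ))]
  have e := antitone_sum_eq M n (fun g =>
    (Matrix.of fun i j : Fin M => (p * Q ^ (i : ℕ)) ^ (g j)).det *
    (Matrix.of fun i j : Fin M => (p' * Q' ^ (i : ℕ)) ^ (g j)).det)
  rw [← e, Finset.sum_filter, Finset.mul_sum]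
  refine Finset.sum_congr rfl fun f hf => ?_
  split_ifs with hA
  · have hext : ∀ i, extz f (i + 1) ≤ extz f i := by
      intro i
      by_cases hi : i + 1 < M
      · rw [extz_of_lt _ hi, extz_of_lt _ (by omega)]
        exact hA (by simp [Fin.le_def])
      · rw [extz_of_ge _ (by omega)]; exact Nat.zero_le _
    rw [h _ hext, h' _ hext]
    have hd : ∀ (p Q : ℝ), (Matrix.of fun i j : Fin M => (p * Q ^ (i : ℕ)) ^ (f (Fin.rev j) + j)).det
        = Equiv.Perm.sign (Fin.revPerm (n := M)) * ((∏ j : Fin M, p ^ (f j + (M - 1 - (j : ℕ)))) *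
          (Matrix.of fun i j : Fin M => Q ^ ((i : ℕ) * (extz f j + (M - 1 - j)))).det) := by
      intro p Q
      rw [← Matrix.det_mul_row, ← Matrix.det_permute']
      congr 1
      ext i j
      simp only [Matrix.of_apply, Matrix.submatrix_apply, id, Fin.revPerm_apply]
      rw [mul_pow, ← pow_mul]
      have : M - 1 - (Fin.rev j : ℕ) = j := by
        rw [Fin.val_rev]; have := j.2; omega
      rw [this, extz_of_lt _ (Fin.rev j).2]
    rw [hd, hd]
    have hsq : ((Equiv.Perm.sign (Fin.revPerm (n := M)) : ℤ) : ℝ) *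
        ((Equiv.Perm.sign (Fin.revPerm (n := M)) : ℤ) : ℝ) = 1 := by
      rcases Int.units_eq_one_or (Equiv.Perm.sign (Fin.revPerm (n := M))) with h | h <;> rw [h] <;> simp
    have hpp : (∏ j : Fin M, p ^ (f j + (M - 1 - (j : ℕ)))) *
        (∏ j : Fin M, p' ^ (f j + (M - 1 - (j : ℕ)))) =
        c ^ (∑ j, f j) * c ^ (∑ j : Fin M, (j : ℕ)) := by
      rw [← Finset.prod_mul_distrib]
      simp_rw [← mul_pow, ← hp]
      rw [Finset.prod_pow_eq_pow_sum, Finset.sum_add_distrib, pow_add]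
      congr 2
      rw [← Equiv.sum_comp Fin.revPerm]
      refine Finset.sum_congr rfl fun j _ => ?_
      rw [Fin.revPerm_apply, Fin.val_rev]; have := j.2; omega
    set s : ℝ := ((Equiv.Perm.sign (Fin.revPerm (n := M)) : ℤ) : ℝ)
    set d := (Matrix.of fun i j : Fin M => Q ^ ((i : ℕ) * (extz f j + (M - 1 - j)))).det
    set d' := (Matrix.of fun i j : Fin M => Q' ^ ((i : ℕ) * (extz f j + (M - 1 - j)))).det
    set A := (∏ j : Fin M, p ^ (f j + (M - 1 - (j : ℕ))))
    set B := (∏ j : Fin M, p' ^ (f j + (M - 1 - (j : ℕ))))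
    set g := c ^ (∑ j, f j)
    have hne : c ^ (∑ j : Fin M, (j : ℕ)) ≠ 0 := by positivity
    set k := c ^ (∑ j : Fin M, (j : ℕ))
    have : s * (A * d) * (s * (B * d')) = g * k * d * d' := by
      calc _ = (s * s) * (A * B) * d * d' := by ring
        _ = _ := by rw [hsq, hpp]; ring
    rw [this]
    field_simp
  · rw [Srec_eq_zero Q hQ M f hA]; simp



def gx (p Q : ℝ) (M : ℕ) (i : Fin M) : ℝ := p * Q ^ (i : ℕ)

lemma gx_inj {p Q : ℝ} (hp : 0 < p) (hQ : 0 < Q) (hQ1 : Q < 1) (M : ℕ) :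
    Function.Injective (gx p Q M) := by
  intro i j h
  unfold gx at h
  have := mul_left_cancel₀ hp.ne' h
  exact Fin.ext ((pow_right_strictAnti₀ hQ hQ1).injective this)

lemma gx_pos {p Q : ℝ} (hp : 0 < p) (hQ : 0 < Q) (M : ℕ) (i) : 0 < gx p Q M i := by
  unfold gx; positivity

lemma gx_le {p Q : ℝ} (hp : 0 < p) (hQ : 0 < Q) (hQ1 : Q < 1) (M : ℕ) (i) : gx p Q M i ≤ p := by
  unfold gx
  exact mul_le_of_le_one_right hp.le (pow_le_one₀ hQ.le hQ1.le)

/-- truncated Gram matrix -/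
def gram {M : ℕ} (x y : Fin M → ℝ) (N : ℕ) : Matrix (Fin M) (Fin M) ℝ :=
  Matrix.of fun i j => ∑ l ∈ Finset.range N, (x i * y j) ^ l

lemma gram_tendsto {M : ℕ} (x y : Fin M → ℝ) (h0 : ∀ i j, 0 ≤ x i * y j) (h1 : ∀ i j, x i * y j < 1) :
    Tendsto (fun N => (gram x y N).det) atTop (𝓝 (cauM x y).det) := by
  have hc : Continuous (fun A : Matrix (Fin M) (Fin M) ℝ => A.det) := Continuous.matrix_det continuous_id
  refine (hc.tendsto _).comp ?_
  refine tendsto_pi_nhds.2 fun i => ?_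
  refine tendsto_pi_nhds.2 fun j => ?_
  exact (hasSum_geometric_of_lt_one (h0 i j) (h1 i j)).tendsto_sum_nat

lemma prod_bound {p p' Q Q' : ℝ} (hp : 0 < p) (hp' : 0 < p') (hc : p * p' < 1) (hQ : 0 < Q) (hQ1 : Q < 1)
    (hQ' : 0 < Q') (hQ1' : Q' < 1) (M : ℕ) :
    (∏ i, ∏ j, (1 - gx p Q M i * gx p' Q' M j))⁻¹ ≤
      Real.exp ((p * p') / (1 - p * p') * ((1 - Q)⁻¹ * (1 - Q')⁻¹)) := by
  have hgeo : ∀ {Q : ℝ}, 0 < Q → Q < 1 → ∑ i : Fin M, Q ^ (i : ℕ) ≤ (1 - Q)⁻¹ := by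
    intro Q h0 h1
    rw [Fin.sum_univ_eq_sum_range (fun i => Q ^ i)]
    rw [← tsum_geometric_of_lt_one h0.le h1]
    exact (summable_geometric_of_lt_one h0.le h1).sum_le_tsum _ (fun i _ => by positivity)
  have hterm : ∀ i j, (1 - gx p Q M i * gx p' Q' M j)⁻¹ ≤
      Real.exp ((p * p') / (1 - p * p') * (Q ^ (i : ℕ) * Q' ^ (j : ℕ))) := by
    intro i j
    have ht : gx p Q M i * gx p' Q' M j = p * p' * (Q ^ (i : ℕ) * Q' ^ (j : ℕ)) := by
      unfold gx; ring
    set t := Q ^ (i : ℕ) * Q' ^ (j : ℕ)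
    have ht0 : 0 < t := by positivity
    have ht1 : t ≤ 1 := mul_le_one₀ (pow_le_one₀ hQ.le hQ1.le) (by positivity) (pow_le_one₀ hQ'.le hQ1'.le)
    rw [ht]
    have hpp : 0 < p * p' := by positivity
    have h1 : 0 < 1 - p * p' := by linarith
    have h2 : p * p' * t ≤ p * p' := mul_le_of_le_one_right hpp.le ht1
    have h3 : 0 < 1 - p * p' * t := by linarith
    have h4 : (1 - p * p' * t)⁻¹ = 1 + p * p' * t / (1 - p * p' * t) := by field_simp; ring
    rw [h4]
    calc _ ≤ 1 + p * p' / (1 - p * p') * t := by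
          gcongr
          rw [div_mul_eq_mul_div]
          gcongr
      _ ≤ _ := by linarith [Real.add_one_le_exp (p * p' / (1 - p * p') * t)]
  have hpos : ∀ i j, 0 < 1 - gx p Q M i * gx p' Q' M j := by
    intro i j
    have : gx p Q M i * gx p' Q' M j ≤ p * p' :=
      mul_le_mul (gx_le hp hQ hQ1 M i) (gx_le hp' hQ' hQ1' M j) (gx_pos hp' hQ' M j).le hp.le
    linarith
  simp_rw [← Finset.prod_inv_distrib]
  calc _ ≤ ∏ i : Fin M, ∏ j : Fin M, Real.exp ((p * p') / (1 - p * p') * (Q ^ (i : ℕ) * Q' ^ (j : ℕ))) := by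
        refine Finset.prod_le_prod (fun i _ => Finset.prod_nonneg fun j _ => (inv_pos.2 (hpos i j)).le)
          (fun i _ => Finset.prod_le_prod (fun j _ => (inv_pos.2 (hpos i j)).le) (fun j _ => hterm i j))
    _ = Real.exp ((p * p') / (1 - p * p') * ((∑ i : Fin M, Q ^ (i : ℕ)) * ∑ j : Fin M, Q' ^ (j : ℕ))) := by
        simp_rw [← Real.exp_sum]
        rw [Finset.sum_mul_sum, Finset.mul_sum]
        simp_rw [Finset.mul_sum]
    _ ≤ _ := by
        have : 0 < 1 - p * p' := by linarith
        refine Real.exp_le_exp.2 (mul_le_mul_of_nonneg_left ?_ (by positivity))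
        · exact mul_le_mul (hgeo hQ hQ1) (hgeo hQ' hQ1') (Finset.sum_nonneg fun i _ => by positivity)
            (inv_nonneg.2 (by linarith))

/-- the measure with given weight -/
def ppMeas (Q c Q' : ℝ) : @Measure (PlanePartition ⊤ ⊤) ⊤ :=
  @Measure.sum _ _ ⊤ (fun Λ => ENNReal.ofReal (wgt Q c Q' Λ) • @Measure.dirac _ ⊤ Λ)

lemma ppMeas_apply (Q c Q' : ℝ) (A : Set (PlanePartition ⊤ ⊤)) :
    ppMeas Q c Q' A = ∑' Λ : A, ENNReal.ofReal (wgt Q c Q' Λ.1) := by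
  let _ : MeasurableSpace (PlanePartition ⊤ ⊤) := ⊤
  have hA : MeasurableSet A := trivial
  rw [ppMeas, Measure.sum_apply _ hA, tsum_subtype A (fun Λ => ENNReal.ofReal (wgt Q c Q' Λ))]
  refine tsum_congr fun Λ => ?_
  rw [Measure.smul_apply, Measure.dirac_apply' _ hA]
  by_cases h : Λ ∈ A <;> simp [h]

lemma exists_box (Λ : PlanePartition ⊤ ⊤) : ∃ M, inBox M Λ := by
  obtain ⟨B, hB⟩ := (Λ.finite_supp.image (fun p => p.1 + p.2)).bddAbove
  refine ⟨B + 1, fun i j h => ?_⟩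
  by_contra hne
  have := hB ⟨(i, j), hne, rfl⟩
  simp only at this
  omega

theorem fin_limit (Q c Q' p p' : ℝ) (hQ : 0 < Q) (hQ1 : Q < 1) (hQ' : 0 < Q') (hQ1' : Q' < 1)
    (hp0 : 0 < p) (hp0' : 0 < p') (hp : c = p * p') (hc1 : c < 1) (n : ℕ) :
    Tendsto (fun M => (gram (gx p Q M) (gx p' Q' M) (n + M)).det / (cauM (gx p Q M) (gx p' Q' M)).det)
      atTop (𝓝 ((∑' Λ : {Λ : PlanePartition ⊤ ⊤ | Λ.part 0 0 ≤ n}, wgt Q c Q' Λ.1) /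
        ∑' Λ : PlanePartition ⊤ ⊤, wgt Q c Q' Λ)) := by
  let _ : MeasurableSpace (PlanePartition ⊤ ⊤) := ⊤
  have hc : 0 < c := by rw [hp]; positivity
  set μ := ppMeas Q c Q' with hμ
  choose κ hκ using fun M => box_det Q c Q' p p' hQ hQ1 hQ' hQ1' hc hp M
  set E : ℕ → ℕ → Set (PlanePartition ⊤ ⊤) := fun M n => {Λ | inBox M Λ ∧ Λ.part 0 0 ≤ n} with hE
  have hwpos : ∀ Λ, 0 ≤ wgt Q c Q' Λ := fun Λ => by unfold wgt; positivity
  have hgr : ∀ M n, (Matrix.of fun i j : Fin M => ∑ l : Fin (n + M),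
        (p * Q ^ (i : ℕ)) ^ (l : ℕ) * (p' * Q' ^ (j : ℕ)) ^ (l : ℕ)) =
        gram (gx p Q M) (gx p' Q' M) (n + M) := by
    intro M n
    ext i j
    simp only [Matrix.of_apply, gram, gx, mul_pow]
    exact Fin.sum_univ_eq_sum_range (fun l => p ^ l * (Q ^ (i : ℕ)) ^ l * (p' ^ l * (Q' ^ (j : ℕ)) ^ l)) _
  have hD : ∀ M n, μ (E M n) = ENNReal.ofReal (κ M * (gram (gx p Q M) (gx p' Q' M) (n + M)).det) := by
    intro M n
    rw [hμ, ppMeas_apply]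
    have := box_sum Q c Q' hQ hc hQ' M n
    rw [hκ M n, hgr] at this
    exact this
  have hD0 : ∀ M n, 0 ≤ κ M * (gram (gx p Q M) (gx p' Q' M) (n + M)).det := by
    intro M n
    rw [← hgr, ← hκ M n]
    exact Finset.sum_nonneg fun f _ => mul_nonneg (by positivity)
        (mul_nonneg (Srec_nonneg hQ.le _ _) (Srec_nonneg hQ'.le _ _))
  have hxy : ∀ M i j, 0 < gx p Q M i * gx p' Q' M j ∧ gx p Q M i * gx p' Q' M j ≤ c := by
    intro M i j
    refine ⟨mul_pos (gx_pos hp0 hQ M i) (gx_pos hp0' hQ' M j), ?_⟩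
    rw [hp]
    exact mul_le_mul (gx_le hp0 hQ hQ1 M i) (gx_le hp0' hQ' hQ1' M j) (gx_pos hp0' hQ' M j).le hp0.le
  -- zero partition
  have hone : ∀ M, μ (E M 0) = 1 := by
    intro M
    have hz : E M 0 = {⟨fun _ _ => 0, by simp, by simp, by simp, by simp, by simp⟩} := by
      ext Λ
      simp only [hE, Set.mem_ofPred_eq, Set.mem_singleton_iff]
      constructor
      · rintro ⟨-, h⟩
        have : ∀ i j, Λ.part i j = 0 := fun i j => Nat.le_zero.1 ((pp_anti Λ i j).trans h)
        obtain ⟨P, h1, h2, h3, h4, h5⟩ := Λ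
        simp only [PlanePartition.mk.injEq]
        funext i j
        exact this i j
      · rintro rfl
        exact ⟨fun i j _ => rfl, le_rfl⟩
    rw [hz, hμ, ppMeas_apply, tsum_singleton _ (fun Λ => ENNReal.ofReal (wgt Q c Q' Λ))]
    simp [wgt, PlanePartition.leftVol, PlanePartition.rightVol, PlanePartition.centralVol]
  have hvand : ∀ M, κ M * ((Matrix.vandermonde (gx p Q M)).det * (Matrix.vandermonde (gx p' Q' M)).det) = 1 := by
    intro M
    have h1 := hone M
    rw [hD] at h1
    have h2 : κ M * (gram (gx p Q M) (gx p' Q' M) (0 + M)).det = 1 := by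
      rw [← ENNReal.toReal_ofReal (hD0 M 0), h1]; simp
    rw [← h2, ← Matrix.det_transpose (Matrix.vandermonde (gx p' Q' M)), ← Matrix.det_mul]
    congr 2
    ext i j
    rw [Matrix.vandermonde_mul_vandermonde_transpose]
    simp only [gram, Matrix.of_apply, zero_add]
    exact Fin.sum_univ_eq_sum_range (fun l => (gx p Q M i * gx p' Q' M j) ^ l) _
  have hκ0 : ∀ M, κ M ≠ 0 := fun M h => by have := hvand M; rw [h] at this; simp at this
  have hgt : ∀ M, Tendsto (fun n => (gram (gx p Q M) (gx p' Q' M) (n + M)).det) atTop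
      (𝓝 (cauM (gx p Q M) (gx p' Q' M)).det) := fun M =>
    (gram_tendsto _ _ (fun i j => (hxy M i j).1.le) (fun i j => (hxy M i j).2.trans_lt hc1)).comp
      (tendsto_add_atTop_nat M)
  have hZ : ∀ M, μ {Λ | inBox M Λ} = ENNReal.ofReal (κ M * (cauM (gx p Q M) (gx p' Q' M)).det) := by
    intro M
    have h1 : Tendsto (fun n => μ (E M n)) atTop (𝓝 (μ (⋃ n, E M n))) := by
      apply tendsto_measure_iUnion_atTop
      intro n n' h Λ hΛ
      exact ⟨hΛ.1, hΛ.2.trans h⟩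
    have h2 : (⋃ n, E M n) = {Λ | inBox M Λ} := by
      ext Λ
      simp only [Set.mem_iUnion, hE, Set.mem_ofPred_eq]
      exact ⟨fun ⟨n, h⟩ => h.1, fun h => ⟨_, h, le_rfl⟩⟩
    rw [h2] at h1
    refine tendsto_nhds_unique h1 ?_
    simp_rw [hD]
    exact ENNReal.tendsto_ofReal ((hgt M).const_mul _)
  have hZ0 : ∀ M, 0 ≤ κ M * (cauM (gx p Q M) (gx p' Q' M)).det := fun M =>
    ge_of_tendsto' ((hgt M).const_mul (κ M)) (fun n => hD0 M n)
  have hcpp : c = p * p' := hp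
  have hbd : ∀ M, κ M * (cauM (gx p Q M) (gx p' Q' M)).det ≤
      Real.exp ((p * p') / (1 - p * p') * ((1 - Q)⁻¹ * (1 - Q')⁻¹)) := by
    intro M
    refine le_trans ?_ (prod_bound hp0 hp0' (hp ▸ hc1) hQ hQ1 hQ' hQ1' M)
    have hpos : ∀ i j, 0 < 1 - gx p Q M i * gx p' Q' M j := fun i j => by linarith [(hxy M i j).2]
    have hsq := cauM_det_vand (gx p Q M) (gx p' Q' M) (gx_inj hp0 hQ hQ1 M) (gx_inj hp0' hQ' hQ1' M)
      (fun i => (gx_pos hp0' hQ' M i).ne') hpos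
    have hP : 0 < (∏ i, ∏ j, (1 - gx p Q M i * gx p' Q' M j))⁻¹ :=
      inv_pos.2 (Finset.prod_pos fun i _ => Finset.prod_pos fun j _ => hpos i j)
    apply le_of_eq
    have h1 : (κ M * (cauM (gx p Q M) (gx p' Q' M)).det) ^ 2 =
      ((∏ i, ∏ j, (1 - gx p Q M i * gx p' Q' M j))⁻¹) ^ 2 := by
      rw [mul_pow, hsq, ← mul_pow, ← mul_assoc, hvand, one_mul]
    exact (pow_left_inj₀ (hZ0 M) hP.le two_ne_zero).1 h1
  have hbm : Monotone (fun M => {Λ : PlanePartition ⊤ ⊤ | inBox M Λ}) := by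
    intro M M' h Λ hΛ i j hij
    exact hΛ i j (by omega)
  have hlimZ : Tendsto (fun M => μ {Λ | inBox M Λ}) atTop (𝓝 (μ Set.univ)) := by
    have : Set.univ = ⋃ M, {Λ : PlanePartition ⊤ ⊤ | inBox M Λ} := by
      ext Λ; simpa using exists_box Λ
    rw [this]
    exact tendsto_measure_iUnion_atTop hbm
  have hlimA : Tendsto (fun M => μ (E M n)) atTop (𝓝 (μ {Λ | Λ.part 0 0 ≤ n})) := by
    have : {Λ : PlanePartition ⊤ ⊤ | Λ.part 0 0 ≤ n} = ⋃ M, E M n := by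
      ext Λ
      simp only [Set.mem_iUnion, hE, Set.mem_ofPred_eq]
      exact ⟨fun h => (exists_box Λ).imp fun M hM => ⟨hM, h⟩, fun ⟨M, h⟩ => h.2⟩
    rw [this]
    apply tendsto_measure_iUnion_atTop
    intro M M' h Λ hΛ
    exact ⟨hbm h hΛ.1, hΛ.2⟩
  have hfin : μ Set.univ ≠ ⊤ := by
    have : μ Set.univ ≤ ENNReal.ofReal (Real.exp ((p * p') / (1 - p * p') * ((1 - Q)⁻¹ * (1 - Q')⁻¹))) := by
      refine le_of_tendsto' hlimZ fun M => ?_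
      rw [hZ]
      exact ENNReal.ofReal_le_ofReal (hbd M)
    exact (this.trans_lt ENNReal.ofReal_lt_top).ne
  have hge : 1 ≤ μ Set.univ := by
    rw [← hone 0]; exact measure_mono (Set.subset_univ _)
  have hreal : ∀ A : Set (PlanePartition ⊤ ⊤), (μ A).toReal = ∑' Λ : A, wgt Q c Q' Λ.1 := by
    intro A
    rw [hμ, ppMeas_apply, ENNReal.tsum_toReal_eq (fun _ => ENNReal.ofReal_ne_top)]
    exact tsum_congr fun Λ => ENNReal.toReal_ofReal (hwpos _)
  have hnum : Tendsto (fun M => κ M * (gram (gx p Q M) (gx p' Q' M) (n + M)).det) atTop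
      (𝓝 (∑' Λ : {Λ : PlanePartition ⊤ ⊤ | Λ.part 0 0 ≤ n}, wgt Q c Q' Λ.1)) := by
    rw [← hreal]
    have hA : μ {Λ | Λ.part 0 0 ≤ n} ≠ ⊤ := ne_top_of_le_ne_top hfin (measure_mono (Set.subset_univ _))
    refine ((ENNReal.tendsto_toReal hA).comp hlimA).congr fun M => ?_
    simp only [Function.comp]
    rw [hD, ENNReal.toReal_ofReal (hD0 _ _)]
  have hden : Tendsto (fun M => κ M * (cauM (gx p Q M) (gx p' Q' M)).det) atTop
      (𝓝 (∑' Λ : PlanePartition ⊤ ⊤, wgt Q c Q' Λ)) := by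
    rw [← tsum_univ, ← hreal]
    refine ((ENNReal.tendsto_toReal hfin).comp hlimZ).congr fun M => ?_
    simp only [Function.comp]
    rw [hZ, ENNReal.toReal_ofReal (hZ0 _)]
  have hne : ∑' Λ : PlanePartition ⊤ ⊤, wgt Q c Q' Λ ≠ 0 := by
    rw [← tsum_univ, ← hreal]
    intro h
    rw [ENNReal.toReal_eq_zero_iff] at h
    rcases h with h | h
    · rw [h] at hge; simp at hge
    · exact hfin h
  refine (hnum.div hden hne).congr fun M => ?_
  exact mul_div_mul_left _ _ (hκ0 M)


/-- Laurent type coefficients -/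
def av {M : ℕ} (x y : Fin M → ℝ) (k : ℕ) : ℝ := ∑ i, alph x y i * x i ^ k

def kern {M : ℕ} (x y : Fin M → ℝ) (l l' : ℕ) : ℝ :=
  ∑ j, ∑ i, y j ^ l * (alph y x j * (1 - x i * y j)⁻¹ * alph x y i) * x i ^ l'

lemma kern_hasSum {M : ℕ} (x y : Fin M → ℝ) (h0 : ∀ i j, 0 ≤ x i * y j) (h1 : ∀ i j, x i * y j < 1)
    (l l' : ℕ) : HasSum (fun m => av y x (l + m) * av x y (l' + m)) (kern x y l l') := by
  unfold kern
  have e : (fun m => av y x (l + m) * av x y (l' + m)) = fun m => ∑ j, ∑ i,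
      (y j ^ l * alph y x j * alph x y i * x i ^ l') * (x i * y j) ^ m := by
    funext m
    unfold av
    rw [Finset.sum_mul_sum]
    refine Finset.sum_congr rfl fun j _ => Finset.sum_congr rfl fun i _ => ?_
    rw [mul_pow, pow_add, pow_add]; ring
  rw [e]
  refine hasSum_sum fun j _ => hasSum_sum fun i _ => ?_
  have := (hasSum_geometric_of_lt_one (h0 i j) (h1 i j)).mul_left
    (y j ^ l * alph y x j * alph x y i * x i ^ l')
  have e2 : y j ^ l * (alph y x j * (1 - x i * y j)⁻¹ * alph x y i) * x i ^ l' =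
      y j ^ l * alph y x j * alph x y i * x i ^ l' * (1 - x i * y j)⁻¹ := by ring
  rw [e2]
  exact this

lemma det_sub_eq {M D N : ℕ} (x y : Fin M → ℝ) (hx : Function.Injective x) (hy : Function.Injective y)
    (hy0 : ∀ i, y i ≠ 0) (hxy : ∀ i j, 1 - x i * y j ≠ 0) :
    (cauM x y - Matrix.of fun i j => ∑ k : Fin D, (x i * y j) ^ (N + (k : ℕ))).det / (cauM x y).det =
    (1 - Matrix.of fun k k' : Fin D => kern x y (N + k) (N + k')).det := by
  set B := (Matrix.of fun j i => alph y x j * (1 - x i * y j)⁻¹ * alph x y i) with hB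
  have hinv : cauM x y * B = 1 := cauM_inv x y hx hy hy0 hxy
  have hdet : (cauM x y).det * B.det = 1 := by rw [← Matrix.det_mul, hinv, Matrix.det_one]
  have hd0 : (cauM x y).det ≠ 0 := left_ne_zero_of_mul_eq_one hdet
  set X : Matrix (Fin M) (Fin D) ℝ := Matrix.of fun i k => x i ^ (N + (k : ℕ)) with hX
  set Y : Matrix (Fin D) (Fin M) ℝ := Matrix.of fun k j => y j ^ (N + (k : ℕ)) with hY
  have e1 : (Matrix.of fun i j => ∑ k : Fin D, (x i * y j) ^ (N + (k : ℕ))) = X * Y := by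
    ext i j
    rw [Matrix.mul_apply]
    simp only [hX, hY, Matrix.of_apply, mul_pow]
  have e2 : (Matrix.of fun k k' : Fin D => kern x y (N + k) (N + k')) = Y * (B * X) := by
    ext k k'
    rw [Matrix.mul_apply]
    simp only [Matrix.mul_apply, hX, hY, hB, Matrix.of_apply, kern]
    refine Finset.sum_congr rfl fun j _ => ?_
    rw [Finset.mul_sum]
    refine Finset.sum_congr rfl fun i _ => ?_
    ring
  have e3 : cauM x y - X * Y = cauM x y * (1 - (B * X) * Y) := by
    rw [mul_sub, mul_one, ← Matrix.mul_assoc, ← Matrix.mul_assoc, hinv, Matrix.one_mul]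
  rw [e1, e2, e3, Matrix.det_mul, mul_div_cancel_left₀ _ hd0, Matrix.det_one_sub_mul_comm]

theorem fin_main (Q c Q' p p' : ℝ) (hQ : 0 < Q) (hQ1 : Q < 1) (hQ' : 0 < Q') (hQ1' : Q' < 1)
    (hp0 : 0 < p) (hp0' : 0 < p') (hp : c = p * p') (hc1 : c < 1) (n : ℕ) (tol : ℝ) (htol : 0 < tol) :
    ∀ᶠ M in atTop, ∀ᶠ D in atTop,
      |(∑' Λ : {Λ : PlanePartition ⊤ ⊤ | Λ.part 0 0 ≤ n}, wgt Q c Q' Λ.1) /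
        (∑' Λ : PlanePartition ⊤ ⊤, wgt Q c Q' Λ) -
        ∑ m ∈ Finset.range (D + 1), ((-1 : ℝ) ^ m / m.factorial) *
          ∑ f : Fin m → Fin D, (Matrix.of fun i j => kern (gx p Q M) (gx p' Q' M)
            (n + M + (f i : ℕ)) (n + M + (f j : ℕ))).det| < tol := by
  have hlim := fin_limit Q c Q' p p' hQ hQ1 hQ' hQ1' hp0 hp0' hp hc1 n
  filter_upwards [(Metric.tendsto_nhds.1 hlim (tol / 2) (by positivity))] with M hM
  set x := gx p Q M with hx
  set y := gx p' Q' M with hy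
  have hxy : ∀ i j, 0 < x i * y j ∧ x i * y j ≤ c := by
    intro i j
    refine ⟨mul_pos (gx_pos hp0 hQ M i) (gx_pos hp0' hQ' M j), ?_⟩
    rw [hp]
    exact mul_le_mul (gx_le hp0 hQ hQ1 M i) (gx_le hp0' hQ' hQ1' M j) (gx_pos hp0' hQ' M j).le hp0.le
  have hxy1 : ∀ i j, 1 - x i * y j ≠ 0 := fun i j => by linarith [(hxy i j).2]
  have hlim2 : Tendsto (fun D => (cauM x y - Matrix.of fun i j => ∑ k : Fin D,
      (x i * y j) ^ (n + M + (k : ℕ))).det) atTop (𝓝 (gram x y (n + M)).det) := by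
    have hc : Continuous (fun A : Matrix (Fin M) (Fin M) ℝ => A.det) := Continuous.matrix_det continuous_id
    refine (hc.tendsto _).comp ?_
    refine tendsto_pi_nhds.2 fun i => ?_
    refine tendsto_pi_nhds.2 fun j => ?_
    have h1 : Tendsto (fun D => ∑ l ∈ Finset.range (n + M + D), (x i * y j) ^ l) atTop
        (𝓝 (1 - x i * y j)⁻¹) := by
      have := (hasSum_geometric_of_lt_one (hxy i j).1.le ((hxy i j).2.trans_lt hc1)).tendsto_sum_nat
      refine (this.comp (tendsto_add_atTop_nat (n + M))).congr fun D => ?_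
      simp only [Function.comp]; rw [add_comm]
    have h2 : Tendsto (fun D => (1 - x i * y j)⁻¹ - (∑ l ∈ Finset.range (n + M + D), (x i * y j) ^ l -
        ∑ l ∈ Finset.range (n + M), (x i * y j) ^ l)) atTop
        (𝓝 ((1 - x i * y j)⁻¹ - ((1 - x i * y j)⁻¹ - ∑ l ∈ Finset.range (n + M), (x i * y j) ^ l))) :=
      tendsto_const_nhds.sub (h1.sub_const _)
    rw [sub_sub_cancel] at h2
    refine h2.congr fun D => ?_
    simp only [Matrix.sub_apply, cauM, Matrix.of_apply]
    rw [Finset.sum_range_add, add_sub_cancel_left, ← Fin.sum_univ_eq_sum_range (fun k => (x i * y j) ^ (n + M + k))]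
  have hlim3 := hlim2.div_const (cauM x y).det
  filter_upwards [Metric.tendsto_nhds.1 hlim3 (tol / 2) (by positivity)] with D hD
  rw [det_sub_eq x y (gx_inj hp0 hQ hQ1 M) (gx_inj hp0' hQ' hQ1' M) (fun i => (gx_pos hp0' hQ' M i).ne') hxy1,
    fredholm_fin _ (D + 1) (by simp)] at hD
  simp only [Matrix.of_apply] at hD
  rw [Real.dist_eq] at hM hD
  rw [abs_sub_comm] at hM
  have := abs_sub_le ((∑' Λ : {Λ : PlanePartition ⊤ ⊤ | Λ.part 0 0 ≤ n}, wgt Q c Q' Λ.1) /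
        (∑' Λ : PlanePartition ⊤ ⊤, wgt Q c Q' Λ)) ((gram x y (n + M)).det / (cauM x y).det)
        (∑ m ∈ Finset.range (D + 1), ((-1 : ℝ) ^ m / m.factorial) *
          ∑ f : Fin m → Fin D, (Matrix.of fun i j => kern x y
            (n + M + (f i : ℕ)) (n + M + (f j : ℕ))).det)
  rw [abs_sub_comm ((gram x y (n + M)).det / (cauM x y).det)] at this
  linarith

open Complex in
lemma one_sub_slit {x : ℝ} (hx : 0 ≤ x) {u : ℂ} (h0 : 0 ≤ u.im) (h1 : u.im ≤ Real.pi)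
    (h2 : u.im = 0 → x * Real.exp u.re < 1) : 1 - (x : ℂ) * cexp u ∈ slitPlane := by
  rw [mem_slitPlane_iff]
  have hre : (1 - (x : ℂ) * cexp u).re = 1 - x * (Real.exp u.re * Real.cos u.im) := by
    simp [exp_re, exp_im]
  have him : (1 - (x : ℂ) * cexp u).im = - (x * (Real.exp u.re * Real.sin u.im)) := by
    simp [exp_re, exp_im]
  rw [hre, him]
  rcases hx.eq_or_lt with hx | hx
  · left; rw [← hx]; simp
  rcases h0.eq_or_lt with h | h
  · left
    rw [← h]; simp; exact h2 h.symm
  rcases h1.eq_or_lt with h' | h'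
  · left
    rw [h']; simp
    have := mul_pos hx (Real.exp_pos u.re)
    linarith
  · right
    have := Real.sin_pos_of_pos_of_lt_pi h h'
    have : 0 < x * (Real.exp u.re * Real.sin u.im) := by positivity
    intro h; linarith

open Complex in
def pathu (p t : ℝ) : ℂ := (p : ℂ) + t * (1 + I)

open Complex in
lemma pathu_re (p t : ℝ) : (pathu p t).re = p + t := by simp [pathu]
open Complex in
lemma pathu_im (p t : ℝ) : (pathu p t).im = t := by simp [pathu]

open Complex in
lemma pathu_deriv (p t : ℝ) : HasDerivAt (pathu p) (1 + I) t := by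
  unfold pathu
  have := ((Complex.ofRealCLM.hasDerivAt (x := t)).mul_const (1 + I)).const_add (p : ℂ)
  simpa using this

lemma pathu_cont (p : ℝ) : Continuous (pathu p) :=
  continuous_iff_continuousAt.2 fun t => (pathu_deriv p t).continuousAt

open Complex in
lemma exp_pathu_pi (p : ℝ) : cexp (pathu p Real.pi) = ((-Real.exp (p + Real.pi) : ℝ) : ℂ) := by
  have : pathu p Real.pi = ((p + Real.pi : ℝ) : ℂ) + Real.pi * I := by
    simp [pathu]; ring
  rw [this, Complex.exp_add, exp_pi_mul_I]; push_cast; ring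

open Complex in
lemma exp_pathu_zero (p : ℝ) : cexp (pathu p 0) = ((Real.exp p : ℝ) : ℂ) := by
  simp [pathu]

lemma path_slit {x p : ℝ} (hx : 0 ≤ x) (hp : x * Real.exp p < 1) {t : ℝ} (h0 : 0 ≤ t) (h1 : t ≤ Real.pi) :
    1 - (x : ℂ) * Complex.exp (pathu p t) ∈ Complex.slitPlane := by
  refine one_sub_slit hx (by rwa [pathu_im]) (by rwa [pathu_im]) ?_
  rw [pathu_im, pathu_re]
  rintro rfl
  simpa using hp

open Complex in
lemma coef_zpow (p : ℝ) (j : ℕ) :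
    (∫ t in (0:ℝ)..Real.pi, (cexp (pathu p t))⁻¹ ^ (j + 1) * (1 + I)).im = 0 := by
  have h : ∀ t ∈ Set.uIcc (0:ℝ) Real.pi, HasDerivAt (fun t => - ((j + 1 : ℕ) : ℂ)⁻¹ * (cexp (-pathu p t)) ^ (j + 1))
      ((cexp (pathu p t))⁻¹ ^ (j + 1) * (1 + I)) t := by
    intro t _
    have h1 := (((pathu_deriv p t).neg.cexp).pow (j + 1)).const_mul (- ((j + 1 : ℕ) : ℂ)⁻¹)
    refine h1.congr_deriv ?_
    rw [← Complex.exp_neg, Nat.add_sub_cancel, pow_succ, Pi.neg_apply]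
    have : ((j + 1 : ℕ) : ℂ) ≠ 0 := by exact_mod_cast Nat.succ_ne_zero j
    field_simp
  rw [intervalIntegral.integral_eq_sub_of_hasDerivAt h]
  · rw [Complex.exp_neg, Complex.exp_neg, exp_pathu_pi, exp_pathu_zero]
    have : (-((j + 1 : ℕ) : ℂ)⁻¹ * ((-Real.exp (p + Real.pi) : ℝ) : ℂ)⁻¹ ^ (j + 1) -
      -((j + 1 : ℕ) : ℂ)⁻¹ * ((Real.exp p : ℝ) : ℂ)⁻¹ ^ (j + 1)) =
      ((-((j + 1 : ℕ) : ℝ)⁻¹ * (-Real.exp (p + Real.pi) : ℝ)⁻¹ ^ (j + 1) -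
      -((j + 1 : ℕ) : ℝ)⁻¹ * (Real.exp p : ℝ)⁻¹ ^ (j + 1) : ℝ) : ℂ) := by push_cast; rfl
    rw [this, Complex.ofReal_im]
  · refine Continuous.intervalIntegrable ?_ _ _
    have := pathu_cont p
    exact ((this.cexp.inv₀ fun t => Complex.exp_ne_zero _).pow _).mul continuous_const

open Complex in
lemma coef_base {x p : ℝ} (hx : 0 ≤ x) (hp : x * Real.exp p < 1) :
    (∫ t in (0:ℝ)..Real.pi, (1 - (x : ℂ) * cexp (pathu p t))⁻¹ * (1 + I)).im = Real.pi := by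
  have hpi := Real.pi_pos.le
  have h : ∀ t ∈ Set.uIcc (0:ℝ) Real.pi, HasDerivAt
      (fun t => pathu p t - Complex.log (1 - (x : ℂ) * cexp (pathu p t)))
      ((1 - (x : ℂ) * cexp (pathu p t))⁻¹ * (1 + I)) t := by
    intro t ht
    rw [Set.uIcc_of_le hpi] at ht
    have hs := path_slit hx hp ht.1 ht.2
    have h1 := (pathu_deriv p t).sub
      ((((pathu_deriv p t).cexp.const_mul (x : ℂ)).const_sub 1).clog_real hs)
    refine h1.congr_deriv ?_
    have := slitPlane_ne_zero hs
    field_simp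
    ring
  rw [intervalIntegral.integral_eq_sub_of_hasDerivAt h]
  · rw [exp_pathu_pi, exp_pathu_zero]
    have e1 : (1 - (x : ℂ) * ((-Real.exp (p + Real.pi) : ℝ) : ℂ)) =
      ((1 + x * Real.exp (p + Real.pi) : ℝ) : ℂ) := by push_cast; ring
    have e2 : (1 - (x : ℂ) * ((Real.exp p : ℝ) : ℂ)) =
      ((1 - x * Real.exp p : ℝ) : ℂ) := by push_cast; ring
    have := Real.exp_pos (p + Real.pi)
    rw [e1, e2, ← Complex.ofReal_log (by positivity), ← Complex.ofReal_log (by linarith)]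
    simp [pathu_im]
  · refine ContinuousOn.intervalIntegrable ?_
    rw [Set.uIcc_of_le hpi]
    intro t ht
    have hs := path_slit hx hp ht.1 ht.2
    have := (pathu_cont p).cexp.continuousAt (x := t)
    exact (((continuousAt_const.sub (continuousAt_const.mul this)).inv₀
      (slitPlane_ne_zero hs)).mul continuousAt_const).continuousWithinAt

open Complex in
lemma coef_cont {x p : ℝ} (hx : 0 ≤ x) (hp : x * Real.exp p < 1) (j : ℕ) : IntervalIntegrable
    (fun t => (cexp (pathu p t))⁻¹ ^ j * (1 - (x : ℂ) * cexp (pathu p t))⁻¹ * (1 + I)) volume 0 Real.pi := by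
  refine ContinuousOn.intervalIntegrable ?_
  rw [Set.uIcc_of_le Real.pi_pos.le]
  intro t ht
  have hs := path_slit hx hp ht.1 ht.2
  have := (pathu_cont p).cexp.continuousAt (x := t)
  exact ((((this.inv₀ (Complex.exp_ne_zero _)).pow _).mul ((continuousAt_const.sub
    (continuousAt_const.mul this)).inv₀ (slitPlane_ne_zero hs))).mul continuousAt_const).continuousWithinAt

open Complex in
lemma coef_gen {x p : ℝ} (hx : 0 ≤ x) (hp : x * Real.exp p < 1) (j : ℕ) :
    (∫ t in (0:ℝ)..Real.pi, (cexp (pathu p t))⁻¹ ^ j * (1 - (x : ℂ) * cexp (pathu p t))⁻¹ * (1 + I)).im =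
      Real.pi * x ^ j := by
  induction j with
  | zero => simpa using coef_base hx hp
  | succ j ih =>
    have e : ∫ t in (0:ℝ)..Real.pi, (cexp (pathu p t))⁻¹ ^ (j + 1) * (1 - (x : ℂ) * cexp (pathu p t))⁻¹ * (1 + I)
      = ∫ t in (0:ℝ)..Real.pi, ((cexp (pathu p t))⁻¹ ^ (j + 1) * (1 + I) +
        (x : ℂ) * ((cexp (pathu p t))⁻¹ ^ j * (1 - (x : ℂ) * cexp (pathu p t))⁻¹ * (1 + I))) := by
      refine intervalIntegral.integral_congr fun t ht => ?_
      rw [Set.uIcc_of_le Real.pi_pos.le] at ht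
      have hs := slitPlane_ne_zero (path_slit hx hp ht.1 ht.2)
      have he := Complex.exp_ne_zero (pathu p t)
      rw [pow_succ]
      generalize cexp (pathu p t) = z at *
      have hs' : 1 - z * (x : ℂ) ≠ 0 := by rwa [mul_comm]
      field_simp
      ring
    rw [e, intervalIntegral.integral_add]
    · rw [intervalIntegral.integral_const_mul, Complex.add_im, coef_zpow, Complex.im_ofReal_mul, ih]
      ring
    · refine Continuous.intervalIntegrable ?_ _ _
      have := pathu_cont p
      exact ((this.cexp.inv₀ fun t => Complex.exp_ne_zero _).pow _).mul continuous_const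
    · exact (coef_cont hx hp j).const_mul _

open Complex in
def Rf {M : ℕ} (x y : Fin M → ℝ) (u : ℂ) : ℂ :=
  (∏ j, (1 - (y j : ℂ) * cexp (-u))) * ∏ i, (1 - (x i : ℂ) * cexp u)⁻¹

open Complex in
theorem av_contour {M : ℕ} (x y : Fin M → ℝ) (hx : Function.Injective x) (hx0 : ∀ i, 0 < x i)
    (p : ℝ) (hp : ∀ i, x i * Real.exp p < 1) (k : ℕ) (κ : ℝ) (hκ : κ = (k : ℝ) + 1 - M) :
    Real.pi * av x y k =
    (∫ t in (0:ℝ)..Real.pi, Rf x y (pathu p t) * cexp (-κ * pathu p t) * (1 + I)).im := by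
  have e : ∫ t in (0:ℝ)..Real.pi, Rf x y (pathu p t) * cexp (-κ * pathu p t) * (1 + I) =
    ∫ t in (0:ℝ)..Real.pi, (((∏ j, (-y j) : ℝ) : ℂ) * ((cexp (pathu p t))⁻¹ ^ (k + 1) * (1 + I)) +
      ∑ i, ((alph x y i : ℝ) : ℂ) * ((cexp (pathu p t))⁻¹ ^ k * (1 - (x i : ℂ) * cexp (pathu p t))⁻¹ * (1 + I))) := by
    refine intervalIntegral.integral_congr fun t ht => ?_
    rw [Set.uIcc_of_le Real.pi_pos.le] at ht
    have hs : ∀ i, 1 - (x i : ℂ) * cexp (pathu p t) ≠ 0 := fun i =>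
      slitPlane_ne_zero (path_slit (hx0 i).le (hp i) ht.1 ht.2)
    have he := Complex.exp_ne_zero (pathu p t)
    have ee : cexp (-κ * pathu p t) = cexp (pathu p t) ^ M * (cexp (pathu p t))⁻¹ ^ (k + 1) := by
      rw [← Complex.exp_neg, ← Complex.exp_nat_mul, ← Complex.exp_nat_mul, ← Complex.exp_add]
      congr 1
      rw [hκ]; push_cast; ring
    have pf := partial_frac (fun i => (x i : ℂ)) (fun i => (y i : ℂ))
      (fun i j h => hx (Complex.ofReal_injective h)) (fun i => by exact_mod_cast (hx0 i).ne') (cexp (pathu p t))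
    have ea : ∀ i, alph (fun i => (x i : ℂ)) (fun i => (y i : ℂ)) i = ((alph x y i : ℝ) : ℂ) := by
      intro i; simp [alph]
    simp_rw [ea] at pf
    have e1 : ∏ j, (1 - (y j : ℂ) * cexp (-pathu p t)) = (cexp (pathu p t))⁻¹ ^ M * ∏ j, (cexp (pathu p t) - y j) := by
      rw [Complex.exp_neg]
      calc _ = ∏ j, ((cexp (pathu p t))⁻¹ * (cexp (pathu p t) - y j)) := by
            refine Finset.prod_congr rfl fun j _ => ?_
            field_simp
        _ = _ := by rw [Finset.prod_mul_distrib]; simp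
    simp only [Rf]
    rw [e1, pf, ee, Finset.prod_inv_distrib]
    have hP : ∏ i, (1 - (x i : ℂ) * cexp (pathu p t)) ≠ 0 := Finset.prod_ne_zero_iff.2 fun i _ => hs i
    have e2 : ∀ i, ∏ l ∈ Finset.univ.erase i, (1 - (x l : ℂ) * cexp (pathu p t)) =
        (∏ l, (1 - (x l : ℂ) * cexp (pathu p t))) * (1 - (x i : ℂ) * cexp (pathu p t))⁻¹ := by
      intro i
      rw [← Finset.mul_prod_erase Finset.univ _ (Finset.mem_univ i)]
      have := hs i
      rw [mul_right_comm, mul_inv_cancel₀ this, one_mul]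
    simp_rw [e2]
    generalize hz : cexp (pathu p t) = z at *
    have e3 : ∑ i, ((alph x y i : ℝ) : ℂ) * z * ((∏ l, (1 - (x l : ℂ) * z)) * (1 - (x i : ℂ) * z)⁻¹)
      = (∏ l, (1 - (x l : ℂ) * z)) * z * ∑ i, ((alph x y i : ℝ) : ℂ) * (1 - (x i : ℂ) * z)⁻¹ := by
      rw [Finset.mul_sum]
      refine Finset.sum_congr rfl fun i _ => by ring
    have e4 : ∑ i, ((alph x y i : ℝ) : ℂ) * (z⁻¹ ^ k * (1 - (x i : ℂ) * z)⁻¹ * (1 + I))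
      = z⁻¹ ^ k * (1 + I) * ∑ i, ((alph x y i : ℝ) : ℂ) * (1 - (x i : ℂ) * z)⁻¹ := by
      rw [Finset.mul_sum]
      refine Finset.sum_congr rfl fun i _ => by ring
    rw [e3, e4]
    generalize ∑ i, ((alph x y i : ℝ) : ℂ) * (1 - (x i : ℂ) * z)⁻¹ = S
    generalize ∏ l, (1 - (x l : ℂ) * z) = P at *
    push_cast
    generalize ∏ l, (-(y l : ℂ)) = P2
    rw [inv_pow, inv_pow, inv_pow, pow_succ]
    field_simp
  rw [e, intervalIntegral.integral_add, intervalIntegral.integral_finsetSum]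
  · simp_rw [intervalIntegral.integral_const_mul]
    rw [Complex.add_im, Complex.im_ofReal_mul, coef_zpow, Complex.im_sum]
    simp_rw [Complex.im_ofReal_mul]
    rw [av, Finset.mul_sum, mul_zero, zero_add]
    refine Finset.sum_congr rfl fun i _ => ?_
    rw [coef_gen (hx0 i).le (hp i)]; ring
  · exact fun i _ => (coef_cont (hx0 i).le (hp i) k).const_mul _
  · refine Continuous.intervalIntegrable ?_ _ _
    have := pathu_cont p
    exact continuous_const.mul (((this.cexp.inv₀ fun t => Complex.exp_ne_zero _).pow _).mul continuous_const)
  · have := IntervalIntegrable.sum Finset.univ (fun i _ => (coef_cont (hx0 i).le (hp i) k).const_mul ((alph x y i : ℝ) : ℂ))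
    refine this.congr (fun t _ => ?_)
    simp

def g1 (ξ : ℂ) : ℂ := ξ / (1 - ξ)
def g2 (ξ : ℂ) : ℂ := ξ / (1 - ξ) ^ 2

lemma taylor2 (F F1 F2 : ℝ → ℂ) (h1 : ∀ r ∈ Set.Icc (0:ℝ) 1, HasDerivAt F (F1 r) r)
    (h2 : ∀ r ∈ Set.Icc (0:ℝ) 1, HasDerivAt F1 (F2 r) r) (hc : ContinuousOn F2 (Set.Icc (0:ℝ) 1)) :
    F 1 = F 0 + F1 0 + ∫ r in (0:ℝ)..1, ((1 - r : ℝ) : ℂ) * F2 r := by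
  have hd : ∀ r ∈ Set.uIcc (0:ℝ) 1, HasDerivAt (fun r : ℝ => F r + ((1 - r : ℝ) : ℂ) * F1 r)
      (((1 - r : ℝ) : ℂ) * F2 r) r := by
    intro r hr
    rw [Set.uIcc_of_le zero_le_one] at hr
    have e : HasDerivAt (fun r : ℝ => ((1 - r : ℝ) : ℂ)) (-1) r := by
      have := ((hasDerivAt_id r).const_sub 1).ofReal_comp
      simpa using this
    refine ((h1 r hr).add (e.mul (h2 r hr))).congr_deriv ?_
    ring
  have hc' : ContinuousOn (fun r : ℝ => ((1 - r : ℝ) : ℂ) * F2 r) (Set.uIcc (0:ℝ) 1) := by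
    rw [Set.uIcc_of_le zero_le_one]
    exact (Continuous.continuousOn (by fun_prop)).mul hc
  rw [intervalIntegral.integral_eq_sub_of_hasDerivAt hd hc'.intervalIntegrable]
  simp

lemma seg_deriv (u0 w : ℂ) (r : ℝ) : HasDerivAt (fun r : ℝ => u0 + r * w) w r := by
  have := ((Complex.ofRealCLM.hasDerivAt (x := r)).mul_const w).const_add u0
  simpa using this

lemma g1_deriv {ξ : ℂ} (h : 1 - ξ ≠ 0) : HasDerivAt g1 (1 / (1 - ξ) ^ 2) ξ := by
  have := (hasDerivAt_id ξ).div ((hasDerivAt_id ξ).const_sub 1) h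
  refine this.congr_deriv ?_
  simp

lemma g1_comp_deriv (f : ℝ → ℂ) (f' : ℂ) (r : ℝ) (hf : HasDerivAt f f' r) (h : 1 - f r ≠ 0) :
    HasDerivAt (fun r => g1 (f r)) (1 / (1 - f r) ^ 2 * f') r :=
  (g1_deriv h).comp r hf

lemma factor_taylor (x : ℝ) (u0 w : ℂ)
    (hs : ∀ r ∈ Set.Icc (0:ℝ) 1, 1 - (x : ℂ) * Complex.exp (u0 + r * w) ∈ Complex.slitPlane) :
    (1 - (x : ℂ) * Complex.exp (u0 + w))⁻¹ = (1 - (x : ℂ) * Complex.exp u0)⁻¹ *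
      Complex.exp (w * g1 (x * Complex.exp u0) + w ^ 2 *
        ∫ r in (0:ℝ)..1, ((1 - r : ℝ) : ℂ) * g2 (x * Complex.exp (u0 + r * w))) := by
  have d0 : ∀ r : ℝ, HasDerivAt (fun r : ℝ => (x : ℂ) * Complex.exp (u0 + r * w))
    ((x : ℂ) * (Complex.exp (u0 + r * w) * w)) r := fun r => ((seg_deriv u0 w r).cexp).const_mul _
  have key := taylor2 (fun r => -Complex.log (1 - (x : ℂ) * Complex.exp (u0 + r * w)))
    (fun r => w * g1 (x * Complex.exp (u0 + r * w)))
    (fun r => w ^ 2 * g2 (x * Complex.exp (u0 + r * w))) ?_ ?_ ?_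
  · simp only [Complex.ofReal_one, one_mul, Complex.ofReal_zero, zero_mul, add_zero] at key
    have hs1 := Complex.slitPlane_ne_zero (hs 1 (by simp))
    have hs0 := Complex.slitPlane_ne_zero (hs 0 (by simp))
    simp only [Complex.ofReal_one, one_mul, Complex.ofReal_zero, zero_mul, add_zero] at hs1 hs0
    have k2 := congrArg Complex.exp key
    rw [add_assoc, Complex.exp_neg, Complex.exp_log hs1, Complex.exp_add (-_), Complex.exp_neg, Complex.exp_log hs0] at k2
    rw [k2]
    congr 3
    rw [← intervalIntegral.integral_const_mul]
    refine intervalIntegral.integral_congr fun r _ => ?_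
    ring
  · intro r hr
    have := Complex.slitPlane_ne_zero (hs r hr)
    refine ((((d0 r).const_sub 1).clog_real (hs r hr)).neg).congr_deriv ?_
    rw [g1]
    field_simp
  · intro r hr
    have := Complex.slitPlane_ne_zero (hs r hr)
    refine ((g1_comp_deriv _ _ r (d0 r) this).const_mul w).congr_deriv ?_
    rw [g2]
    field_simp
  · intro r hr
    have := Complex.slitPlane_ne_zero (hs r hr)
    have hc := (d0 r).continuousAt
    unfold g2
    exact (continuousAt_const.mul (hc.div ((continuousAt_const.sub hc).pow 2) (pow_ne_zero 2 this))).continuousWithinAt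

/-- saddle sums -/
def Gs {M : ℕ} (x y : Fin M → ℝ) (u : ℂ) : ℂ :=
  ∑ i, g1 (x i * Complex.exp u) + ∑ j, g1 (y j * Complex.exp (-u))
def G2s {M : ℕ} (x y : Fin M → ℝ) (u : ℂ) : ℂ :=
  ∑ i, g2 (x i * Complex.exp u) - ∑ j, g2 (y j * Complex.exp (-u))

lemma g2_int (x : ℝ) (u0 w : ℂ)
    (hs : ∀ r ∈ Set.Icc (0:ℝ) 1, 1 - (x : ℂ) * Complex.exp (u0 + r * w) ∈ Complex.slitPlane) :
    IntervalIntegrable (fun r : ℝ => ((1 - r : ℝ) : ℂ) * g2 (x * Complex.exp (u0 + r * w))) volume 0 1 := by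
  refine ContinuousOn.intervalIntegrable ?_
  rw [Set.uIcc_of_le zero_le_one]
  intro r hr
  have := Complex.slitPlane_ne_zero (hs r hr)
  have hc : ContinuousAt (fun r : ℝ => (x : ℂ) * Complex.exp (u0 + r * w)) r := by fun_prop
  have hc1 : ContinuousAt (fun r : ℝ => ((1 - r : ℝ) : ℂ)) r := by fun_prop
  unfold g2
  exact (hc1.mul (hc.div ((continuousAt_const.sub hc).pow 2) (pow_ne_zero 2 this))).continuousWithinAt

lemma Rf_taylor {M : ℕ} (x y : Fin M → ℝ) (u0 w : ℂ)
    (hsx : ∀ i, ∀ r ∈ Set.Icc (0:ℝ) 1, 1 - (x i : ℂ) * Complex.exp (u0 + r * w) ∈ Complex.slitPlane)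
    (hsy : ∀ i, ∀ r ∈ Set.Icc (0:ℝ) 1, 1 - (y i : ℂ) * Complex.exp (-(u0 + r * w)) ∈ Complex.slitPlane) :
    Rf x y (u0 + w) = Rf x y u0 * Complex.exp (w * Gs x y u0 + w ^ 2 *
      ∫ r in (0:ℝ)..1, ((1 - r : ℝ) : ℂ) * G2s x y (u0 + r * w)) := by
  have en : ∀ r : ℝ, -u0 + r * (-w) = -(u0 + r * w) := fun r => by ring
  have hsy' : ∀ i, ∀ r ∈ Set.Icc (0:ℝ) 1, 1 - (y i : ℂ) * Complex.exp (-u0 + r * (-w)) ∈ Complex.slitPlane := by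
    intro i r hr; rw [en]; exact hsy i r hr
  have hy : ∀ j, 1 - (y j : ℂ) * Complex.exp (-(u0 + w)) = (1 - (y j : ℂ) * Complex.exp (-u0)) *
      Complex.exp (w * g1 (y j * Complex.exp (-u0)) - w ^ 2 *
        ∫ r in (0:ℝ)..1, ((1 - r : ℝ) : ℂ) * g2 (y j * Complex.exp (-(u0 + r * w)))) := by
    intro j
    have := congrArg (fun z : ℂ => z⁻¹) (factor_taylor (y j) (-u0) (-w) (hsy' j))
    simp only [inv_inv, mul_inv, ← Complex.exp_neg] at this
    rw [show -(u0 + w) = -u0 + -w by ring, this]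
    congr 2
    simp_rw [en]
    ring
  have hI : ∫ r in (0:ℝ)..1, ((1 - r : ℝ) : ℂ) * G2s x y (u0 + r * w) =
      ∑ i, (∫ r in (0:ℝ)..1, ((1 - r : ℝ) : ℂ) * g2 (x i * Complex.exp (u0 + r * w))) -
      ∑ j, (∫ r in (0:ℝ)..1, ((1 - r : ℝ) : ℂ) * g2 (y j * Complex.exp (-(u0 + r * w)))) := by
    have i1 := fun i => g2_int (x i) u0 w (hsx i)
    have i2 : ∀ i, IntervalIntegrable (fun r : ℝ => ((1 - r : ℝ) : ℂ) * g2 (y i * Complex.exp (-(u0 + r * w)))) volume 0 1 := by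
      intro i
      have := g2_int (y i) (-u0) (-w) (hsy' i)
      simpa only [en] using this
    rw [← intervalIntegral.integral_finsetSum fun i _ => i1 i, ← intervalIntegral.integral_finsetSum fun i _ => i2 i,
      ← intervalIntegral.integral_sub]
    · refine intervalIntegral.integral_congr fun r _ => ?_
      simp only [G2s]
      rw [mul_sub, Finset.mul_sum, Finset.mul_sum]
    · refine (IntervalIntegrable.sum Finset.univ fun i _ => i1 i).congr fun t _ => ?_
      simp
    · refine (IntervalIntegrable.sum Finset.univ fun i _ => i2 i).congr fun t _ => ?_
      simp
  unfold Rf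
  rw [Finset.prod_congr rfl fun j _ => hy j, Finset.prod_congr rfl fun i _ => factor_taylor (x i) u0 w (hsx i),
    Finset.prod_mul_distrib, Finset.prod_mul_distrib, ← Complex.exp_sum, ← Complex.exp_sum, hI, Gs]
  rw [Finset.sum_sub_distrib, Finset.sum_add_distrib, ← Finset.mul_sum, ← Finset.mul_sum, ← Finset.mul_sum, ← Finset.mul_sum]
  rw [mul_mul_mul_comm, ← Complex.exp_add]
  congr 2
  ring

lemma riem {E : Type*} [NormedAddCommGroup E] [NormedSpace ℝ E] (H H1 H2 : ℝ → E) (B h : ℝ) (hB : 0 ≤ B)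
    (hh : 0 < h) (hh1 : h ≤ 1)
    (d1 : ∀ s, 0 ≤ s → HasDerivAt H (H1 s) s) (d2 : ∀ s, 0 ≤ s → HasDerivAt H1 (H2 s) s)
    (hb : ∀ s, 0 ≤ s → ‖H2 s‖ ≤ B * Real.exp (-s)) (M : ℕ) :
    ‖h • ∑ i : Fin M, H1 (h * ((i : ℕ) + 1 / 2)) - (H (h * M) - H 0)‖ ≤ 2 * B * h := by
  have cell : ∀ i : ℕ, ‖h • H1 (h * ((i : ℕ) + 1 / 2)) - (H (h * (i + 1 : ℕ)) - H (h * i))‖ ≤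
      B * h ^ 2 * Real.exp (-h) ^ i := by
    intro i
    set m := h * ((i : ℝ) + 1 / 2) with hm
    have hi : 0 ≤ h * i := by positivity
    have hI : Convex ℝ (Set.Icc (h * i) (h * (i + 1 : ℕ))) := convex_Icc _ _
    have hmem : m ∈ Set.Icc (h * i) (h * (i + 1 : ℕ)) := by
      rw [hm]; push_cast; constructor <;> nlinarith
    have b1 : ∀ s ∈ Set.Icc (h * i) (h * (i + 1 : ℕ)), ‖H2 s‖ ≤ B * Real.exp (-(h * i)) := by
      intro s hs
      refine (hb s (hi.trans hs.1)).trans ?_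
      gcongr
      exact hs.1
    have b2 : ∀ s ∈ Set.Icc (h * i) (h * (i + 1 : ℕ)), ‖H1 s - H1 m‖ ≤ B * Real.exp (-(h * i)) * h := by
      intro s hs
      have := hI.norm_image_sub_le_of_norm_hasDerivWithin_le
        (fun s hs => (d2 s (hi.trans hs.1)).hasDerivWithinAt) b1 hmem hs
      refine this.trans ?_
      have : ‖s - m‖ ≤ h := by
        rw [Real.norm_eq_abs, abs_le]
        have h1 := hs.1; have h2 := hs.2; have h3 := hmem.1; have h4 := hmem.2
        push_cast at h2 h4
        constructor <;> nlinarith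
      gcongr
    have b3 := hI.norm_image_sub_le_of_norm_hasDerivWithin_le (f := fun s => H s - s • H1 m)
        (f' := fun s => H1 s - H1 m)
        (fun s hs => by
          have := (d1 s (hi.trans hs.1)).sub ((hasDerivAt_id s).smul_const (H1 m))
          refine HasDerivAt.hasDerivWithinAt (this.congr_deriv ?_)
          simp) b2
        (Set.left_mem_Icc.2 (by push_cast; nlinarith)) (Set.right_mem_Icc.2 (by push_cast; nlinarith))
    have e1 : H (h * (i + 1 : ℕ)) - (h * (i + 1 : ℕ)) • H1 m - (H (h * i) - (h * i) • H1 m) =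
      -(h • H1 m - (H (h * (i + 1 : ℕ)) - H (h * i))) := by
      have : h * ((i + 1 : ℕ) : ℝ) = h * i + h := by push_cast; ring
      rw [this, add_smul]; abel
    rw [e1, norm_neg] at b3
    refine b3.trans (le_of_eq ?_)
    rw [← Real.exp_nat_mul]
    have : ‖h * ((i + 1 : ℕ) : ℝ) - h * i‖ = h := by
      rw [show h * ((i + 1 : ℕ) : ℝ) - h * i = h by push_cast; ring, Real.norm_of_nonneg hh.le]
    rw [this, show (i : ℝ) * -h = -(h * i) by ring]
    ring
  have e : h • ∑ i : Fin M, H1 (h * ((i : ℕ) + 1 / 2)) - (H (h * M) - H 0) =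
      ∑ i ∈ Finset.range M, (h • H1 (h * ((i : ℕ) + 1 / 2)) - (H (h * (i + 1 : ℕ)) - H (h * i))) := by
    rw [Finset.sum_sub_distrib, Finset.sum_range_sub (fun i : ℕ => H (h * i)), Finset.smul_sum,
      Fin.sum_univ_eq_sum_range (fun i => h • H1 (h * ((i : ℕ) + 1 / 2)))]
    simp
  rw [e]
  refine (norm_sum_le _ _).trans ((Finset.sum_le_sum fun i _ => cell i).trans ?_)
  rw [← Finset.mul_sum]
  have hq : Real.exp (-h) < 1 := by rw [Real.exp_lt_one_iff]; linarith
  have hs : ∑ i ∈ Finset.range M, Real.exp (-h) ^ i ≤ (1 - Real.exp (-h))⁻¹ := by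
    rw [← tsum_geometric_of_lt_one (Real.exp_pos _).le hq]
    exact (summable_geometric_of_lt_one (Real.exp_pos _).le hq).sum_le_tsum _ (fun i _ => by positivity)
  have hq2 : h / 2 ≤ 1 - Real.exp (-h) := by
    have h1 : Real.exp (-h) ≤ (1 + h)⁻¹ := by
      rw [Real.exp_neg]
      exact inv_anti₀ (by linarith) (by linarith [Real.add_one_le_exp h])
    have h2 : (1 + h)⁻¹ ≤ 1 - h / 2 := by
      rw [inv_le_iff_one_le_mul₀ (by linarith)]; nlinarith
    linarith
  have hs2 : (1 - Real.exp (-h))⁻¹ ≤ 2 / h := by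
    rw [← inv_div]
    exact inv_anti₀ (by positivity) hq2
  calc B * h ^ 2 * ∑ i ∈ Finset.range M, Real.exp (-h) ^ i ≤ B * h ^ 2 * (2 / h) := by
        gcongr; exact hs.trans hs2
    _ = 2 * B * h := by field_simp

def xs (b h : ℝ) (M : ℕ) : Fin M → ℝ := gx (b * Real.exp (-h / 2)) (Real.exp (-h)) M

lemma xs_eq (b h : ℝ) (M : ℕ) (i : Fin M) : xs b h M i = b * Real.exp (-(h * ((i : ℕ) + 1 / 2))) := by
  unfold xs gx
  rw [mul_assoc, ← Real.exp_nat_mul, ← Real.exp_add]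
  congr 2
  ring

lemma xs_bd {b h : ℝ} (hb : 0 < b) (hh : 0 < h) (M : ℕ) (i : Fin M) : 0 < xs b h M i ∧ xs b h M i ≤ b := by
  rw [xs_eq]
  refine ⟨by positivity, mul_le_of_le_one_right hb.le ?_⟩
  rw [Real.exp_le_one_iff]
  have : 0 ≤ h * ((i : ℕ) + 1 / 2 : ℝ) := by positivity
  linarith

lemma xs_inj {b h : ℝ} (hb : 0 < b) (hh : 0 < h) (M : ℕ) : Function.Injective (xs b h M) :=
  gx_inj (by positivity) (Real.exp_pos _) (by rw [Real.exp_lt_one_iff]; linarith) M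

lemma expneg_deriv (b s : ℝ) : HasDerivAt (fun s : ℝ => b * Real.exp (-s)) (-(b * Real.exp (-s))) s := by
  have := ((hasDerivAt_id s).neg.exp).const_mul b
  refine this.congr_deriv ?_
  simp

lemma rs_g2 {b h c0 Z : ℝ} (hb : 0 < b) (hb1 : b ≤ 1) (hh : 0 < h) (hh1 : h ≤ 1) (z : ℂ) (hc0 : 0 < c0)
    (hz : ∀ s ∈ Set.Icc 0 b, c0 ≤ ‖1 - (s : ℂ) * z‖) (hZ : ‖z‖ ≤ Z) (M : ℕ) (hM : Real.exp (-(h * M)) ≤ h) :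
    ‖∑ i, g2 (xs b h M i * z) - (h : ℂ)⁻¹ * g1 (b * z)‖ ≤ 2 * (Z * (1 + Z) / c0 ^ 3) + Z / c0 := by
  have hZ0 : 0 ≤ Z := (norm_nonneg _).trans hZ
  set ξ : ℝ → ℂ := fun s => ((b * Real.exp (-s) : ℝ) : ℂ) * z with hξ
  have hle : ∀ s, 0 ≤ s → b * Real.exp (-s) ∈ Set.Icc 0 b := by
    intro s hs
    refine ⟨by positivity, mul_le_of_le_one_right hb.le ?_⟩
    rw [Real.exp_le_one_iff]; linarith
  have hn : ∀ s, 0 ≤ s → c0 ≤ ‖1 - ξ s‖ := fun s hs => hz _ (hle s hs)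
  have hne : ∀ s, 0 ≤ s → 1 - ξ s ≠ 0 := fun s hs h => by
    have := hn s hs; rw [h, norm_zero] at this; linarith
  have hξd : ∀ s, HasDerivAt ξ (-ξ s) s := by
    intro s
    have := ((expneg_deriv b s).ofReal_comp).mul_const z
    refine this.congr_deriv ?_
    simp [hξ]
  have hξn : ∀ s, ‖ξ s‖ ≤ Z * Real.exp (-s) := by
    intro s
    simp only [hξ]
    rw [norm_mul, Complex.norm_real, Real.norm_of_nonneg (by positivity), mul_assoc]
    calc b * (Real.exp (-s) * ‖z‖) ≤ 1 * (Real.exp (-s) * Z) := by gcongr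
      _ = _ := by ring
  have key := riem (fun s => (1 - ξ s)⁻¹) (fun s => - g2 (ξ s)) (fun s => ξ s * (1 + ξ s) / (1 - ξ s) ^ 3)
    (Z * (1 + Z) / c0 ^ 3) h (by positivity) hh hh1 ?_ ?_ ?_ M
  · have e0 : ∀ s, 0 ≤ s → (1 - ξ s)⁻¹ = 1 + g1 (ξ s) := by
      intro s hs
      have := hne s hs
      rw [g1]; field_simp; ring
    have hM0 : 0 ≤ h * M := by positivity
    have exi : ∀ i : Fin M, ξ (h * ((i : ℕ) + 1 / 2)) = xs b h M i * z := by
      intro i; simp only [hξ]; rw [xs_eq]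
    have ex0 : ξ 0 = b * z := by simp [hξ]
    have tail : ‖g1 (ξ (h * M))‖ ≤ Z * h / c0 := by
      rw [g1, norm_div]
      have := hn _ hM0
      have h2 := hξn (h * M)
      have h3 : ‖ξ (h * M)‖ ≤ Z * h := h2.trans (by gcongr)
      gcongr
    beta_reduce at key
    rw [e0 _ hM0, e0 0 le_rfl, ex0] at key
    simp_rw [exi] at key
    have eq : ∑ i, g2 (xs b h M i * z) - (h : ℂ)⁻¹ * g1 (b * z) =
        -((h : ℂ)⁻¹ * ((h • ∑ i, -g2 (xs b h M i * z) - (1 + g1 (ξ (h * M)) - (1 + g1 (b * z)))) + g1 (ξ (h * M)))) := by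
      have : (h : ℂ) ≠ 0 := by exact_mod_cast hh.ne'
      rw [Complex.real_smul, Finset.sum_neg_distrib]
      generalize ∑ i, g2 (xs b h M i * z) = S
      field_simp
      ring
    rw [eq, norm_neg, norm_mul, norm_inv, Complex.norm_real, Real.norm_of_nonneg hh.le]
    calc _ ≤ h⁻¹ * (2 * (Z * (1 + Z) / c0 ^ 3) * h + Z * h / c0) := by
          gcongr
          exact (norm_add_le _ _).trans (add_le_add key tail)
      _ = _ := by field_simp
  · intro s hs
    have := hne s hs
    refine (((hξd s).const_sub 1).inv this).congr_deriv ?_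
    rw [g2]; ring
  · intro s hs
    have := hne s hs
    refine ((hξd s).div (((hξd s).const_sub 1).pow 2) (pow_ne_zero 2 this)).neg.congr_deriv ?_
    simp only [Pi.pow_apply]
    field_simp
    ring
  · intro s hs
    have h1 := hn s hs
    have h2 := hξn s
    have h3 : ‖1 + ξ s‖ ≤ 1 + Z := by
      refine (norm_add_le _ _).trans ?_
      rw [norm_one]
      have : Z * Real.exp (-s) ≤ Z := mul_le_of_le_one_right hZ0 (by rw [Real.exp_le_one_iff]; linarith)
      linarith
    rw [norm_div, norm_mul, norm_pow]
    calc _ ≤ Z * Real.exp (-s) * (1 + Z) / c0 ^ 3 := by gcongr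
      _ = _ := by ring

lemma rs_g1 {b h z : ℝ} (hb : 0 < b) (hb1 : b ≤ 1) (hh : 0 < h) (hh1 : h ≤ 1) (hz0 : 0 < z)
    (hz : b * z < 1) (M : ℕ) (hM : Real.exp (-(h * M)) ≤ h) :
    |∑ i, xs b h M i * z / (1 - xs b h M i * z) - h⁻¹ * (-Real.log (1 - b * z))| ≤
      2 * (z / (1 - b * z) ^ 2) + z / (1 - b * z) := by
  set ξ : ℝ → ℝ := fun s => (b * Real.exp (-s)) * z with hξ
  have h1z : 0 < 1 - b * z := by linarith
  have hn : ∀ s, 0 ≤ s → 1 - b * z ≤ 1 - ξ s := by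
    intro s hs
    have : ξ s ≤ b * z := by
      simp only [hξ]
      gcongr
      exact mul_le_of_le_one_right hb.le (by rw [Real.exp_le_one_iff]; linarith)
    linarith
  have hpos : ∀ s, 0 ≤ s → 0 < 1 - ξ s := fun s hs => by linarith [hn s hs]
  have hξd : ∀ s, HasDerivAt ξ (-ξ s) s := by
    intro s
    have := (expneg_deriv b s).mul_const z
    refine this.congr_deriv ?_
    simp [hξ]
  have hξp : ∀ s, 0 < ξ s := fun s => by simp only [hξ]; positivity
  have hξn : ∀ s, ξ s ≤ z * Real.exp (-s) := by
    intro s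
    simp only [hξ]
    calc b * Real.exp (-s) * z ≤ 1 * Real.exp (-s) * z := by gcongr
      _ = _ := by ring
  have key := riem (fun s => -Real.log (1 - ξ s)) (fun s => - (ξ s / (1 - ξ s))) (fun s => ξ s / (1 - ξ s) ^ 2)
    (z / (1 - b * z) ^ 2) h (by positivity) hh hh1 ?_ ?_ ?_ M
  · have hM0 : 0 ≤ h * M := by positivity
    have exi : ∀ i : Fin M, ξ (h * ((i : ℕ) + 1 / 2)) = xs b h M i * z := by
      intro i; simp only [hξ]; rw [xs_eq]
    have ex0 : ξ 0 = b * z := by simp [hξ]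
    have tail : |Real.log (1 - ξ (h * M))| ≤ z * h / (1 - b * z) := by
      have h2 := hξn (h * M)
      have h3 : ξ (h * M) ≤ z * h := h2.trans (by gcongr)
      have h4 := hpos _ hM0
      have h5 := Real.one_sub_inv_le_log_of_pos h4
      have h6 : Real.log (1 - ξ (h * M)) ≤ 0 := Real.log_nonpos h4.le (by linarith [hξp (h * M)])
      rw [abs_of_nonpos h6]
      have h7 : (1 - ξ (h * M))⁻¹ - 1 = ξ (h * M) / (1 - ξ (h * M)) := by field_simp; ring
      calc _ ≤ (1 - ξ (h * M))⁻¹ - 1 := by linarith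
        _ ≤ _ := by
          rw [h7]
          have := hn _ hM0
          gcongr
    beta_reduce at key
    rw [ex0] at key
    simp_rw [exi] at key
    rw [Real.norm_eq_abs, smul_eq_mul, Finset.sum_neg_distrib] at key
    have eq : ∑ i, xs b h M i * z / (1 - xs b h M i * z) - h⁻¹ * (-Real.log (1 - b * z)) =
        -(h⁻¹ * ((h * -∑ i, xs b h M i * z / (1 - xs b h M i * z) -
          (-Real.log (1 - ξ (h * M)) - -Real.log (1 - b * z))) - Real.log (1 - ξ (h * M)))) := by
      generalize ∑ i, xs b h M i * z / (1 - xs b h M i * z) = S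
      field_simp
      ring
    rw [eq, abs_neg, abs_mul, abs_inv, abs_of_pos hh]
    calc _ ≤ h⁻¹ * (2 * (z / (1 - b * z) ^ 2) * h + z * h / (1 - b * z)) := by
          gcongr
          exact (abs_sub _ _).trans (add_le_add key tail)
      _ = _ := by field_simp
  · intro s hs
    have := (hpos s hs).ne'
    refine ((((hξd s).const_sub 1).log this).neg).congr_deriv ?_
    field_simp
  · intro s hs
    have := (hpos s hs).ne'
    refine ((hξd s).div ((hξd s).const_sub 1) this).neg.congr_deriv ?_
    field_simp
    ring
  · intro s hs
    have h1 := hn s hs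
    have h2 := hξn s
    rw [Real.norm_of_nonneg (div_nonneg (hξp s).le (by positivity))]
    calc _ ≤ z * Real.exp (-s) / (1 - b * z) ^ 2 := by gcongr
      _ = _ := by ring

/-- saddle point data -/
structure SP (b η θ uc v c : ℝ) : Prop where
  hb : 0 < b
  hb1 : b ≤ 1
  hη : 0 < η
  hθ : 0 < θ
  hB : b * Real.exp uc < 1
  hA : b * Real.exp (-uc) < 1
  hρ : η⁻¹ * (b * Real.exp uc / (1 - b * Real.exp uc)) = θ⁻¹ * (b * Real.exp (-uc) / (1 - b * Real.exp (-uc)))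
  hv : v = -η⁻¹ * Real.log (1 - b * Real.exp uc) - θ⁻¹ * Real.log (1 - b * Real.exp (-uc))
  hc : 0 < c
  hc3 : 2 * c ^ 3 = η⁻¹ * (b * Real.exp uc / (1 - b * Real.exp uc) ^ 2) +
    θ⁻¹ * (b * Real.exp (-uc) / (1 - b * Real.exp (-uc)) ^ 2)

lemma SP.swap {b η θ uc v c : ℝ} (h : SP b η θ uc v c) : SP b θ η (-uc) v c where
  hb := h.hb
  hb1 := h.hb1
  hη := h.hθ
  hθ := h.hη
  hB := h.hA
  hA := by simpa using h.hB
  hρ := by simpa using h.hρ.symm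
  hv := by rw [neg_neg, h.hv]; ring
  hc := h.hc
  hc3 := by rw [neg_neg, h.hc3]; ring

def KR (δ : ℝ) : Set ℂ := {w | 0 ≤ w.im ∧ w.im ≤ Real.pi ∧ 0 ≤ w.re ∧ w.re ≤ w.im + δ}

lemma KR_smul {δ : ℝ} (hδ : 0 ≤ δ) {w : ℂ} (hw : w ∈ KR δ) {r : ℝ} (h0 : 0 ≤ r) (h1 : r ≤ 1) :
    (r : ℂ) * w ∈ KR δ := by
  obtain ⟨a1, a2, a3, a4⟩ := hw
  simp only [KR, Set.mem_ofPred_eq, Complex.im_ofReal_mul, Complex.re_ofReal_mul]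
  refine ⟨by positivity, by nlinarith, by positivity, by nlinarith⟩

lemma KR_norm {δ : ℝ} (hδ1 : δ ≤ 1) {w : ℂ} (hw : w ∈ KR δ) : ‖w‖ ≤ 9 := by
  obtain ⟨a1, a2, a3, a4⟩ := hw
  have := Complex.norm_le_abs_re_add_abs_im w
  rw [abs_of_nonneg a1, abs_of_nonneg a3] at this
  linarith [Real.pi_le_four]

lemma KR_compact {δ : ℝ} (hδ1 : δ ≤ 1) : IsCompact (KR δ) := by
  refine Metric.isCompact_of_isClosed_isBounded ?_ ?_
  · have : KR δ = {w : ℂ | 0 ≤ w.im} ∩ ({w | w.im ≤ Real.pi} ∩ ({w | 0 ≤ w.re} ∩ {w | w.re ≤ w.im + δ})) := by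
      ext w; simp [KR]
    rw [this]
    exact (isClosed_le continuous_const Complex.continuous_im).inter
      ((isClosed_le Complex.continuous_im continuous_const).inter
      ((isClosed_le continuous_const Complex.continuous_re).inter
      (isClosed_le Complex.continuous_re (Complex.continuous_im.add continuous_const))))
  · refine (Metric.isBounded_closedBall (x := (0:ℂ)) (r := 9)).subset fun w hw => ?_
    simpa using KR_norm hδ1 hw

/-- region facts -/
structure Reg (b uc δ c0 : ℝ) : Prop where
  hδ : 0 < δ
  hδ1 : δ ≤ 1
  hc0 : 0 < c0
  n1 : ∀ w ∈ KR δ, ∀ s ∈ Set.Icc 0 b, c0 ≤ ‖1 - (s : ℂ) * Complex.exp (uc + w)‖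
  n2 : ∀ w ∈ KR δ, ∀ s ∈ Set.Icc 0 b, c0 ≤ ‖1 - (s : ℂ) * Complex.exp (-(uc + w))‖
  s1 : ∀ w ∈ KR δ, ∀ s ∈ Set.Icc 0 b, 1 - (s : ℂ) * Complex.exp (uc + w) ∈ Complex.slitPlane
  s2 : ∀ w ∈ KR δ, ∀ s ∈ Set.Icc 0 b, 1 - (s : ℂ) * Complex.exp (-(uc + w)) ∈ Complex.slitPlane
  hp : b * Real.exp (uc + δ) < 1

lemma SP.reg {b η θ uc v c : ℝ} (h : SP b η θ uc v c) : ∃ δ c0, Reg b uc δ c0 := by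
  have hb := h.hb
  obtain ⟨δ, hδ, hδ1, hp⟩ : ∃ δ, 0 < δ ∧ δ ≤ 1 ∧ b * Real.exp (uc + δ) < 1 := by
    have hcont : ContinuousAt (fun δ : ℝ => b * Real.exp (uc + δ)) 0 := by fun_prop
    have h0 : ∀ᶠ δ in 𝓝 (0:ℝ), b * Real.exp (uc + δ) < 1 := by
      apply hcont.eventually_lt continuousAt_const
      simpa using h.hB
    have h1 : ∀ᶠ δ in 𝓝[>] (0:ℝ), b * Real.exp (uc + δ) < 1 := h0.filter_mono nhdsWithin_le_nhds
    have h2 : ∀ᶠ δ in 𝓝[>] (0:ℝ), δ ∈ Set.Ioc (0:ℝ) 1 := Ioc_mem_nhdsGT zero_lt_one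
    obtain ⟨δ, a, b⟩ := (h1.and h2).exists
    exact ⟨δ, b.1, b.2, a⟩
  have s1 : ∀ w ∈ KR δ, ∀ s ∈ Set.Icc 0 b, 1 - (s : ℂ) * Complex.exp (uc + w) ∈ Complex.slitPlane := by
    intro w hw s hs
    obtain ⟨a1, a2, a3, a4⟩ := hw
    refine one_sub_slit hs.1 (by simpa using a1) (by simpa using a2) ?_
    intro h0
    have h0 : w.im = 0 := by simpa using h0
    simp only [Complex.add_re, Complex.ofReal_re]
    refine lt_of_le_of_lt ?_ hp
    have h1 : s ≤ b := hs.2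
    gcongr
    linarith
  have nn2 : ∀ w ∈ KR δ, ∀ s ∈ Set.Icc 0 b, ‖(s : ℂ) * Complex.exp (-(uc + w))‖ ≤ b * Real.exp (-uc) := by
    intro w hw s hs
    obtain ⟨a1, a2, a3, a4⟩ := hw
    rw [norm_mul, Complex.norm_real, Real.norm_of_nonneg hs.1, Complex.norm_exp]
    have h1 : s ≤ b := hs.2
    gcongr
    simp; exact a3
  have hcomp : IsCompact (Set.Icc 0 b ×ˢ KR δ) := isCompact_Icc.prod (KR_compact hδ1)
  have hne : (Set.Icc 0 b ×ˢ KR δ).Nonempty := ⟨(0, 0), by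
    refine ⟨⟨le_rfl, hb.le⟩, ?_⟩
    simp [KR, Real.pi_pos.le, hδ.le]⟩
  obtain ⟨m, hm, hmin⟩ := hcomp.exists_isMinOn hne
    (f := fun q : ℝ × ℂ => ‖1 - (q.1 : ℂ) * Complex.exp (uc + q.2)‖) (by fun_prop)
  have hm0 : 0 < ‖1 - (m.1 : ℂ) * Complex.exp (uc + m.2)‖ :=
    norm_pos_iff.2 (Complex.slitPlane_ne_zero (s1 m.2 hm.2 m.1 hm.1))
  refine ⟨δ, min ‖1 - (m.1 : ℂ) * Complex.exp (uc + m.2)‖ (1 - b * Real.exp (-uc)), hδ, hδ1,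
    lt_min hm0 (by linarith [h.hA]), ?_, ?_, s1, ?_, hp⟩
  · intro w hw s hs
    exact (min_le_left _ _).trans (hmin (show (s, w) ∈ _ from ⟨hs, hw⟩))
  · intro w hw s hs
    refine (min_le_right _ _).trans ?_
    have h1 := norm_sub_norm_le (1 : ℂ) ((s : ℂ) * Complex.exp (-(uc + w)))
    rw [norm_one] at h1
    linarith [nn2 w hw s hs]
  · intro w hw s hs
    have h1 := nn2 w hw s hs
    have h2 := Complex.re_le_norm ((s : ℂ) * Complex.exp (-(uc + w)))
    rw [Complex.mem_slitPlane_iff]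
    left
    rw [Complex.sub_re, Complex.one_re]
    linarith [h.hA]

def rho (b η θ : ℝ) (u : ℂ) : ℂ :=
  (η : ℂ)⁻¹ * g1 (b * Complex.exp u) - (θ : ℂ)⁻¹ * g1 (b * Complex.exp (-u))

def rho' (b η θ : ℝ) (u : ℂ) : ℂ :=
  (η : ℂ)⁻¹ * g2 (b * Complex.exp u) + (θ : ℂ)⁻¹ * g2 (b * Complex.exp (-u))

lemma rho_deriv (b η θ : ℝ) {u : ℂ} (h1 : 1 - (b : ℂ) * Complex.exp u ≠ 0)
    (h2 : 1 - (b : ℂ) * Complex.exp (-u) ≠ 0) : HasDerivAt (rho b η θ) (rho' b η θ u) u := by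
  have d1 : HasDerivAt (fun u => (b : ℂ) * Complex.exp u) (b * Complex.exp u) u :=
    (Complex.hasDerivAt_exp u).const_mul _
  have d2 : HasDerivAt (fun u => (b : ℂ) * Complex.exp (-u)) (b * (Complex.exp (-u) * (-1))) u :=
    ((hasDerivAt_neg u).cexp).const_mul _
  have k1 := ((g1_deriv h1).comp u d1).const_mul (η : ℂ)⁻¹
  have k2 := ((g1_deriv h2).comp u d2).const_mul (θ : ℂ)⁻¹
  refine (k1.sub k2).congr_deriv ?_
  unfold rho' g2
  field_simp
  ring

lemma SP.rho_uc {b η θ uc v c : ℝ} (h : SP b η θ uc v c) : rho b η θ uc = 0 := by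
  have := h.hρ
  unfold rho g1
  rw [sub_eq_zero]
  exact_mod_cast this

lemma SP.rho'_uc {b η θ uc v c : ℝ} (h : SP b η θ uc v c) : rho' b η θ uc = ((2 * c ^ 3 : ℝ) : ℂ) := by
  rw [h.hc3]
  unfold rho' g2
  push_cast
  ring

lemma SP.rho_lip {b η θ uc v c δ c0 : ℝ} (h : SP b η θ uc v c) (hr : Reg b uc δ c0) :
    ∃ C, 0 < C ∧ ∀ w ∈ KR δ, ‖rho b η θ (uc + w)‖ ≤ C * ‖w‖ := by
  have hη := h.hη
  have hθ := h.hθ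
  have hb := h.hb
  have hc0 := hr.hc0
  set Z := Real.exp (|uc| + 9) with hZ
  refine ⟨(η⁻¹ + θ⁻¹) * (Z / c0 ^ 2), by positivity, fun w hw => ?_⟩
  have hbb : b ∈ Set.Icc 0 b := ⟨hb.le, le_rfl⟩
  have hne1 : ∀ r ∈ Set.Icc (0:ℝ) 1, 1 - (b : ℂ) * Complex.exp (uc + r * w) ≠ 0 := fun r hr' =>
    Complex.slitPlane_ne_zero (hr.s1 _ (KR_smul hr.hδ.le hw hr'.1 hr'.2) b hbb)
  have hne2 : ∀ r ∈ Set.Icc (0:ℝ) 1, 1 - (b : ℂ) * Complex.exp (-(uc + r * w)) ≠ 0 := fun r hr' =>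
    Complex.slitPlane_ne_zero (hr.s2 _ (KR_smul hr.hδ.le hw hr'.1 hr'.2) b hbb)
  have hd : ∀ r ∈ Set.Icc (0:ℝ) 1, HasDerivWithinAt (fun r : ℝ => rho b η θ (uc + r * w))
      (rho' b η θ (uc + r * w) * w) (Set.Icc (0:ℝ) 1) r := by
    intro r hr'
    have k : HasDerivAt (rho b η θ) (rho' b η θ (uc + r * w)) ((fun r : ℝ => (uc : ℂ) + r * w) r) :=
      rho_deriv b η θ (hne1 r hr') (hne2 r hr')
    exact (k.comp r (seg_deriv (uc : ℂ) w r)).hasDerivWithinAt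
  have hZb : ∀ w : ℂ, w ∈ KR δ → ‖(b : ℂ) * Complex.exp (uc + w)‖ ≤ Z ∧ ‖(b : ℂ) * Complex.exp (-(uc + w))‖ ≤ Z := by
    intro w hw
    have h9 := KR_norm hr.hδ1 hw
    have h8 := (Complex.abs_re_le_norm w).trans h9
    have h7 := abs_le.1 h8
    have h6 := abs_le.1 (le_refl |uc|)
    rw [norm_mul, norm_mul, Complex.norm_real, Real.norm_of_nonneg hb.le, Complex.norm_exp, Complex.norm_exp]
    constructor
    · refine (mul_le_of_le_one_left (Real.exp_pos _).le h.hb1).trans ?_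
      rw [hZ]; gcongr; simp; linarith
    · refine (mul_le_of_le_one_left (Real.exp_pos _).le h.hb1).trans ?_
      rw [hZ]; gcongr; simp; linarith
  have hbd : ∀ r ∈ Set.Icc (0:ℝ) 1, ‖rho' b η θ (uc + r * w) * w‖ ≤ (η⁻¹ + θ⁻¹) * (Z / c0 ^ 2) * ‖w‖ := by
    intro r hr'
    have hw' := KR_smul hr.hδ.le hw hr'.1 hr'.2
    rw [norm_mul]
    gcongr
    have k1 := hr.n1 _ hw' b hbb
    have k2 := hr.n2 _ hw' b hbb
    have k3 := (hZb _ hw').1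
    have k4 := (hZb _ hw').2
    unfold rho' g2
    refine (norm_add_le _ _).trans ?_
    rw [add_mul, norm_mul, norm_mul, norm_inv, norm_inv, Complex.norm_real, Complex.norm_real,
      Real.norm_of_nonneg hη.le, Real.norm_of_nonneg hθ.le, norm_div, norm_div, norm_pow, norm_pow]
    gcongr
  have := (convex_Icc (0:ℝ) 1).norm_image_sub_le_of_norm_hasDerivWithin_le hd hbd
    (Set.left_mem_Icc.2 zero_le_one) (Set.right_mem_Icc.2 zero_le_one)
  simpa [h.rho_uc] using this

lemma im_g1 (ξ : ℂ) : (g1 ξ).im = ξ.im / Complex.normSq (1 - ξ) := by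
  unfold g1
  rw [Complex.div_im]
  simp
  ring

lemma SP.rho_im {b η θ uc v c δ c0 : ℝ} (h : SP b η θ uc v c) (hr : Reg b uc δ c0) :
    ∃ C, 0 < C ∧ ∀ w ∈ KR δ, C * Real.sin w.im ≤ (rho b η θ (uc + w)).im := by
  have hη := h.hη
  have hθ := h.hθ
  have hb := h.hb
  have hc0 := hr.hc0
  set Z := Real.exp (|uc| + 9) with hZ
  refine ⟨η⁻¹ * (b * Real.exp uc / (1 + Z) ^ 2), by positivity, fun w hw => ?_⟩
  have hbb : b ∈ Set.Icc 0 b := ⟨hb.le, le_rfl⟩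
  have hw' := hw
  obtain ⟨a1, a2, a3, a4⟩ := hw'
  have hsin := Real.sin_nonneg_of_nonneg_of_le_pi a1 a2
  unfold rho
  rw [Complex.sub_im, ← Complex.ofReal_inv, ← Complex.ofReal_inv, Complex.im_ofReal_mul, Complex.im_ofReal_mul,
    im_g1, im_g1]
  have e1 : ((b : ℂ) * Complex.exp (uc + w)).im = b * (Real.exp (uc + w.re) * Real.sin w.im) := by
    rw [Complex.im_ofReal_mul, Complex.exp_im]; simp
  have e2 : ((b : ℂ) * Complex.exp (-(uc + w))).im = -(b * (Real.exp (-(uc + w.re)) * Real.sin w.im)) := by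
    rw [Complex.im_ofReal_mul, Complex.exp_im]; simp
  rw [e1, e2]
  have p1 : 0 < ‖1 - (b : ℂ) * Complex.exp (uc + w)‖ := hc0.trans_le (hr.n1 _ hw b hbb)
  have p2 : ‖1 - (b : ℂ) * Complex.exp (uc + w)‖ ≤ 1 + Z := by
    refine (norm_sub_le _ _).trans ?_
    rw [norm_one, norm_mul, Complex.norm_real, Real.norm_of_nonneg hb.le, Complex.norm_exp]
    have h9 := KR_norm hr.hδ1 hw
    have h8 := (Complex.abs_re_le_norm w).trans h9
    have h7 := abs_le.1 h8
    have h6 := abs_le.1 (le_refl |uc|)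
    gcongr
    refine (mul_le_of_le_one_left (Real.exp_pos _).le h.hb1).trans ?_
    rw [hZ]; gcongr; simp; linarith
  rw [Complex.normSq_eq_norm_sq, Complex.normSq_eq_norm_sq]
  have t2 : 0 ≤ θ⁻¹ * (b * (Real.exp (-(uc + w.re)) * Real.sin w.im) / ‖1 - (b : ℂ) * Complex.exp (-(uc + w))‖ ^ 2) := by
    positivity
  have t1 : η⁻¹ * (b * Real.exp uc / (1 + Z) ^ 2) * Real.sin w.im ≤
      η⁻¹ * (b * (Real.exp (uc + w.re) * Real.sin w.im) / ‖1 - (b : ℂ) * Complex.exp (uc + w)‖ ^ 2) := by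
    calc _ = η⁻¹ * (b * (Real.exp uc * Real.sin w.im) / (1 + Z) ^ 2) := by ring
      _ ≤ _ := by
        gcongr
        linarith
  rw [neg_div, mul_neg, sub_neg_eq_add]
  linarith

def Wf (b η θ uc : ℝ) (w : ℂ) : ℂ := w ^ 2 * ∫ r in (0:ℝ)..1, ((1 - r : ℝ) : ℂ) * rho b η θ (uc + r * w)

lemma g1_cont (f : ℝ → ℂ) (s : Set ℝ) (hf : ContinuousOn f s) (h : ∀ r ∈ s, 1 - f r ≠ 0) :
    ContinuousOn (fun r => g1 (f r)) s := by
  unfold g1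
  exact hf.div (continuousOn_const.sub hf) h

lemma g2_cont (f : ℝ → ℂ) (s : Set ℝ) (hf : ContinuousOn f s) (h : ∀ r ∈ s, 1 - f r ≠ 0) :
    ContinuousOn (fun r => g2 (f r)) s := by
  unfold g2
  exact hf.div ((continuousOn_const.sub hf).pow 2) fun r hr => pow_ne_zero 2 (h r hr)

lemma Reg.rho_cont {b uc δ c0 : ℝ} (hb : 0 < b) (hr : Reg b uc δ c0) (η θ : ℝ) {w : ℂ} (hw : w ∈ KR δ) :
    ContinuousOn (fun r : ℝ => rho b η θ (uc + r * w)) (Set.Icc 0 1) := by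
  have hbb : b ∈ Set.Icc 0 b := ⟨hb.le, le_rfl⟩
  unfold rho
  refine (continuousOn_const.mul (g1_cont _ _ (by fun_prop) fun r hr' => ?_)).sub
    (continuousOn_const.mul (g1_cont _ _ (by fun_prop) fun r hr' => ?_))
  · exact Complex.slitPlane_ne_zero (hr.s1 _ (KR_smul hr.hδ.le hw hr'.1 hr'.2) b hbb)
  · exact Complex.slitPlane_ne_zero (hr.s2 _ (KR_smul hr.hδ.le hw hr'.1 hr'.2) b hbb)

lemma Reg.G2s_cont {b uc δ c0 : ℝ} (hr : Reg b uc δ c0) {M : ℕ} (x y : Fin M → ℝ)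
    (hx : ∀ i, x i ∈ Set.Icc 0 b) (hy : ∀ i, y i ∈ Set.Icc 0 b) {w : ℂ} (hw : w ∈ KR δ) :
    ContinuousOn (fun r : ℝ => G2s x y (uc + r * w)) (Set.Icc 0 1) := by
  unfold G2s
  refine (continuousOn_finsetSum _ fun i _ => g2_cont _ _ (by fun_prop) fun r hr' => ?_).sub
    (continuousOn_finsetSum _ fun i _ => g2_cont _ _ (by fun_prop) fun r hr' => ?_)
  · exact Complex.slitPlane_ne_zero (hr.s1 _ (KR_smul hr.hδ.le hw hr'.1 hr'.2) _ (hx i))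
  · exact Complex.slitPlane_ne_zero (hr.s2 _ (KR_smul hr.hδ.le hw hr'.1 hr'.2) _ (hy i))

theorem SP.approx {b η θ uc v c δ c0 : ℝ} (h : SP b η θ uc v c) (hr : Reg b uc δ c0) :
    ∃ C, 0 < C ∧ ∀ ε : ℝ, 0 < ε → η * ε ≤ 1 → θ * ε ≤ 1 → ∀ M : ℕ, Real.exp (-(η * ε * M)) ≤ η * ε →
      Real.exp (-(θ * ε * M)) ≤ θ * ε → ∀ w ∈ KR δ, ∀ κ : ℝ, ∃ e : ℂ, ‖e‖ ≤ C * ‖w‖ ∧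
      Rf (xs b (η * ε) M) (xs b (θ * ε) M) (uc + w) * Complex.exp (-κ * (uc + w)) =
      Rf (xs b (η * ε) M) (xs b (θ * ε) M) uc * Complex.exp (-κ * uc) *
        Complex.exp (w * (v / ε - κ : ℝ) + (ε : ℂ)⁻¹ * Wf b η θ uc w + e) := by
  have hη := h.hη
  have hθ := h.hθ
  have hb := h.hb
  have hb1 := h.hb1
  have hc0 := hr.hc0
  have hB' : 0 < 1 - b * Real.exp uc := by linarith [h.hB]
  have hA' : 0 < 1 - b * Real.exp (-uc) := by linarith [h.hA]
  set Z := Real.exp (|uc| + 9) with hZ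
  have hZb : ∀ w : ℂ, w ∈ KR δ → ‖Complex.exp (uc + w)‖ ≤ Z ∧ ‖Complex.exp (-(uc + w))‖ ≤ Z := by
    intro w hw
    have h9 := KR_norm hr.hδ1 hw
    have h8 := (Complex.abs_re_le_norm w).trans h9
    have h7 := abs_le.1 h8
    have h6 := abs_le.1 (le_refl |uc|)
    rw [Complex.norm_exp, Complex.norm_exp]
    constructor
    · rw [hZ]; gcongr; simp; linarith
    · rw [hZ]; gcongr; simp; linarith
  set C2 := 2 * (Z * (1 + Z) / c0 ^ 3) + Z / c0 with hC2
  set C1 := (2 * (Real.exp uc / (1 - b * Real.exp uc) ^ 2) + Real.exp uc / (1 - b * Real.exp uc)) +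
    (2 * (Real.exp (-uc) / (1 - b * Real.exp (-uc)) ^ 2) + Real.exp (-uc) / (1 - b * Real.exp (-uc))) with hC1
  have hZ0 : 0 < Z := Real.exp_pos _
  have hC2p : 0 < C2 := by positivity
  have hC1p : 0 < C1 := by positivity
  refine ⟨C1 + 9 * (C2 + C2), by positivity, ?_⟩
  intro ε hε hηε hθε M hM1 hM2 w hw κ
  have hx := fun i => xs_bd hb (mul_pos hη hε) M i
  have hy := fun i => xs_bd hb (mul_pos hθ hε) M i
  set x := xs b (η * ε) M with hxd
  set y := xs b (θ * ε) M with hyd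
  have hx' : ∀ i, x i ∈ Set.Icc 0 b := fun i => ⟨(hx i).1.le, (hx i).2⟩
  have hy' : ∀ i, y i ∈ Set.Icc 0 b := fun i => ⟨(hy i).1.le, (hy i).2⟩
  have b1 : ‖Gs x y uc - ((v / ε : ℝ) : ℂ)‖ ≤ C1 := by
    have r1 := rs_g1 hb hb1 (mul_pos hη hε) hηε (Real.exp_pos uc) h.hB M hM1
    have r2 := rs_g1 hb hb1 (mul_pos hθ hε) hθε (Real.exp_pos (-uc)) h.hA M hM2
    rw [← hxd] at r1
    rw [← hyd] at r2
    have e : Gs x y uc - ((v / ε : ℝ) : ℂ) = (((∑ i, x i * Real.exp uc / (1 - x i * Real.exp uc) -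
        (η * ε)⁻¹ * (-Real.log (1 - b * Real.exp uc))) + (∑ i, y i * Real.exp (-uc) / (1 - y i * Real.exp (-uc)) -
        (θ * ε)⁻¹ * (-Real.log (1 - b * Real.exp (-uc)))) : ℝ) : ℂ) := by
      have hv : v / ε = (η * ε)⁻¹ * (-Real.log (1 - b * Real.exp uc)) +
          (θ * ε)⁻¹ * (-Real.log (1 - b * Real.exp (-uc))) := by
        rw [h.hv, mul_inv, mul_inv]; ring
      rw [hv]
      unfold Gs g1
      push_cast
      ring
    rw [e, Complex.norm_real, Real.norm_eq_abs]
    exact (abs_add_le _ _).trans (add_le_add r1 r2)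
  have b2 : ∀ r ∈ Set.Icc (0:ℝ) 1, ‖G2s x y (uc + r * w) - (ε : ℂ)⁻¹ * rho b η θ (uc + r * w)‖ ≤ C2 + C2 := by
    intro r hr'
    have hw' := KR_smul hr.hδ.le hw hr'.1 hr'.2
    have r1 := rs_g2 hb hb1 (mul_pos hη hε) hηε _ hc0 (hr.n1 _ hw') (hZb _ hw').1 M hM1
    have r2 := rs_g2 hb hb1 (mul_pos hθ hε) hθε _ hc0 (hr.n2 _ hw') (hZb _ hw').2 M hM2
    rw [← hxd] at r1
    rw [← hyd] at r2
    refine le_trans (le_of_eq ?_) ((norm_sub_le _ _).trans (add_le_add r1 r2))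
    congr 1
    unfold G2s rho
    push_cast
    rw [mul_inv, mul_inv]
    ring
  refine ⟨w * (Gs x y uc - ((v / ε : ℝ) : ℂ)) + w ^ 2 *
    ∫ r in (0:ℝ)..1, ((1 - r : ℝ) : ℂ) * (G2s x y (uc + r * w) - (ε : ℂ)⁻¹ * rho b η θ (uc + r * w)), ?_, ?_⟩
  · have hI : ‖∫ r in (0:ℝ)..1, ((1 - r : ℝ) : ℂ) * (G2s x y (uc + r * w) - (ε : ℂ)⁻¹ * rho b η θ (uc + r * w))‖ ≤
        (C2 + C2) * |1 - 0| := by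
      refine intervalIntegral.norm_integral_le_of_norm_le_const fun r hr' => ?_
      rw [Set.uIoc_of_le zero_le_one] at hr'
      have := b2 r ⟨hr'.1.le, hr'.2⟩
      rw [norm_mul, Complex.norm_real, Real.norm_of_nonneg (by linarith [hr'.2])]
      calc _ ≤ 1 * (C2 + C2) := by gcongr; linarith [hr'.1]
        _ = _ := one_mul _
    have h9 := KR_norm hr.hδ1 hw
    refine (norm_add_le _ _).trans ?_
    rw [norm_mul, norm_mul, norm_pow]
    rw [sub_zero, abs_one, mul_one] at hI
    calc _ ≤ ‖w‖ * C1 + (9 * ‖w‖) * (C2 + C2) := by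
          gcongr
          rw [sq]; gcongr
      _ = _ := by ring
  · rw [Rf_taylor x y uc w (fun i r hr' => hr.s1 _ (KR_smul hr.hδ.le hw hr'.1 hr'.2) _ (hx' i))
      (fun i r hr' => hr.s2 _ (KR_smul hr.hδ.le hw hr'.1 hr'.2) _ (hy' i))]
    rw [mul_assoc, mul_assoc, ← Complex.exp_add, ← Complex.exp_add]
    congr 2
    have c1 := hr.G2s_cont x y hx' hy' hw
    have c2 := hr.rho_cont hb η θ hw
    have c3 : ContinuousOn (fun r : ℝ => ((1 - r : ℝ) : ℂ)) (Set.Icc 0 1) := by fun_prop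
    have hsp : ∫ r in (0:ℝ)..1, ((1 - r : ℝ) : ℂ) * (G2s x y (uc + r * w) - (ε : ℂ)⁻¹ * rho b η θ (uc + r * w)) =
        (∫ r in (0:ℝ)..1, ((1 - r : ℝ) : ℂ) * G2s x y (uc + r * w)) -
        (ε : ℂ)⁻¹ * ∫ r in (0:ℝ)..1, ((1 - r : ℝ) : ℂ) * rho b η θ (uc + r * w) := by
      rw [← intervalIntegral.integral_const_mul, ← intervalIntegral.integral_sub]
      · refine intervalIntegral.integral_congr fun r _ => ?_
        ring
      · apply ContinuousOn.intervalIntegrable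
        rw [Set.uIcc_of_le zero_le_one]
        exact c3.mul c1
      · apply ContinuousOn.intervalIntegrable
        rw [Set.uIcc_of_le zero_le_one]
        exact continuousOn_const.mul (c3.mul c2)
    rw [hsp, Wf]
    push_cast
    ring

lemma sin_lower {t r : ℝ} (ht0 : 0 ≤ t) (ht : t ≤ Real.pi) (hr0 : 0 ≤ r) (hr1 : r ≤ 1) :
    2 / Real.pi * (t * (r * (1 - r))) ≤ Real.sin (r * t) := by
  have hpi := Real.pi_pos
  have hrt : 0 ≤ r * t := by positivity
  rcases le_total (r * t) (Real.pi / 2) with h | h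
  · refine le_trans ?_ (Real.mul_le_sin hrt h)
    have h3 : t * (r * (1 - r)) ≤ r * t := by nlinarith [mul_nonneg hrt hr0]
    exact mul_le_mul_of_nonneg_left h3 (by positivity)
  · have h1 : r * t ≤ Real.pi := by nlinarith
    have := Real.mul_le_sin (x := Real.pi - r * t) (by linarith) (by linarith)
    rw [Real.sin_pi_sub] at this
    refine le_trans ?_ this
    gcongr
    have h2 : r * t ≤ r * Real.pi := by gcongr
    have h3 : t * (r * (1 - r)) ≤ Real.pi * (1 * (1 - r)) := by
      gcongr
    nlinarith

theorem SP.W_re {b η θ uc v c δ c0 : ℝ} (h : SP b η θ uc v c) (hr : Reg b uc δ c0) :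
    ∃ C c3, 0 < C ∧ 0 < c3 ∧ ∀ σ t : ℝ, 0 < σ → σ ≤ δ → 0 ≤ t → t ≤ Real.pi →
      (Wf b η θ uc (σ + t * (1 + Complex.I))).re ≤ C * σ * (σ + 2 * t) ^ 2 - c3 * t ^ 3 := by
  obtain ⟨C, hC, hlip⟩ := h.rho_lip hr
  obtain ⟨C', hC', him⟩ := h.rho_im hr
  have hpi := Real.pi_pos
  refine ⟨C, 2 * (C' * (2 / Real.pi)) / 12, hC, by positivity, ?_⟩
  intro σ t hσ hσδ ht htpi
  set w : ℂ := σ + t * (1 + Complex.I) with hw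
  have hre : w.re = σ + t := by simp [hw]
  have hi : w.im = t := by simp [hw]
  have hwK : w ∈ KR δ := by
    simp only [KR, Set.mem_ofPred_eq, hre, hi]
    exact ⟨ht, htpi, by positivity, by linarith⟩
  have hn : ‖w‖ ≤ σ + 2 * t := by
    have := Complex.norm_le_abs_re_add_abs_im w
    rw [hre, hi, abs_of_nonneg ht, abs_of_nonneg (by positivity)] at this
    linarith
  have hcont := (show ContinuousOn (fun r : ℝ => ((1 - r : ℝ) : ℂ)) (Set.Icc 0 1) by fun_prop).mul
    (hr.rho_cont h.hb η θ hwK)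
  set J := ∫ r in (0:ℝ)..1, ((1 - r : ℝ) : ℂ) * rho b η θ (uc + r * w) with hJ
  have hJn : ‖J‖ ≤ C * (σ + 2 * t) := by
    have : ‖J‖ ≤ C * (σ + 2 * t) * |1 - 0| := by
      refine intervalIntegral.norm_integral_le_of_norm_le_const fun r hr' => ?_
      rw [Set.uIoc_of_le zero_le_one] at hr'
      have hw' := KR_smul hr.hδ.le hwK hr'.1.le hr'.2
      rw [norm_mul, Complex.norm_real, Real.norm_of_nonneg (by linarith [hr'.2])]
      have h1 := hlip _ hw'
      rw [norm_mul, Complex.norm_real, Real.norm_of_nonneg hr'.1.le] at h1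
      have h2 : r * ‖w‖ ≤ 1 * (σ + 2 * t) := by gcongr; exact hr'.2
      calc _ ≤ 1 * (C * (1 * (σ + 2 * t))) := by
            gcongr
            · linarith [hr'.1]
            · exact h1.trans (by gcongr)
        _ = _ := by ring
    simpa using this
  have hJi : C' * (2 / Real.pi) * t / 12 ≤ J.im := by
    have e1 : J.im = ∫ r in (0:ℝ)..1, (1 - r) * (rho b η θ (uc + r * w)).im := by
      have := Complex.imCLM.intervalIntegral_comp_comm (μ := volume) (a := 0) (b := 1)
        (f := fun r : ℝ => ((1 - r : ℝ) : ℂ) * rho b η θ (uc + r * w)) ?_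
      · rw [hJ]
        simp only [Complex.imCLM_apply, Complex.im_ofReal_mul] at this
        exact this.symm
      · apply ContinuousOn.intervalIntegrable
        rwa [Set.uIcc_of_le zero_le_one]
    have e2 : C' * (2 / Real.pi) * t / 12 = ∫ r in (0:ℝ)..1, C' * (2 / Real.pi) * t * (r - 2 * r ^ 2 + r ^ 3) := by
      rw [intervalIntegral.integral_const_mul, intervalIntegral.integral_add, intervalIntegral.integral_sub,
        intervalIntegral.integral_const_mul, integral_pow, integral_pow, integral_id]
      · norm_num
        ring
      all_goals apply Continuous.intervalIntegrable; fun_prop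
    rw [e1, e2]
    refine intervalIntegral.integral_mono_on zero_le_one (Continuous.intervalIntegrable (by fun_prop) _ _) ?_ ?_
    · apply ContinuousOn.intervalIntegrable
      rw [Set.uIcc_of_le zero_le_one]
      exact (show ContinuousOn (fun r : ℝ => 1 - r) (Set.Icc 0 1) by fun_prop).mul
        (Complex.continuous_im.comp_continuousOn (hr.rho_cont h.hb η θ hwK))
    · intro r hr'
      have hw' := KR_smul hr.hδ.le hwK hr'.1 hr'.2
      have h1 := him _ hw'
      rw [Complex.im_ofReal_mul, hi] at h1
      have h2 := sin_lower ht htpi hr'.1 hr'.2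
      have h3 : 0 ≤ 1 - r := by linarith [hr'.2]
      calc _ = (1 - r) * (C' * (2 / Real.pi * (t * (r * (1 - r))))) := by ring
        _ ≤ (1 - r) * (C' * Real.sin (r * t)) := by gcongr
        _ ≤ _ := by gcongr
  have hsq : w ^ 2 = ((σ * (σ + 2 * t) : ℝ) : ℂ) + ((2 * t * (σ + t) : ℝ) : ℂ) * Complex.I := by
    rw [hw]
    push_cast
    ring_nf
    rw [Complex.I_sq]
    ring
  have hWre : (Wf b η θ uc w).re = σ * (σ + 2 * t) * J.re - 2 * t * (σ + t) * J.im := by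
    rw [Wf, ← hJ, hsq, add_mul, Complex.add_re, Complex.re_ofReal_mul, mul_assoc (((2 * t * (σ + t) : ℝ) : ℂ)),
      Complex.re_ofReal_mul]
    simp
    ring
  rw [hWre]
  have hJr : J.re ≤ C * (σ + 2 * t) := (Complex.re_le_norm J).trans hJn
  have k1 : σ * (σ + 2 * t) * J.re ≤ σ * (σ + 2 * t) * (C * (σ + 2 * t)) := by gcongr
  have k0 : 0 ≤ C' * (2 / Real.pi) * t / 12 := by positivity
  have k2 : 2 * t * t * (C' * (2 / Real.pi) * t / 12) ≤ 2 * t * (σ + t) * J.im := by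
    gcongr
    linarith
  nlinarith

theorem SP.W_lim {b η θ uc v c : ℝ} (h : SP b η θ uc v c) (ζ : ℂ) :
    Tendsto (fun σ : ℝ => ((c ^ 3 * σ ^ 3 : ℝ) : ℂ)⁻¹ * Wf b η θ uc (σ * ζ)) (𝓝[>] 0) (𝓝 (ζ ^ 3 / 3)) := by
  have hη := h.hη
  have hb := h.hb
  have hc := h.hc
  have hc' : (c : ℂ) ≠ 0 := by exact_mod_cast hc.ne'
  have hd : HasDerivAt (rho b η θ) ((2 * c ^ 3 : ℝ) : ℂ) (uc : ℂ) := by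
    rw [← h.rho'_uc]
    refine rho_deriv b η θ ?_ ?_
    · have := h.hB
      have h1 : 1 - b * Real.exp uc ≠ 0 := by linarith
      exact_mod_cast h1
    · have := h.hA
      have h1 : 1 - b * Real.exp (-uc) ≠ 0 := by linarith
      exact_mod_cast h1
  have key : Tendsto (fun σ : ℝ => ∫ r in (0:ℝ)..1, ((1 - r : ℝ) : ℂ) * ((σ : ℂ)⁻¹ * rho b η θ (uc + r * (σ * ζ))))
      (𝓝[>] 0) (𝓝 (∫ r in (0:ℝ)..1, ((1 - r : ℝ) : ℂ) * (((2 * c ^ 3 : ℝ) : ℂ) * (r * ζ)))) := by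
    obtain ⟨d, hd0, hdb⟩ : ∃ d > 0, ∀ w : ℂ, ‖w‖ < d → ‖rho b η θ (uc + w)‖ ≤ (2 * c ^ 3 + 1) * ‖w‖ := by
      have := (hasDerivAt_iff_isLittleO.1 hd).def (zero_lt_one)
      rw [Metric.eventually_nhds_iff] at this
      obtain ⟨d, hd0, h1⟩ := this
      refine ⟨d, hd0, fun w hw => ?_⟩
      have h2 := h1 (y := uc + w) (by simpa [dist_eq_norm] using hw)
      rw [h.rho_uc] at h2
      simp only [sub_zero, add_sub_cancel_left, smul_eq_mul, one_mul] at h2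
      have h3 := norm_le_norm_add_norm_sub' (rho b η θ (uc + w)) (w * ((2 * c ^ 3 : ℝ) : ℂ))
      rw [norm_mul, Complex.norm_real, Real.norm_of_nonneg (by positivity)] at h3
      linarith
    refine intervalIntegral.tendsto_integral_filter_of_dominated_convergence
      (fun _ => (2 * c ^ 3 + 1) * ‖ζ‖) ?_ ?_ intervalIntegrable_const ?_
    · refine Eventually.of_forall fun σ => Measurable.aestronglyMeasurable ?_
      unfold rho g1
      fun_prop
    · have : ∀ᶠ σ : ℝ in 𝓝[>] 0, σ * ‖ζ‖ < d := by
        have hcont : ContinuousAt (fun σ : ℝ => σ * ‖ζ‖) 0 := by fun_prop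
        exact (hcont.eventually_lt continuousAt_const (by simpa using hd0)).filter_mono nhdsWithin_le_nhds
      filter_upwards [this, self_mem_nhdsWithin] with σ hσ hσ0
      refine Eventually.of_forall fun r hr' => ?_
      rw [Set.uIoc_of_le zero_le_one] at hr'
      have hσ0 : 0 < σ := hσ0
      have hn : ‖(r : ℂ) * (σ * ζ)‖ = r * (σ * ‖ζ‖) := by
        rw [norm_mul, norm_mul, Complex.norm_real, Complex.norm_real, Real.norm_of_nonneg hr'.1.le,
          Real.norm_of_nonneg hσ0.le]
      have hle : r * (σ * ‖ζ‖) ≤ σ * ‖ζ‖ := mul_le_of_le_one_left (by positivity) hr'.2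
      have := hdb _ (by rw [hn]; linarith)
      rw [hn] at this
      rw [norm_mul, norm_mul, norm_inv, Complex.norm_real, Complex.norm_real, Real.norm_of_nonneg hσ0.le,
        Real.norm_of_nonneg (by linarith [hr'.2])]
      calc _ ≤ 1 * (σ⁻¹ * ((2 * c ^ 3 + 1) * (σ * ‖ζ‖))) := by
            gcongr
            · linarith [hr'.1]
            · exact this.trans (by gcongr)
        _ = _ := by field_simp
    · refine Eventually.of_forall fun r _ => ?_
      refine Tendsto.mul tendsto_const_nhds ?_
      have hd2 : HasDerivAt (rho b η θ) ((2 * c ^ 3 : ℝ) : ℂ) ((fun σ : ℝ => (uc : ℂ) + σ * (r * ζ)) 0) := by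
        simpa using hd
      have hd3 := (hd2.comp (0:ℝ) (seg_deriv (uc : ℂ) (r * ζ) 0)).tendsto_slope_zero_right
      refine hd3.congr' ?_
      refine Eventually.of_forall fun σ => ?_
      simp only [Function.comp, zero_add, Complex.ofReal_zero, zero_mul, add_zero, h.rho_uc, sub_zero,
        Complex.real_smul, Complex.ofReal_inv]
      congr 3
      ring
  have hval : ∫ r in (0:ℝ)..1, ((1 - r : ℝ) : ℂ) * (((2 * c ^ 3 : ℝ) : ℂ) * (r * ζ)) = c ^ 3 * ζ / 3 := by
    have : ∀ r : ℝ, ((1 - r : ℝ) : ℂ) * (((2 * c ^ 3 : ℝ) : ℂ) * (r * ζ)) = ((r - r ^ 2 : ℝ) : ℂ) * (2 * c ^ 3 * ζ) := by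
      intro r; push_cast; ring
    simp_rw [this]
    rw [intervalIntegral.integral_mul_const, intervalIntegral.integral_ofReal, intervalIntegral.integral_sub,
      integral_pow, integral_id]
    · push_cast; ring
    all_goals apply Continuous.intervalIntegrable; fun_prop
  rw [hval] at key
  have k2 := key.const_mul (ζ ^ 2 / c ^ 3)
  have e : ζ ^ 2 / (c : ℂ) ^ 3 * (c ^ 3 * ζ / 3) = ζ ^ 3 / 3 := by field_simp
  rw [e] at k2
  refine k2.congr' ?_
  filter_upwards [self_mem_nhdsWithin] with σ hσ
  have hσ : (σ : ℂ) ≠ 0 := by exact_mod_cast (show (0:ℝ) < σ from hσ).ne'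
  have e3 : ∫ r in (0:ℝ)..1, ((1 - r : ℝ) : ℂ) * ((σ : ℂ)⁻¹ * rho b η θ (uc + r * (σ * ζ))) =
      (σ : ℂ)⁻¹ * ∫ r in (0:ℝ)..1, ((1 - r : ℝ) : ℂ) * rho b η θ (uc + r * (σ * ζ)) := by
    rw [← intervalIntegral.integral_const_mul]
    refine intervalIntegral.integral_congr fun r _ => ?_
    ring
  rw [e3, Wf]
  generalize ∫ r in (0:ℝ)..1, ((1 - r : ℝ) : ℂ) * rho b η θ (uc + r * (σ * ζ)) = J
  push_cast
  field_simp

def Rr {M : ℕ} (x y : Fin M → ℝ) (u : ℝ) : ℝ :=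
  (∏ j, (1 - y j * Real.exp (-u))) * ∏ i, (1 - x i * Real.exp u)⁻¹

lemma Rf_ofReal {M : ℕ} (x y : Fin M → ℝ) (u : ℝ) : Rf x y u = (Rr x y u : ℂ) := by
  unfold Rf Rr
  push_cast
  rfl

lemma Rr_swap {M : ℕ} (x y : Fin M → ℝ) (u : ℝ) : Rr y x (-u) = (Rr x y u)⁻¹ := by
  unfold Rr
  rw [neg_neg, Finset.prod_inv_distrib, Finset.prod_inv_distrib, mul_inv, inv_inv, mul_comm]

/-- normalised coefficients -/
def Ah (b η θ uc ε : ℝ) (M j : ℕ) : ℝ :=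
  av (xs b (η * ε) M) (xs b (θ * ε) M) (j + M) * Real.exp (((j : ℝ) + 1) * uc) /
    Rr (xs b (η * ε) M) (xs b (θ * ε) M) uc

def good (η θ ε : ℝ) (M : ℕ) : Prop := 0 < ε ∧ η * ε ≤ 1 ∧ θ * ε ≤ 1 ∧ Real.exp (-(η * ε * M)) ≤ η * ε ∧
  Real.exp (-(θ * ε * M)) ≤ θ * ε

def zt (τ : ℝ) : ℂ := 1 + τ * (1 + Complex.I)

lemma zt_re (τ : ℝ) : (zt τ).re = 1 + τ := by simp [zt]
lemma zt_im (τ : ℝ) : (zt τ).im = τ := by simp [zt]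

def fA (b η θ uc ε : ℝ) (M j : ℕ) (σ τ : ℝ) : ℂ :=
  Set.indicator (Set.Iic (Real.pi / σ)) (fun τ =>
    Rf (xs b (η * ε) M) (xs b (θ * ε) M) (uc + σ * zt τ) * Complex.exp (-((j + 1 : ℝ) : ℂ) * (uc + σ * zt τ)) /
    (Rf (xs b (η * ε) M) (xs b (θ * ε) M) uc * Complex.exp (-((j + 1 : ℝ) : ℂ) * uc)) * (1 + Complex.I)) τ

lemma fA_meas (b η θ uc ε : ℝ) (M j : ℕ) (σ : ℝ) : Measurable (fA b η θ uc ε M j σ) := by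
  unfold fA
  refine Measurable.indicator ?_ measurableSet_Iic
  unfold Rf zt
  fun_prop

lemma Rr_pos {b η θ uc v c ε : ℝ} (h : SP b η θ uc v c) (hε : 0 < ε) (M : ℕ) :
    0 < Rr (xs b (η * ε) M) (xs b (θ * ε) M) uc := by
  unfold Rr
  have h1 : ∀ i, 0 < 1 - xs b (η * ε) M i * Real.exp uc := by
    intro i
    have := (xs_bd h.hb (mul_pos h.hη hε) M i).2
    have h2 : xs b (η * ε) M i * Real.exp uc ≤ b * Real.exp uc := by gcongr
    linarith [h.hB]
  have h2 : ∀ i, 0 < 1 - xs b (θ * ε) M i * Real.exp (-uc) := by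
    intro i
    have := (xs_bd h.hb (mul_pos h.hθ hε) M i).2
    have h2 : xs b (θ * ε) M i * Real.exp (-uc) ≤ b * Real.exp (-uc) := by gcongr
    linarith [h.hA]
  exact mul_pos (Finset.prod_pos fun i _ => h2 i) (Finset.prod_pos fun i _ => inv_pos.2 (h1 i))

lemma Ah_eq {b η θ uc v c δ c0 ε σ : ℝ} (h : SP b η θ uc v c) (hr : Reg b uc δ c0) (hε : 0 < ε)
    (hσ : 0 < σ) (hσδ : σ ≤ δ) (M j : ℕ) :
    Ah b η θ uc ε M j / σ = Real.pi⁻¹ * (∫ τ in Set.Ioi 0, fA b η θ uc ε M j σ τ).im := by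
  have hpi := Real.pi_pos
  set x := xs b (η * ε) M with hx
  set y := xs b (θ * ε) M with hy
  have hR := Rr_pos h hε M
  rw [← hx, ← hy] at hR
  have hc := av_contour x y (xs_inj h.hb (mul_pos h.hη hε) M) (fun i => (xs_bd h.hb (mul_pos h.hη hε) M i).1)
    (uc + σ) (fun i => by
      have h1 := (xs_bd h.hb (mul_pos h.hη hε) M i).2
      refine lt_of_le_of_lt ?_ hr.hp
      rw [hx]
      have := h.hb
      gcongr) (j + M) ((j : ℝ) + 1) (by push_cast; ring)
  have hind : ∫ τ in Set.Ioi 0, fA b η θ uc ε M j σ τ = ∫ τ in (0:ℝ)..(Real.pi / σ),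
      Rf x y (uc + σ * zt τ) * Complex.exp (-((j + 1 : ℝ) : ℂ) * (uc + σ * zt τ)) /
      (Rf x y uc * Complex.exp (-((j + 1 : ℝ) : ℂ) * uc)) * (1 + Complex.I) := by
    unfold fA
    rw [setIntegral_indicator measurableSet_Iic, Set.Ioi_inter_Iic,
      intervalIntegral.integral_of_le (by positivity)]
  have hcv := intervalIntegral.smul_integral_comp_mul_left (a := 0) (b := Real.pi / σ)
    (fun t => Rf x y (pathu (uc + σ) t) * Complex.exp (-((j + 1 : ℝ) : ℂ) * pathu (uc + σ) t) * (1 + Complex.I)) σ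
  rw [mul_zero, mul_div_cancel₀ _ hσ.ne'] at hcv
  rw [← hcv] at hc
  have hp : ∀ τ : ℝ, pathu (uc + σ) (σ * τ) = uc + σ * zt τ := by
    intro τ; unfold pathu zt; push_cast; ring
  simp_rw [hp] at hc
  have hden : Rf x y uc * Complex.exp (-((j + 1 : ℝ) : ℂ) * uc) =
      ((Rr x y uc * Real.exp (-(j + 1) * uc) : ℝ) : ℂ) := by
    rw [Rf_ofReal]; push_cast; ring
  have e2 : ∫ τ in (0:ℝ)..(Real.pi / σ), Rf x y (uc + σ * zt τ) * Complex.exp (-((j + 1 : ℝ) : ℂ) * (uc + σ * zt τ)) /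
      (Rf x y uc * Complex.exp (-((j + 1 : ℝ) : ℂ) * uc)) * (1 + Complex.I) =
      (((Rr x y uc * Real.exp (-(j + 1) * uc))⁻¹ : ℝ) : ℂ) * ∫ τ in (0:ℝ)..(Real.pi / σ), Rf x y (uc + σ * zt τ) *
        Complex.exp (-((j + 1 : ℝ) : ℂ) * (uc + σ * zt τ)) * (1 + Complex.I) := by
    rw [← intervalIntegral.integral_const_mul, hden]
    refine intervalIntegral.integral_congr fun τ _ => ?_
    simp only [Complex.ofReal_inv]
    rw [div_eq_mul_inv]
    ring
  rw [hind, e2, Complex.im_ofReal_mul]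
  rw [Complex.real_smul, Complex.im_ofReal_mul] at hc
  set I0 := (∫ τ in (0:ℝ)..(Real.pi / σ), Rf x y (uc + σ * zt τ) *
        Complex.exp (-((j + 1 : ℝ) : ℂ) * (uc + σ * zt τ)) * (1 + Complex.I)).im with hI0
  unfold Ah
  rw [← hx, ← hy]
  have e3 : av x y (j + M) = Real.pi⁻¹ * (σ * I0) := by
    rw [← hc]; field_simp
  rw [e3]
  have e4 : Real.exp (((j : ℝ) + 1) * uc) = (Real.exp (-((j : ℝ) + 1) * uc))⁻¹ := by
    rw [← Real.exp_neg]; congr 1; ring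
  rw [e4]
  field_simp

lemma cubic_bound (A B E d : ℝ) (hB : 0 ≤ B) (hE : 0 ≤ E) (hd : 0 < d) :
    ∃ K, ∀ τ : ℝ, 0 ≤ τ → A + B * τ + E * τ ^ 2 - d * τ ^ 3 ≤ K - τ := by
  set T := 1 + (B + 1 + E) / d with hT
  have hT1 : 1 ≤ T := by rw [hT]; have : 0 ≤ (B + 1 + E) / d := by positivity
                         linarith
  have hTd : B + 1 + E ≤ d * T := by
    rw [hT, mul_add, mul_div_cancel₀ _ hd.ne']; linarith
  refine ⟨A + (B + 1) * T + E * T ^ 2, fun τ hτ => ?_⟩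
  rcases le_total τ T with h | h
  · have h1 : (B + 1) * τ ≤ (B + 1) * T := by gcongr
    have h2 : E * τ ^ 2 ≤ E * T ^ 2 := by gcongr
    have h3 : 0 ≤ d * τ ^ 3 := by positivity
    linarith
  · have h1 : (B + 1) * τ ≤ (B + 1) * τ ^ 2 := by
      have : τ ≤ τ ^ 2 := by nlinarith
      gcongr
    have h2 : (B + 1 + E) * τ ^ 2 ≤ d * τ * τ ^ 2 := by
      gcongr
      exact hTd.trans (by gcongr)
    have h3 : 0 ≤ (B + 1) * T + E * T ^ 2 := by positivity
    nlinarith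

theorem SP.core {b η θ uc v c : ℝ} (h : SP b η θ uc v c) (X0 : ℝ) (hX0 : 0 ≤ X0) :
    ∃ K C δ, 0 < C ∧ 0 < δ ∧ ∀ σ : ℝ, 0 < σ → σ ≤ δ → ∀ M j : ℕ, good η θ (c ^ 3 * σ ^ 3) M →
      Ah b η θ uc (c ^ 3 * σ ^ 3) M j / σ = Real.pi⁻¹ * (∫ τ in Set.Ioi 0, fA b η θ uc (c ^ 3 * σ ^ 3) M j σ τ).im ∧
      (-X0 ≤ σ * ((j : ℝ) + 1 - v / (c ^ 3 * σ ^ 3)) → ∀ τ, 0 ≤ τ → ‖fA b η θ uc (c ^ 3 * σ ^ 3) M j σ τ‖ ≤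
        Real.exp (-(σ * ((j : ℝ) + 1 - v / (c ^ 3 * σ ^ 3)))) * Real.exp (K - τ)) ∧
      (∀ τ, 0 ≤ τ → τ ≤ Real.pi / σ → ∃ e : ℂ, ‖e‖ ≤ C * ‖σ * zt τ‖ ∧
        fA b η θ uc (c ^ 3 * σ ^ 3) M j σ τ = Complex.exp (-((σ * ((j : ℝ) + 1 - v / (c ^ 3 * σ ^ 3)) : ℝ) : ℂ) * zt τ +
          ((c ^ 3 * σ ^ 3 : ℝ) : ℂ)⁻¹ * Wf b η θ uc (σ * zt τ) + e) * (1 + Complex.I)) := by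
  obtain ⟨δ, c0, hr⟩ := h.reg
  obtain ⟨C, hC, hap⟩ := h.approx hr
  obtain ⟨C2, c3, hC2, hc3, hW⟩ := h.W_re hr
  have hc := h.hc
  set a := (c ^ 3)⁻¹ * C2 with ha
  have ha0 : 0 < a := by positivity
  obtain ⟨K, hK⟩ := cubic_bound (a + C * 9) (X0 + 4 * a) (4 * a) ((c ^ 3)⁻¹ * c3) (by positivity) (by positivity) (by positivity)
  have form : ∀ σ : ℝ, 0 < σ → σ ≤ δ → ∀ M j : ℕ, good η θ (c ^ 3 * σ ^ 3) M →
      (∀ τ, 0 ≤ τ → τ ≤ Real.pi / σ → (σ * zt τ) ∈ KR δ ∧ ∃ e : ℂ, ‖e‖ ≤ C * ‖σ * zt τ‖ ∧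
        fA b η θ uc (c ^ 3 * σ ^ 3) M j σ τ = Complex.exp (-((σ * ((j : ℝ) + 1 - v / (c ^ 3 * σ ^ 3)) : ℝ) : ℂ) * zt τ +
          ((c ^ 3 * σ ^ 3 : ℝ) : ℂ)⁻¹ * Wf b η θ uc (σ * zt τ) + e) * (1 + Complex.I)) := by
    intro σ hσ hσδ M j hg τ hτ hτ2
    have hst : σ * τ ≤ Real.pi := by rw [le_div_iff₀ hσ] at hτ2; linarith
    have hK' : (σ * zt τ) ∈ KR δ := by
      simp only [KR, Set.mem_ofPred_eq, Complex.im_ofReal_mul, Complex.re_ofReal_mul, zt_re, zt_im]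
      exact ⟨by positivity, hst, by positivity, by linarith⟩
    refine ⟨hK', ?_⟩
    obtain ⟨hε, g1, g2, g3, g4⟩ := hg
    obtain ⟨e, he, hR⟩ := hap _ hε g1 g2 M g3 g4 _ hK' ((j : ℝ) + 1)
    refine ⟨e, he, ?_⟩
    have hR0 := (Rr_pos h hε M).ne'
    have hden : Rf (xs b (η * (c ^ 3 * σ ^ 3)) M) (xs b (θ * (c ^ 3 * σ ^ 3)) M) uc *
        Complex.exp (-((j + 1 : ℝ) : ℂ) * uc) ≠ 0 := by
      refine mul_ne_zero ?_ (Complex.exp_ne_zero _)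
      rw [Rf_ofReal]
      exact_mod_cast hR0
    rw [fA, Set.indicator_of_mem (show τ ∈ Set.Iic (Real.pi / σ) from hτ2), hR, mul_div_cancel_left₀ _ hden]
    congr 3
    push_cast
    ring
  refine ⟨K + 1, C, δ, hC, hr.hδ, ?_⟩
  intro σ hσ hσδ M j hg
  refine ⟨Ah_eq h hr hg.1 hσ hσδ M j, ?_, fun τ h1 h2 => (form σ hσ hσδ M j hg τ h1 h2).2⟩
  intro hx τ hτ
  rcases le_or_gt τ (Real.pi / σ) with hτ2 | hτ2
  · obtain ⟨hKR, e, he, hf⟩ := form σ hσ hσδ M j hg τ hτ hτ2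
    set X := σ * ((j : ℝ) + 1 - v / (c ^ 3 * σ ^ 3)) with hX
    have hst : σ * τ ≤ Real.pi := by rw [le_div_iff₀ hσ] at hτ2; linarith
    rw [hf, norm_mul, Complex.norm_exp, ← Real.exp_add]
    have h2 : ‖(1 + Complex.I : ℂ)‖ ≤ Real.exp 1 := by
      refine (norm_add_le _ _).trans ?_
      rw [norm_one, Complex.norm_I]
      linarith [Real.add_one_le_exp 1]
    have hw := hW σ (σ * τ) hσ hσδ (by positivity) hst
    have hwe : (σ : ℂ) + ((σ * τ : ℝ) : ℂ) * (1 + Complex.I) = σ * zt τ := by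
      unfold zt; push_cast; ring
    rw [hwe] at hw
    have he2 : e.re ≤ C * 9 := (Complex.re_le_norm e).trans (he.trans (by gcongr; exact KR_norm hr.hδ1 hKR))
    have hre : (-((X : ℝ) : ℂ) * zt τ + ((c ^ 3 * σ ^ 3 : ℝ) : ℂ)⁻¹ * Wf b η θ uc (σ * zt τ) + e).re ≤
        -X + K - τ := by
      rw [Complex.add_re, Complex.add_re, ← Complex.ofReal_neg, ← Complex.ofReal_inv, Complex.re_ofReal_mul,
        Complex.re_ofReal_mul, zt_re]
      have h5 : (c ^ 3 * σ ^ 3)⁻¹ * (Wf b η θ uc (σ * zt τ)).re ≤ a * (1 + 2 * τ) ^ 2 - (c ^ 3)⁻¹ * c3 * τ ^ 3 := by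
        calc _ ≤ (c ^ 3 * σ ^ 3)⁻¹ * (C2 * σ * (σ + 2 * (σ * τ)) ^ 2 - c3 * (σ * τ) ^ 3) := by gcongr
          _ = _ := by rw [ha]; field_simp
      have h6 := hK τ hτ
      have h7 : -X * τ ≤ X0 * τ := by
        have : -X ≤ X0 := by linarith
        gcongr
      nlinarith
    calc _ ≤ Real.exp (-X + K - τ) * Real.exp 1 := by gcongr
      _ = _ := by rw [← Real.exp_add]; congr 1; ring
  · rw [fA, Set.indicator_of_notMem (by simpa using hτ2), norm_zero]
    positivity

def Ai (x : ℝ) : ℝ := Real.pi⁻¹ * (∫ τ in Set.Ioi (0:ℝ), Complex.exp (-(x : ℂ) * zt τ + zt τ ^ 3 / 3) * (1 + Complex.I)).im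

lemma int_exp_sub (K : ℝ) : IntegrableOn (fun τ : ℝ => Real.exp (K - τ)) (Set.Ioi 0) := by
  have : (fun τ : ℝ => Real.exp (K - τ)) = fun τ => Real.exp K * Real.exp (-τ) := by
    funext τ; rw [← Real.exp_add]; congr 1
  rw [this]
  exact (integrableOn_exp_neg_Ioi 0).const_mul _

theorem SP.Ah_bound {b η θ uc v c : ℝ} (h : SP b η θ uc v c) (X0 : ℝ) (hX0 : 0 ≤ X0) :
    ∃ C δ, 0 < C ∧ 0 < δ ∧ ∀ σ : ℝ, 0 < σ → σ ≤ δ → ∀ M j : ℕ, good η θ (c ^ 3 * σ ^ 3) M →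
      -X0 ≤ σ * ((j : ℝ) + 1 - v / (c ^ 3 * σ ^ 3)) →
      |Ah b η θ uc (c ^ 3 * σ ^ 3) M j / σ| ≤ C * Real.exp (-(σ * ((j : ℝ) + 1 - v / (c ^ 3 * σ ^ 3)))) := by
  obtain ⟨K, C, δ, hC, hδ, hcore⟩ := h.core X0 hX0
  refine ⟨Real.pi⁻¹ * Real.exp K, δ, by positivity, hδ, ?_⟩
  intro σ hσ hσδ M j hg hx
  obtain ⟨h1, h2, -⟩ := hcore σ hσ hσδ M j hg
  have h3 := h2 hx
  rw [h1, abs_mul, abs_of_pos (inv_pos.2 Real.pi_pos), mul_assoc]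
  gcongr
  refine (Complex.abs_im_le_norm _).trans ?_
  set X := σ * ((j : ℝ) + 1 - v / (c ^ 3 * σ ^ 3)) with hX
  calc _ ≤ ∫ τ in Set.Ioi (0:ℝ), Real.exp (-X) * Real.exp (K - τ) := by
        refine norm_integral_le_of_norm_le ((int_exp_sub K).const_mul _) ?_
        refine (ae_restrict_iff' measurableSet_Ioi).2 (Eventually.of_forall fun τ hτ => h3 τ (le_of_lt hτ))
    _ = _ := by
        rw [integral_const_mul]
        have : (fun τ : ℝ => Real.exp (K - τ)) = fun τ => Real.exp K * Real.exp (-τ) := by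
          funext τ; rw [← Real.exp_add]; congr 1
        rw [this, integral_const_mul, integral_exp_neg_Ioi_zero]
        ring

theorem SP.Ah_lim {b η θ uc v c : ℝ} (h : SP b η θ uc v c) (x : ℝ) (M j : ℝ → ℕ)
    (hM : ∀ᶠ σ in 𝓝[>] (0:ℝ), good η θ (c ^ 3 * σ ^ 3) (M σ))
    (hj : Tendsto (fun σ => σ * ((j σ : ℝ) + 1 - v / (c ^ 3 * σ ^ 3))) (𝓝[>] 0) (𝓝 x)) :
    Tendsto (fun σ => Ah b η θ uc (c ^ 3 * σ ^ 3) (M σ) (j σ) / σ) (𝓝[>] 0) (𝓝 (Ai x)) := by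
  obtain ⟨K, C, δ, hC, hδ, hcore⟩ := h.core (|x| + 1) (by positivity)
  have hσev : ∀ᶠ σ in 𝓝[>] (0:ℝ), σ ∈ Set.Ioc 0 δ := Ioc_mem_nhdsGT hδ
  have hxev : ∀ᶠ σ in 𝓝[>] (0:ℝ), -(|x| + 1) ≤ σ * ((j σ : ℝ) + 1 - v / (c ^ 3 * σ ^ 3)) := by
    refine hj.eventually_const_le ?_
    linarith [neg_abs_le x]
  have hlim : Tendsto (fun σ => ∫ τ in Set.Ioi (0:ℝ), fA b η θ uc (c ^ 3 * σ ^ 3) (M σ) (j σ) σ τ) (𝓝[>] 0)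
      (𝓝 (∫ τ in Set.Ioi (0:ℝ), Complex.exp (-(x : ℂ) * zt τ + zt τ ^ 3 / 3) * (1 + Complex.I))) := by
    refine tendsto_integral_filter_of_dominated_convergence
      (fun τ => Real.exp (|x| + 1) * Real.exp (K - τ)) ?_ ?_ ((int_exp_sub K).const_mul _) ?_
    · exact Eventually.of_forall fun σ => (fA_meas _ _ _ _ _ _ _ _).aestronglyMeasurable
    · filter_upwards [hM, hσev, hxev] with σ h1 h2 h3
      refine (ae_restrict_iff' measurableSet_Ioi).2 (Eventually.of_forall fun τ hτ => ?_)
      refine ((hcore σ h2.1 h2.2 _ _ h1).2.1 h3 τ (le_of_lt hτ)).trans ?_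
      gcongr
      linarith
    · refine (ae_restrict_iff' measurableSet_Ioi).2 (Eventually.of_forall fun τ hτ => ?_)
      have hτ0 : 0 < τ := hτ
      have hpev : ∀ᶠ σ in 𝓝[>] (0:ℝ), τ ≤ Real.pi / σ := by
        have : ∀ᶠ σ in 𝓝[>] (0:ℝ), σ ∈ Set.Ioc 0 (Real.pi / τ) := Ioc_mem_nhdsGT (by positivity)
        filter_upwards [this] with σ hσ
        rw [le_div_iff₀ hσ.1]
        have := hσ.2
        rw [le_div_iff₀ hτ0] at this
        linarith
      have hall := hM.and (hσev.and hpev)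
      set E : ℝ → ℂ := fun σ => fA b η θ uc (c ^ 3 * σ ^ 3) (M σ) (j σ) σ τ with hE
      have hex : ∀ σ : ℝ, ∃ e : ℂ, (good η θ (c ^ 3 * σ ^ 3) (M σ) ∧ σ ∈ Set.Ioc 0 δ ∧ τ ≤ Real.pi / σ) →
          ‖e‖ ≤ C * ‖σ * zt τ‖ ∧ E σ = Complex.exp (-((σ * ((j σ : ℝ) + 1 - v / (c ^ 3 * σ ^ 3)) : ℝ) : ℂ) * zt τ +
          ((c ^ 3 * σ ^ 3 : ℝ) : ℂ)⁻¹ * Wf b η θ uc (σ * zt τ) + e) * (1 + Complex.I) := by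
        intro σ
        by_cases hσ : (good η θ (c ^ 3 * σ ^ 3) (M σ) ∧ σ ∈ Set.Ioc 0 δ ∧ τ ≤ Real.pi / σ)
        · obtain ⟨e, he⟩ := (hcore σ hσ.2.1.1 hσ.2.1.2 (M σ) (j σ) hσ.1).2.2 τ hτ0.le hσ.2.2
          exact ⟨e, fun _ => he⟩
        · exact ⟨0, fun h => absurd h hσ⟩
      choose e he using hex
      have he0 : Tendsto e (𝓝[>] 0) (𝓝 0) := by
        refine squeeze_zero_norm' (a := fun σ : ℝ => C * ‖(σ : ℂ) * zt τ‖) ?_ ?_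
        · filter_upwards [hall] with σ hσ
          exact (he σ hσ).1
        · have hcont : Continuous (fun σ : ℝ => C * ‖(σ : ℂ) * zt τ‖) := by fun_prop
          have := (hcont.tendsto 0).mono_left (nhdsWithin_le_nhds (s := Set.Ioi 0))
          simpa using this
      have hmain : Tendsto (fun σ : ℝ => Complex.exp (-((σ * ((j σ : ℝ) + 1 - v / (c ^ 3 * σ ^ 3)) : ℝ) : ℂ) * zt τ +
          ((c ^ 3 * σ ^ 3 : ℝ) : ℂ)⁻¹ * Wf b η θ uc (σ * zt τ) + e σ) * (1 + Complex.I)) (𝓝[>] 0)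
          (𝓝 (Complex.exp (-(x : ℂ) * zt τ + zt τ ^ 3 / 3 + 0) * (1 + Complex.I))) := by
        refine Tendsto.mul_const _ ((Complex.continuous_exp.tendsto _).comp ?_)
        refine Tendsto.add (Tendsto.add ?_ (h.W_lim _)) he0
        exact (((Complex.continuous_ofReal.tendsto x).comp hj).neg).mul_const _
      rw [add_zero] at hmain
      refine hmain.congr' ?_
      filter_upwards [hall] with σ hσ
      exact (he σ hσ).2.symm
  have hfin := ((Complex.continuous_im.tendsto _).comp hlim).const_mul Real.pi⁻¹
  refine hfin.congr' ?_
  filter_upwards [hM, hσev] with σ h1 h2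
  exact (hcore σ h2.1 h2.2 _ _ h1).1.symm

def Fa (x : ℝ) (z : ℂ) : ℂ := Complex.exp (z ^ 3 / 3 - x * z)

lemma Fa_norm (x : ℝ) (z : ℂ) : ‖Fa x z‖ = Real.exp (z.re * (z.re ^ 2 / 3 - z.im ^ 2) - x * z.re) := by
  rw [Fa, Complex.norm_exp]
  congr 1
  have : (z ^ 3 / 3 - x * z) = ((z.re * (z.re ^ 2 / 3 - z.im ^ 2) - x * z.re : ℝ) : ℂ)
      + ((z.re ^ 2 * z.im - z.im ^ 3 / 3 - x * z.im : ℝ) : ℂ) * Complex.I := by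
    conv_lhs => rw [← Complex.re_add_im z]
    push_cast
    generalize (z.re : ℂ) = p
    generalize (z.im : ℂ) = r
    have h2 : Complex.I ^ 2 = -1 := Complex.I_sq
    have h3 : Complex.I ^ 3 = -Complex.I := by rw [pow_succ, h2]; ring
    ring_nf
    rw [h2, h3]; ring
  rw [this]; simp only [Complex.add_re, Complex.ofReal_re, Complex.re_ofReal_mul, Complex.I_re, mul_zero, add_zero]

lemma Fa_vert_norm (x t : ℝ) : ‖Fa x (1 + t * Complex.I)‖ = Real.exp (1/3 - x) * Real.exp (-1 * t ^ 2) := by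
  rw [Fa_norm, ← Real.exp_add]
  congr 1; simp; ring

lemma Fa_cont2 : Continuous fun p : ℝ × ℝ => Fa p.1 (1 + p.2 * Complex.I) := by
  unfold Fa; fun_prop

lemma Fa_int (x : ℝ) : Integrable fun t : ℝ => Fa x (1 + t * Complex.I) := by
  refine Integrable.mono' ((integrable_exp_neg_mul_sq (b := 1) one_pos).const_mul (Real.exp (1/3 - x))) ?_ ?_
  · exact (Continuous.aestronglyMeasurable (by unfold Fa; fun_prop))
  · exact Eventually.of_forall fun t => (Fa_vert_norm x t).le

lemma Fa_conj (x t : ℝ) : Fa x (1 + ((-t : ℝ) : ℂ) * Complex.I) = (starRingEnd ℂ) (Fa x (1 + t * Complex.I)) := by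
  unfold Fa
  rw [← Complex.exp_conj]
  congr 1
  have h3 : (starRingEnd ℂ) 3 = 3 := Complex.conj_ofNat 3
  simp [h3]

lemma Fa_int_zt (x : ℝ) : IntegrableOn (fun τ : ℝ => Fa x (zt τ) * (1 + Complex.I)) (Ioi 0) := by
  obtain ⟨K, hK⟩ := cubic_bound (1/3 - x) (1 + |x|) 0 (2/3) (by positivity) le_rfl (by norm_num)
  refine Integrable.mono' ((int_exp_sub K).mul_const ‖1 + Complex.I‖) ?_ ?_
  · refine (Continuous.aestronglyMeasurable (by unfold Fa zt; fun_prop))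
  · refine (ae_restrict_iff' measurableSet_Ioi).2 (Eventually.of_forall fun τ hτ => ?_)
    have hτ0 : 0 < τ := hτ
    rw [norm_mul]
    gcongr
    rw [Fa_norm]
    apply Real.exp_le_exp.2
    refine le_trans ?_ (hK τ hτ0.le)
    rw [zt_re, zt_im]
    nlinarith [mul_le_mul_of_nonneg_right (neg_abs_le x) hτ0.le]

theorem Ai_eq (x : ℝ) : ((2 * Real.pi * Ai x : ℝ) : ℂ) = ∫ t : ℝ, Fa x (1 + t * Complex.I) := by
  have hd : Differentiable ℂ (Fa x) := by unfold Fa; fun_prop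
  obtain ⟨G, hG⟩ := hd.isExactOn_univ
  have hcont : Continuous (Fa x) := hd.continuous
  have path : ∀ (p d : ℂ) (T : ℝ), ∫ τ in (0:ℝ)..T, Fa x (p + τ * d) * d = G (p + T * d) - G p := by
    intro p d T
    have := intervalIntegral.integral_eq_sub_of_hasDerivAt (a := 0) (b := T)
      (f := fun τ : ℝ => G (p + τ * d)) (f' := fun τ : ℝ => Fa x (p + τ * d) * d) (fun τ _ => by
        have h1 := hG (p + τ * d) (mem_univ _)
        have h2 : HasDerivAt (fun τ : ℝ => p + (τ : ℂ) * d) d τ := by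
          have := ((Complex.ofRealCLM.hasDerivAt (x := τ)).mul_const d).const_add p
          exact this.congr_deriv (by simp)
        exact h1.comp τ h2) (by apply Continuous.intervalIntegrable; fun_prop)
    simpa using this
  have h1 := intervalIntegral_tendsto_integral_Ioi 0 (Fa_int_zt x) tendsto_id
  have hI : IntegrableOn (fun τ : ℝ => Fa x (1 + τ * Complex.I) * Complex.I) (Ioi 0) :=
    ((Fa_int x).mul_const _).integrableOn
  have h2 := intervalIntegral_tendsto_integral_Ioi 0 hI tendsto_id
  have h3 : Tendsto (fun T : ℝ => (∫ τ in (0:ℝ)..T, Fa x (zt τ) * (1 + Complex.I)) -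
      ∫ τ in (0:ℝ)..T, Fa x (1 + τ * Complex.I) * Complex.I) atTop (𝓝 0) := by
    have e : ∀ T : ℝ, (∫ τ in (0:ℝ)..T, Fa x (zt τ) * (1 + Complex.I)) -
      (∫ τ in (0:ℝ)..T, Fa x (1 + τ * Complex.I) * Complex.I)
        = ∫ τ in (0:ℝ)..T, Fa x ((1 + T * Complex.I) + τ * 1) * 1 := by
      intro T
      unfold zt
      rw [path, path, path]
      ring_nf
    simp_rw [e]
    have hb : Tendsto (fun T : ℝ => Real.exp (|x|) * (T ^ (1:ℝ) * Real.exp (-(11/27) * T))) atTop (𝓝 0) := by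
      have := (tendsto_rpow_mul_exp_neg_mul_atTop_nhds_zero 1 (11/27) (by norm_num)).const_mul (Real.exp |x|)
      simpa using this
    refine squeeze_zero_norm' ?_ hb
    filter_upwards [eventually_ge_atTop 3, eventually_ge_atTop (3 * |x| + 3)] with T hT hTx
    have hax := abs_nonneg x
    refine (intervalIntegral.norm_integral_le_of_norm_le_const (C := Real.exp (|x| - 11/27 * T)) ?_).trans ?_
    · intro τ hτ
      rw [uIoc_of_le (by linarith)] at hτ
      rw [mul_one, mul_one, Fa_norm]
      apply Real.exp_le_exp.2
      have e1 : (1 + (T:ℂ) * Complex.I + τ).re = 1 + τ := by simp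
      have e2 : (1 + (T:ℂ) * Complex.I + τ).im = T := by simp
      rw [e1, e2]
      set u := 1 + τ with hu
      have hu1 : 1 ≤ u := by linarith [hτ.1]
      have hu2 : u ≤ 4/3 * T := by linarith [hτ.2]
      have hu3 : u ^ 2 / 3 ≤ 16/27 * T ^ 2 := by nlinarith
      have hx' : -(x * u) ≤ |x| * u := by nlinarith [neg_abs_le x]
      have h5 : |x| - 11/27 * T ^ 2 ≤ |x| - 11/27 * T := by nlinarith
      have h6 : |x| - 11/27 * T ≤ 0 := by linarith
      calc u * (u ^ 2 / 3 - T ^ 2) - x * u ≤ u * (|x| - 11/27 * T ^ 2) := by nlinarith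
        _ ≤ u * (|x| - 11/27 * T) := by gcongr
        _ ≤ _ := by nlinarith
    · rw [sub_zero, abs_of_nonneg (by linarith : 0 ≤ T), Real.rpow_one, sub_eq_add_neg, Real.exp_add]
      apply le_of_eq
      ring_nf
  have h4 := tendsto_nhds_unique (h1.sub h2) h3
  have h5 := sub_eq_zero.1 h4
  have hAi : Ai x = Real.pi⁻¹ * (∫ τ in Ioi (0:ℝ), Fa x (1 + τ * Complex.I) * Complex.I).im := by
    rw [← h5, Ai]
    congr 3
    funext τ
    rw [Fa]; congr 2; ring
  have hre : (∫ τ in Ioi (0:ℝ), Fa x (1 + τ * Complex.I) * Complex.I).im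
      = (∫ τ in Ioi (0:ℝ), Fa x (1 + τ * Complex.I)).re := by
    rw [integral_mul_const]; simp
  have hsplit := integral_add_compl (measurableSet_Ioi (a := (0:ℝ))) (Fa_int x)
  have hneg : ∫ t in (Ioi (0:ℝ))ᶜ, Fa x (1 + t * Complex.I) = (starRingEnd ℂ) (∫ t in Ioi (0:ℝ), Fa x (1 + t * Complex.I)) := by
    rw [compl_Ioi, ← integral_conj]
    have := integral_comp_neg_Ioi (0:ℝ) (fun t : ℝ => Fa x (1 + t * Complex.I))
    rw [neg_zero] at this
    rw [← this]
    congr 1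
    funext t
    exact Fa_conj x t
  rw [← hsplit, hneg, Complex.add_conj, hAi, hre]
  generalize (∫ τ in Ioi (0:ℝ), Fa x (1 + τ * Complex.I)).re = w
  congr 1
  field_simp

lemma Ai_meas : Measurable Ai := by
  have h : ∀ x, Ai x = (2 * Real.pi)⁻¹ * (∫ t : ℝ, Fa x (1 + t * Complex.I)).re := by
    intro x; rw [← Ai_eq, Complex.ofReal_re]; field_simp
  rw [funext h]
  have : StronglyMeasurable (fun x : ℝ => ∫ t : ℝ, Fa x (1 + t * Complex.I)) :=
    (Fa_cont2.stronglyMeasurable).integral_prod_right'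
  exact (Complex.measurable_re.comp this.measurable).const_mul _

lemma Ai_bound : ∃ C, 0 < C ∧ ∀ x, |Ai x| ≤ C * Real.exp (-x) := by
  refine ⟨(2 * Real.pi)⁻¹ * (Real.exp (1/3) * ∫ t : ℝ, Real.exp (-1 * t ^ 2)), ?_, ?_⟩
  · rw [integral_gaussian]; positivity
  · intro x
    have h1 : ‖((2 * Real.pi * Ai x : ℝ) : ℂ)‖ ≤ Real.exp (1/3 - x) * ∫ t : ℝ, Real.exp (-1 * t ^ 2) := by
      rw [Ai_eq, ← integral_const_mul]
      exact (norm_integral_le_integral_norm _).trans (le_of_eq (by simp_rw [Fa_vert_norm]))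
    rw [Complex.norm_real, Real.norm_eq_abs, abs_mul, abs_of_pos (by positivity)] at h1
    rw [sub_eq_add_neg, Real.exp_add] at h1
    rw [mul_assoc (2 * Real.pi)⁻¹, inv_mul_eq_div, le_div_iff₀ (by positivity)]
    linarith

lemma ae_snd {p : ℝ × ℝ → Prop} (h : ∀ z : ℝ × ℝ, 0 < z.2 → p z) :
    ∀ᵐ z ∂((volume : Measure ℝ).prod ((volume : Measure ℝ).restrict (Ioi 0))), p z := by
  have e := Measure.prod_restrict (μ := (volume : Measure ℝ)) (ν := (volume : Measure ℝ)) univ (Ioi 0)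
  rw [Measure.restrict_univ, univ_prod] at e
  rw [e]
  exact (ae_restrict_iff' (measurableSet_Ioi.preimage measurable_snd)).2 (Eventually.of_forall fun z hz => h z hz)

theorem airyKernel_eq (x y : ℝ) : airyKernel x y = ((∫ r in Ioi (0:ℝ), Ai (x + r) * Ai (y + r) : ℝ) : ℂ) := by
  have hgi := integrable_exp_neg_mul_sq (b := 1) one_pos
  have key : ∀ t s : ℝ, Complex.exp ((1 + t * Complex.I) ^ 3 / 3 - x * (1 + t * Complex.I)) *
        Complex.exp (-(-1 + s * Complex.I) ^ 3 / 3 + y * (-1 + s * Complex.I)) /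
        ((1 + t * Complex.I) - (-1 + s * Complex.I))
      = ∫ r in Ioi (0:ℝ), Fa (x + r) (1 + t * Complex.I) * Fa (y + r) (1 + ((-s:ℝ):ℂ) * Complex.I) := by
    intro t s
    have h := integral_exp_mul_complex_Ioi (a := -((1 + t * Complex.I) - (-1 + s * Complex.I)))
      (by simp) 0
    have e : ∀ r : ℝ, Fa (x + r) (1 + t * Complex.I) * Fa (y + r) (1 + ((-s:ℝ):ℂ) * Complex.I)
        = (Complex.exp ((1 + t * Complex.I) ^ 3 / 3 - x * (1 + t * Complex.I)) *
        Complex.exp (-(-1 + s * Complex.I) ^ 3 / 3 + y * (-1 + s * Complex.I)))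
         * Complex.exp (-((1 + t * Complex.I) - (-1 + s * Complex.I)) * r) := by
      intro r
      unfold Fa
      rw [← Complex.exp_add, ← Complex.exp_add, ← Complex.exp_add]
      congr 1
      push_cast
      ring
    simp_rw [e]
    rw [integral_const_mul, h]
    simp only [Complex.ofReal_zero, mul_zero, Complex.exp_zero]
    rw [div_eq_mul_inv, neg_div_neg_eq, one_div]
  have inner : ∀ t : ℝ, (∫ s : ℝ, Complex.exp ((1 + t * Complex.I) ^ 3 / 3 - x * (1 + t * Complex.I)) *
        Complex.exp (-(-1 + s * Complex.I) ^ 3 / 3 + y * (-1 + s * Complex.I)) /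
        ((1 + t * Complex.I) - (-1 + s * Complex.I)) * Complex.I)
      = (∫ r in Ioi (0:ℝ), Fa (x + r) (1 + t * Complex.I) * ((2 * Real.pi * Ai (y + r) : ℝ) : ℂ)) * Complex.I := by
    intro t
    rw [integral_mul_const]
    simp_rw [key]
    rw [integral_integral_swap]
    · congr 2
      funext r
      rw [integral_const_mul, Ai_eq]
      congr 1
      exact integral_neg_eq_self (fun s : ℝ => Fa (y + r) (1 + (s:ℂ) * Complex.I)) volume
    · refine Integrable.mono' (g := fun p : ℝ × ℝ => (Real.exp (-1 * p.1 ^ 2)) *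
        (Real.exp (1/3 - x) * Real.exp (-1 * t ^ 2) * Real.exp (1/3 - y) * Real.exp (0 - p.2)))
        (hgi.mul_prod ((int_exp_sub 0).const_mul _)) ?_ ?_
      · refine Continuous.aestronglyMeasurable ?_
        unfold Fa Function.uncurry; fun_prop
      · refine ae_snd fun p hp2 => ?_
        simp only [Function.uncurry]
        rw [norm_mul, Fa_vert_norm, Fa_vert_norm]
        simp only [← Real.exp_add]
        apply Real.exp_le_exp.2
        nlinarith
  unfold airyKernel
  simp_rw [inner]
  rw [integral_mul_const, integral_mul_const, integral_integral_swap]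
  · have e : ∀ r : ℝ, ∫ t : ℝ, Fa (x + r) (1 + t * Complex.I) * ((2 * Real.pi * Ai (y + r) : ℝ) : ℂ)
        = (((2 * Real.pi) ^ 2 * (Ai (x + r) * Ai (y + r)) : ℝ) : ℂ) := by
      intro r
      rw [integral_mul_const, ← Ai_eq, ← Complex.ofReal_mul]
      congr 1; ring
    simp_rw [e]
    rw [integral_complex_ofReal, integral_const_mul]
    push_cast
    have hI : Complex.I ^ 2 = -1 := Complex.I_sq
    have hpi : (Real.pi : ℂ) ≠ 0 := by exact_mod_cast Real.pi_ne_zero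
    generalize ((∫ r in Ioi (0:ℝ), Ai (x + r) * Ai (y + r) : ℝ) : ℂ) = w
    field_simp
  · obtain ⟨C, hC, hAb⟩ := Ai_bound
    refine Integrable.mono' (g := fun p : ℝ × ℝ => (Real.exp (-1 * p.1 ^ 2)) *
        (Real.exp (1/3 - x) * (2 * Real.pi * (C * Real.exp (-y))) * Real.exp (0 - p.2)))
        (hgi.mul_prod ((int_exp_sub 0).const_mul _)) ?_ ?_
    · refine AEStronglyMeasurable.mul ?_ ?_
      · exact Continuous.aestronglyMeasurable (by unfold Fa; fun_prop)
      · refine Measurable.aestronglyMeasurable ?_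
        refine Complex.measurable_ofReal.comp ?_
        exact (Ai_meas.comp (measurable_snd.const_add y)).const_mul _
    · refine ae_snd fun p hp2 => ?_
      simp only [Function.uncurry]
      rw [norm_mul, Fa_vert_norm, Complex.norm_real, Real.norm_eq_abs, abs_mul, abs_of_pos (by positivity : 0 < 2 * Real.pi)]
      have h1 : Real.exp (1/3 - (x + p.2)) ≤ Real.exp (1/3 - x) * Real.exp (0 - p.2) := by
        rw [← Real.exp_add]; gcongr; linarith
      have h2 : |Ai (y + p.2)| ≤ C * Real.exp (-y) := by
        refine (hAb _).trans ?_
        gcongr; linarith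
      calc _ ≤ (Real.exp (1/3 - x) * Real.exp (0 - p.2)) * Real.exp (-1 * p.1 ^ 2) * (2 * Real.pi * (C * Real.exp (-y))) := by gcongr
        _ = _ := by ring

lemma floor_cell {σ : ℝ} (hσ : 0 < σ) {r : ℝ} (hr : 0 ≤ r) (m : ℕ) :
    ⌊r / σ⌋₊ = m ↔ r ∈ Ico ((m:ℝ) * σ) ((m:ℝ) * σ + σ) := by
  rw [Nat.floor_eq_iff (by positivity), le_div_iff₀ hσ, div_lt_iff₀ hσ, mem_Ico, add_mul, one_mul]

lemma step_int (g : ℕ → ℝ) (hg : Summable g) {σ : ℝ} (hσ : 0 < σ) :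
    ∫ r in Ioi (0:ℝ), g ⌊r / σ⌋₊ = σ * ∑' m, g m := by
  set S : ℕ → Set ℝ := fun m => Ico ((m:ℝ) * σ) ((m:ℝ) * σ + σ) with hS
  have hS0 : ∀ m, ∀ r ∈ S m, 0 ≤ r := fun m r hr => le_trans (by positivity) hr.1
  have hSf : ∀ m, ∀ r ∈ S m, ⌊r / σ⌋₊ = m := fun m r hr => (floor_cell hσ (hS0 m r hr) m).2 hr
  have hU : (⋃ m, S m) = Ici 0 := by
    ext r
    simp only [mem_iUnion, mem_Ici]
    exact ⟨fun ⟨m, hm⟩ => hS0 m r hm, fun h => ⟨_, (floor_cell hσ h _).1 rfl⟩⟩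
  have hD : Pairwise (Function.onFun Disjoint S) := by
    intro m k hmk
    refine Set.disjoint_left.2 fun r h1 h2 => hmk ?_
    rw [← hSf m r h1, hSf k r h2]
  have hmS : ∀ m, MeasurableSet (S m) := fun m => measurableSet_Ico
  have hvol : ∀ m, (volume : Measure ℝ).real (S m) = σ := by
    intro m; simp [hS, Measure.real, hσ.le]
  have hfin : ∀ m, (volume : Measure ℝ) (S m) ≠ ⊤ := by intro m; simp [hS]
  have hi : ∀ m, IntegrableOn (fun r => g ⌊r / σ⌋₊) (S m) := fun m =>
    (integrableOn_const (hfin m) (C := g m)).congr_fun (fun r hr => by simp only; rw [hSf m r hr]) (hmS m)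
  have hv : ∀ m, ∫ r in S m, g ⌊r / σ⌋₊ = σ * g m := by
    intro m
    rw [setIntegral_congr_fun (hmS m) (g := fun _ => g m) (fun r hr => by simp only; rw [hSf m r hr]),
      setIntegral_const, hvol, smul_eq_mul]
  have hvn : ∀ m, ∫ r in S m, ‖g ⌊r / σ⌋₊‖ = σ * ‖g m‖ := by
    intro m
    rw [setIntegral_congr_fun (hmS m) (g := fun _ => ‖g m‖) (fun r hr => by simp only; rw [hSf m r hr]),
      setIntegral_const, hvol, smul_eq_mul]
  have hI := integrableOn_iUnion_of_summable_integral_norm hi (by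
    simp_rw [hvn]; exact (hg.norm).mul_left σ)
  have := hasSum_integral_iUnion hmS hD hI
  simp_rw [hv] at this
  rw [hU, integral_Ici_eq_integral_Ioi] at this
  rw [← this.tsum_eq, tsum_mul_left]

def KK (b η θ uc ε : ℝ) (M j j' : ℕ) : ℝ :=
  kern (xs b (η * ε) M) (xs b (θ * ε) M) (j + M) (j' + M) * Real.exp (((j':ℝ) - j) * uc)

lemma KK_hasSum {b η θ uc v c ε : ℝ} (h : SP b η θ uc v c) (hε : 0 < ε) (M j j' : ℕ) :
    HasSum (fun m => Ah b θ η (-uc) ε M (j + m) * Ah b η θ uc ε M (j' + m)) (KK b η θ uc ε M j j') := by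
  have hη := h.hη
  have hθ := h.hθ
  have hk := kern_hasSum (xs b (η * ε) M) (xs b (θ * ε) M) (fun i k => ?_) (fun i k => ?_) (j + M) (j' + M)
  · have := hk.mul_right (Real.exp (((j':ℝ) - j) * uc))
    refine this.congr_fun ?_ |> fun h => h
    intro m
    unfold Ah
    rw [Rr_swap]
    have hR := (Rr_pos h hε M).ne'
    have e : Real.exp (((j':ℝ) - j) * uc) = Real.exp ((((j + m : ℕ):ℝ) + 1) * -uc) * Real.exp ((((j' + m : ℕ):ℝ) + 1) * uc) := by
      rw [← Real.exp_add]; congr 1; push_cast; ring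
    rw [e, show j + M + m = j + m + M by ring, show j' + M + m = j' + m + M by ring]
    generalize Rr (xs b (η * ε) M) (xs b (θ * ε) M) uc = R at *
    field_simp
  · exact mul_nonneg (xs_bd h.hb (by positivity) M i).1.le (xs_bd h.hb (by positivity) M k).1.le
  · have h1 := xs_bd h.hb (show 0 < θ * ε by positivity) M k
    have h2 : xs b (η * ε) M i < b := by
      rw [xs_eq]
      refine mul_lt_of_lt_one_right h.hb ?_
      rw [Real.exp_lt_one_iff]
      have : 0 < η * ε * ((i : ℕ) + 1 / 2 : ℝ) := by positivity
      linarith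
    have h3 := (xs_bd h.hb (show 0 < η * ε by positivity) M i).1
    nlinarith [h.hb1, h.hb]

lemma KK_int {b η θ uc v c ε σ : ℝ} (h : SP b η θ uc v c) (hε : 0 < ε) (hσ : 0 < σ) (M j j' : ℕ) :
    KK b η θ uc ε M j j' / σ = ∫ r in Ioi (0:ℝ), (Ah b θ η (-uc) ε M (j + ⌊r / σ⌋₊) / σ) *
      (Ah b η θ uc ε M (j' + ⌊r / σ⌋₊) / σ) := by
  have h1 := KK_hasSum h hε M j j'
  have h2 := step_int _ (h1.summable.mul_left (1 / σ ^ 2)) hσ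
  rw [tsum_mul_left, h1.tsum_eq] at h2
  have e : ∀ r : ℝ, (Ah b θ η (-uc) ε M (j + ⌊r / σ⌋₊) / σ) * (Ah b η θ uc ε M (j' + ⌊r / σ⌋₊) / σ)
      = 1 / σ ^ 2 * (Ah b θ η (-uc) ε M (j + ⌊r / σ⌋₊) * Ah b η θ uc ε M (j' + ⌊r / σ⌋₊)) := by
    intro r; field_simp
  simp_rw [e]
  rw [h2]
  field_simp

lemma good.swap {η θ ε : ℝ} {M : ℕ} (h : good η θ ε M) : good θ η ε M :=
  ⟨h.1, h.2.2.1, h.2.1, h.2.2.2.2, h.2.2.2.1⟩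

lemma floor_bd {σ r : ℝ} (hσ : 0 < σ) (hr : 0 ≤ r) : r - σ ≤ σ * (⌊r / σ⌋₊ : ℝ) ∧ σ * (⌊r / σ⌋₊ : ℝ) ≤ r := by
  have h := (floor_cell hσ hr _).1 rfl
  constructor <;> linarith [h.1, h.2]

theorem SP.KK_core {b η θ uc v c : ℝ} (h : SP b η θ uc v c) (X0 : ℝ) (hX0 : 0 ≤ X0) :
    ∃ C δ, 0 < C ∧ 0 < δ ∧ ∀ σ : ℝ, 0 < σ → σ ≤ δ → ∀ M j j' : ℕ, good η θ (c ^ 3 * σ ^ 3) M →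
      -X0 ≤ σ * ((j : ℝ) + 1 - v / (c ^ 3 * σ ^ 3)) → -X0 ≤ σ * ((j' : ℝ) + 1 - v / (c ^ 3 * σ ^ 3)) →
      ∀ r : ℝ, 0 ≤ r → ‖(Ah b θ η (-uc) (c ^ 3 * σ ^ 3) M (j + ⌊r / σ⌋₊) / σ) *
      (Ah b η θ uc (c ^ 3 * σ ^ 3) M (j' + ⌊r / σ⌋₊) / σ)‖ ≤
        C * (Real.exp (-(σ * ((j : ℝ) + 1 - v / (c ^ 3 * σ ^ 3)))) *
          Real.exp (-(σ * ((j' : ℝ) + 1 - v / (c ^ 3 * σ ^ 3))))) * Real.exp (2 - r) := by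
  obtain ⟨C1, d1, hC1, hd1, hb1⟩ := h.Ah_bound X0 hX0
  obtain ⟨C2, d2, hC2, hd2, hb2⟩ := h.swap.Ah_bound X0 hX0
  refine ⟨C2 * C1, min (min d1 d2) 1, by positivity, by positivity, ?_⟩
  intro σ hσ hσd M j j' hg hj hj' r hr
  have hσ1 : σ ≤ d1 := hσd.trans ((min_le_left _ _).trans (min_le_left _ _))
  have hσ2 : σ ≤ d2 := hσd.trans ((min_le_left _ _).trans (min_le_right _ _))
  have hσ3 : σ ≤ 1 := hσd.trans (min_le_right _ _)
  have hf := floor_bd hσ hr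
  set F := ⌊r / σ⌋₊
  have hF0 : 0 ≤ σ * (F:ℝ) := by positivity
  have e : ∀ j : ℕ, σ * (((j + F : ℕ) : ℝ) + 1 - v / (c ^ 3 * σ ^ 3)) = σ * ((j : ℝ) + 1 - v / (c ^ 3 * σ ^ 3)) + σ * F := by
    intro j; push_cast; ring
  have h1 := hb2 σ hσ hσ2 M (j + F) hg.swap (by rw [e]; linarith)
  have h2 := hb1 σ hσ hσ1 M (j' + F) hg (by rw [e]; linarith)
  rw [e] at h1 h2
  rw [norm_mul, Real.norm_eq_abs, Real.norm_eq_abs]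
  refine (mul_le_mul h1 h2 (abs_nonneg _) (by positivity)).trans ?_
  generalize σ * ((j : ℝ) + 1 - v / (c ^ 3 * σ ^ 3)) = X
  generalize σ * ((j' : ℝ) + 1 - v / (c ^ 3 * σ ^ 3)) = Y
  have : Real.exp (-(X + σ * F)) * Real.exp (-(Y + σ * F)) ≤ Real.exp (-X) * Real.exp (-Y) * Real.exp (2 - r) := by
    simp only [← Real.exp_add]
    apply Real.exp_le_exp.2
    linarith
  calc _ = C2 * C1 * (Real.exp (-(X + σ * F)) * Real.exp (-(Y + σ * F))) := by ring
    _ ≤ C2 * C1 * (Real.exp (-X) * Real.exp (-Y) * Real.exp (2 - r)) := by gcongr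
    _ = _ := by ring

theorem SP.KK_bound {b η θ uc v c : ℝ} (h : SP b η θ uc v c) (X0 : ℝ) (hX0 : 0 ≤ X0) :
    ∃ C δ, 0 < C ∧ 0 < δ ∧ ∀ σ : ℝ, 0 < σ → σ ≤ δ → ∀ M j j' : ℕ, good η θ (c ^ 3 * σ ^ 3) M →
      -X0 ≤ σ * ((j : ℝ) + 1 - v / (c ^ 3 * σ ^ 3)) → -X0 ≤ σ * ((j' : ℝ) + 1 - v / (c ^ 3 * σ ^ 3)) →
      |KK b η θ uc (c ^ 3 * σ ^ 3) M j j' / σ| ≤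
        C * (Real.exp (-(σ * ((j : ℝ) + 1 - v / (c ^ 3 * σ ^ 3)))) *
          Real.exp (-(σ * ((j' : ℝ) + 1 - v / (c ^ 3 * σ ^ 3))))) := by
  obtain ⟨C, δ, hC, hδ, hb⟩ := h.KK_core X0 hX0
  refine ⟨C * Real.exp 2, δ, by positivity, hδ, ?_⟩
  intro σ hσ hσd M j j' hg hj hj'
  rw [KK_int h hg.1 hσ, ← Real.norm_eq_abs]
  refine (norm_integral_le_of_norm_le ((int_exp_sub 2).const_mul _) ((ae_restrict_iff' measurableSet_Ioi).2
    (Eventually.of_forall fun r hr => hb σ hσ hσd M j j' hg hj hj' r (le_of_lt hr)))).trans (le_of_eq ?_)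
  rw [integral_const_mul]
  have : (fun τ : ℝ => Real.exp (2 - τ)) = fun τ => Real.exp 2 * Real.exp (-τ) := by
    funext τ; rw [← Real.exp_add]; congr 1
  rw [this, integral_const_mul, integral_exp_neg_Ioi_zero]
  ring

theorem SP.KK_lim {b η θ uc v c : ℝ} (h : SP b η θ uc v c) (x y : ℝ) (M j j' : ℝ → ℕ)
    (hM : ∀ᶠ σ in 𝓝[>] (0:ℝ), good η θ (c ^ 3 * σ ^ 3) (M σ))
    (hj : Tendsto (fun σ : ℝ => σ * ((j σ : ℝ) + 1 - v / (c ^ 3 * σ ^ 3))) (𝓝[>] 0) (𝓝 x))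
    (hj' : Tendsto (fun σ : ℝ => σ * ((j' σ : ℝ) + 1 - v / (c ^ 3 * σ ^ 3))) (𝓝[>] 0) (𝓝 y)) :
    Tendsto (fun σ : ℝ => KK b η θ uc (c ^ 3 * σ ^ 3) (M σ) (j σ) (j' σ) / σ) (𝓝[>] 0)
      (𝓝 (∫ r in Ioi (0:ℝ), Ai (x + r) * Ai (y + r))) := by
  obtain ⟨C, δ, hC, hδ, hb⟩ := h.KK_core (|x| + |y| + 1) (by positivity)
  have hσev : ∀ᶠ σ in 𝓝[>] (0:ℝ), σ ∈ Ioc 0 δ := Ioc_mem_nhdsGT hδ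
  have hxev := hj.eventually (Icc_mem_nhds (show x - 1 < x by linarith) (show x < x + 1 by linarith))
  have hyev := hj'.eventually (Icc_mem_nhds (show y - 1 < y by linarith) (show y < y + 1 by linarith))
  have e : (fun σ : ℝ => KK b η θ uc (c ^ 3 * σ ^ 3) (M σ) (j σ) (j' σ) / σ) =ᶠ[𝓝[>] 0]
      fun σ => ∫ r in Ioi (0:ℝ), (Ah b θ η (-uc) (c ^ 3 * σ ^ 3) (M σ) (j σ + ⌊r / σ⌋₊) / σ) *
      (Ah b η θ uc (c ^ 3 * σ ^ 3) (M σ) (j' σ + ⌊r / σ⌋₊) / σ) := by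
    filter_upwards [hM, hσev] with σ h1 h2
    exact KK_int h h1.1 h2.1 _ _ _
  rw [tendsto_congr' e]
  refine tendsto_integral_filter_of_dominated_convergence
    (fun r => C * (Real.exp (-(x - 1)) * Real.exp (-(y - 1))) * Real.exp (2 - r)) ?_ ?_ ((int_exp_sub 2).const_mul _) ?_
  · refine Eventually.of_forall fun σ => Measurable.aestronglyMeasurable ?_
    exact (measurable_from_top (f := fun k : ℕ => (Ah b θ η (-uc) (c ^ 3 * σ ^ 3) (M σ) (j σ + k) / σ) *
      (Ah b η θ uc (c ^ 3 * σ ^ 3) (M σ) (j' σ + k) / σ))).comp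
      (Nat.measurable_floor.comp (measurable_id.div_const σ))
  · filter_upwards [hM, hσev, hxev, hyev] with σ h1 h2 h3 h4
    refine (ae_restrict_iff' measurableSet_Ioi).2 (Eventually.of_forall fun r hr => ?_)
    have hx1 := neg_abs_le x
    have hy1 := neg_abs_le y
    have hx2 := abs_nonneg x
    have hy2 := abs_nonneg y
    refine (hb σ h2.1 h2.2 _ _ _ h1 (by linarith [h3.1]) (by linarith [h4.1]) r (le_of_lt hr)).trans ?_
    have := h3.1
    have := h4.1
    gcongr
  · refine (ae_restrict_iff' measurableSet_Ioi).2 (Eventually.of_forall fun r hr => ?_)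
    have hr0 : 0 ≤ r := le_of_lt hr
    have hfl : Tendsto (fun σ : ℝ => σ * (⌊r / σ⌋₊ : ℝ)) (𝓝[>] 0) (𝓝 r) := by
      have hid : Tendsto (fun σ : ℝ => r - σ) (𝓝[>] 0) (𝓝 r) := by
        have : Tendsto (fun σ : ℝ => r - σ) (𝓝 0) (𝓝 (r - 0)) := (continuous_const.sub continuous_id).tendsto 0
        rw [sub_zero] at this
        exact this.mono_left nhdsWithin_le_nhds
      refine tendsto_of_tendsto_of_tendsto_of_le_of_le' hid tendsto_const_nhds ?_ ?_
      · filter_upwards [self_mem_nhdsWithin] with σ hσ using (floor_bd hσ hr0).1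
      · filter_upwards [self_mem_nhdsWithin] with σ hσ using (floor_bd hσ hr0).2
    refine Tendsto.mul ?_ ?_
    · refine h.swap.Ah_lim (x + r) M (fun σ => j σ + ⌊r / σ⌋₊) (hM.mono fun σ hσ => hσ.swap) ?_
      refine (hj.add hfl).congr fun σ => ?_
      push_cast; ring
    · refine h.Ah_lim (y + r) M (fun σ => j' σ + ⌊r / σ⌋₊) hM ?_
      refine (hj'.add hfl).congr fun σ => ?_
      push_cast; ring

lemma hadamard {m : ℕ} (A : Matrix (Fin m) (Fin m) ℝ) : |A.det| ≤ ∏ i, Real.sqrt (∑ j, A i j ^ 2) := by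
  have : Fact (Module.finrank ℝ (EuclideanSpace ℝ (Fin m)) = m) := ⟨by simp⟩
  set bs := EuclideanSpace.basisFun (Fin m) ℝ
  set v : Fin m → EuclideanSpace ℝ (Fin m) := fun i => WithLp.toLp 2 (A i) with hv
  have h1 := bs.toBasis.orientation.abs_volumeForm_apply_le v
  rw [bs.toBasis.orientation.volumeForm_robust' bs v] at h1
  have h2 : bs.toBasis.det v = A.det := by
    rw [Module.Basis.det_apply, ← Matrix.det_transpose]
    congr 1
  rw [h2] at h1
  refine h1.trans (le_of_eq ?_)
  refine Finset.prod_congr rfl fun i _ => ?_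
  rw [EuclideanSpace.norm_eq]
  simp [hv]

lemma hadamard' {m : ℕ} (A : Matrix (Fin m) (Fin m) ℝ) (u : Fin m → ℝ) (hu : ∀ i, 0 < u i) (C : ℝ) (hC : 0 ≤ C)
    (hA : ∀ i j, |A i j| ≤ C * (u i * u j)) : |A.det| ≤ (C * Real.sqrt m) ^ m * ∏ i, u i ^ 2 := by
  set B : Matrix (Fin m) (Fin m) ℝ := Matrix.of fun i j => A i j / (u i * u j) with hB
  have e : A = Matrix.of fun i j => u i * (Matrix.of (fun i j => u j * B i j)) i j := by
    ext i j
    have := (hu i).ne'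
    have := (hu j).ne'
    simp only [hB, Matrix.of_apply]
    field_simp
  have h1 : A.det = (∏ i, u i ^ 2) * B.det := by
    conv_lhs => rw [e]
    rw [Matrix.det_mul_column, Matrix.det_mul_row, ← mul_assoc, ← Finset.prod_mul_distrib]
    simp only [sq]
  have h2 : |B.det| ≤ (C * Real.sqrt m) ^ m := by
    refine (hadamard B).trans ?_
    have : ∀ i ∈ Finset.univ, Real.sqrt (∑ j, B i j ^ 2) ≤ C * Real.sqrt m := by
      intro i _
      rw [show C * Real.sqrt m = Real.sqrt (m * C ^ 2) by
        rw [Real.sqrt_mul (by positivity), Real.sqrt_sq hC]; ring]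
      refine Real.sqrt_le_sqrt ?_
      refine (Finset.sum_le_card_nsmul _ _ (C ^ 2) fun j _ => ?_).trans (by simp)
      have h3 : |B i j| ≤ C := by
        simp only [hB, Matrix.of_apply]
        have := mul_pos (hu i) (hu j)
        rw [abs_div, abs_of_pos this, div_le_iff₀ this]
        exact hA i j
      rw [← sq_abs]
      gcongr
    refine (Finset.prod_le_prod (fun i _ => Real.sqrt_nonneg _) this).trans ?_
    simp
  rw [h1, abs_mul, abs_of_pos (Finset.prod_pos fun i _ => by have := hu i; positivity), mul_comm]
  gcongr

lemma had_summable (B : ℝ) (hB : 0 ≤ B) :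
    Summable fun m : ℕ => ((m.factorial : ℝ))⁻¹ * ((B * Real.sqrt m) ^ m) := by
  have h1 : Summable fun m : ℕ => (1/4 : ℝ) ^ m := summable_geometric_of_lt_one (by norm_num) (by norm_num)
  have h2 := Real.summable_pow_div_factorial (4 * B ^ 2 * Real.exp 1)
  refine Summable.of_nonneg_of_le (fun m => by positivity) (fun m => ?_) (h1.add h2)
  have hf : (0:ℝ) < m.factorial := by exact_mod_cast m.factorial_pos
  have h3 : (m:ℝ) ^ m ≤ Real.exp 1 ^ m * m.factorial := by
    have := Real.pow_div_factorial_le_exp (m:ℝ) (by positivity) m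
    rw [div_le_iff₀ hf] at this
    rwa [← Real.exp_nat_mul, mul_one]
  set X := (1/2 : ℝ) ^ m with hX
  set Y := ((m.factorial : ℝ))⁻¹ * ((2 * B * Real.sqrt m) ^ m) with hY
  have e1 : ((m.factorial : ℝ))⁻¹ * ((B * Real.sqrt m) ^ m) = X * Y := by
    rw [hX, hY, show 2 * B * Real.sqrt m = 2 * (B * Real.sqrt m) by ring, mul_pow 2]
    have : (1/2:ℝ)^m * 2^m = 1 := by rw [← mul_pow]; norm_num
    linear_combination (-(((m.factorial : ℝ))⁻¹ * ((B * Real.sqrt m) ^ m))) * this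
  have e2 : (1/4:ℝ) ^ m = X ^ 2 := by rw [hX, ← pow_mul, mul_comm, pow_mul]; norm_num
  have e3 : Y ^ 2 ≤ (4 * B ^ 2 * Real.exp 1) ^ m / m.factorial := by
    have : Y ^ 2 = ((m.factorial : ℝ))⁻¹ ^ 2 * ((4 * B ^ 2) ^ m * (m:ℝ) ^ m) := by
      rw [hY, mul_pow, ← pow_mul, mul_comm m 2, pow_mul, mul_pow (2 * B), Real.sq_sqrt (by positivity), mul_pow]
      ring
    rw [this, le_div_iff₀ hf]
    calc _ ≤ ((m.factorial : ℝ))⁻¹ ^ 2 * ((4 * B ^ 2) ^ m * (Real.exp 1 ^ m * m.factorial)) * m.factorial := by gcongr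
      _ = _ := by rw [mul_pow (4 * B ^ 2)]; field_simp
  rw [e1, e2]
  nlinarith [sq_nonneg (X - Y), sq_nonneg X, sq_nonneg Y]

lemma setpi_eq (m : ℕ) (s : ℝ) : {x : Fin m → ℝ | ∀ i, x i ∈ Ioi s} = univ.pi fun _ => Ioi s := by
  ext x; simp [Set.mem_pi]

lemma prod_int (m : ℕ) (s : ℝ) :
    IntegrableOn (fun x : Fin m → ℝ => ∏ i, Real.exp (1 - x i) ^ 2) {x | ∀ i, x i ∈ Ioi s} ∧
    ∫ x in {x : Fin m → ℝ | ∀ i, x i ∈ Ioi s}, ∏ i, Real.exp (1 - x i) ^ 2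
      = (∫ t in Ioi s, Real.exp (1 - t) ^ 2) ^ m := by
  have hi : IntegrableOn (fun t : ℝ => Real.exp (1 - t) ^ 2) (Ioi s) := by
    have : (fun t : ℝ => Real.exp (1 - t) ^ 2) = fun t => Real.exp 2 * Real.exp (-2 * t) := by
      funext t; rw [← Real.exp_nat_mul, ← Real.exp_add]; congr 1; push_cast; ring
    rw [this]
    exact (integrableOn_exp_mul_Ioi (by norm_num) s).const_mul _
  rw [setpi_eq, IntegrableOn, volume_pi, Measure.restrict_pi_pi]
  refine ⟨?_, ?_⟩
  · exact Integrable.fintype_prod (f := fun _ t => Real.exp (1 - t) ^ 2) (fun _ => hi)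
  · rw [integral_fintype_prod_eq_pow (fun t : ℝ => Real.exp (1 - t) ^ 2)]
    simp

def Tc (s σ : ℝ) (k : ℕ) : Set ℝ := Ioi s ∩ Ico (s + k * σ) (s + k * σ + σ)

lemma Tc_vol (s : ℝ) {σ : ℝ} (hσ : 0 < σ) (k : ℕ) : volume (Tc s σ k) = ENNReal.ofReal σ := by
  have hk : 0 ≤ (k:ℝ) * σ := by positivity
  refine le_antisymm ?_ ?_
  · refine (measure_mono inter_subset_right).trans ?_
    rw [Real.volume_Ico]; simp
  · calc ENNReal.ofReal σ = volume (Ioo (s + k * σ) (s + k * σ + σ)) := by rw [Real.volume_Ioo]; simp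
      _ ≤ _ := measure_mono (fun x hx => by
        exact ⟨by have := hx.1; simp only [mem_Ioi]; linarith, hx.1.le, hx.2⟩)

lemma Tc_mem {s σ : ℝ} (hσ : 0 < σ) (k : ℕ) (r : ℝ) : r ∈ Tc s σ k ↔ s < r ∧ ⌊(r - s) / σ⌋₊ = k := by
  unfold Tc
  constructor
  · rintro ⟨h1, h2⟩
    have h1' : s < r := h1
    exact ⟨h1, (floor_cell hσ (by linarith) k).2 ⟨by linarith [h2.1], by linarith [h2.2]⟩⟩
  · rintro ⟨h1, h2⟩
    have := (floor_cell hσ (by linarith) k).1 h2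
    exact ⟨h1, by linarith [this.1], by linarith [this.2]⟩

open Classical in
lemma cell_int (m D : ℕ) (s : ℝ) {σ : ℝ} (hσ : 0 < σ) (g : (Fin m → ℕ) → ℝ) :
    ∫ x in {x : Fin m → ℝ | ∀ i, x i ∈ Ioi s},
      (if ∀ i, ⌊(x i - s) / σ⌋₊ < D then g (fun i => ⌊(x i - s) / σ⌋₊) else 0)
      = σ ^ m * ∑ f : Fin m → Fin D, g (fun i => (f i : ℕ)) := by
  set cell : (Fin m → Fin D) → Set (Fin m → ℝ) := fun f => univ.pi fun i => Tc s σ (f i) with hcell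
  have hcm : ∀ f, MeasurableSet (cell f) := fun f => MeasurableSet.univ_pi fun i =>
    measurableSet_Ioi.inter measurableSet_Ico
  have hcv : ∀ f, volume (cell f) = ENNReal.ofReal σ ^ m := by
    intro f
    rw [hcell, volume_pi_pi]
    simp [Tc_vol s hσ]
  have hmem : ∀ f x, x ∈ cell f ↔ ∀ i, s < x i ∧ ⌊(x i - s) / σ⌋₊ = f i := by
    intro f x
    simp only [hcell, Set.mem_pi, mem_univ, true_implies, Tc_mem hσ]
  have hSm : MeasurableSet {x : Fin m → ℝ | ∀ i, x i ∈ Ioi s} := by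
    rw [setpi_eq]; exact MeasurableSet.univ_pi fun i => measurableSet_Ioi
  rw [← integral_indicator hSm]
  have e : ({x : Fin m → ℝ | ∀ i, x i ∈ Ioi s}.indicator fun x : Fin m → ℝ =>
      (if ∀ i, ⌊(x i - s) / σ⌋₊ < D then g (fun i => ⌊(x i - s) / σ⌋₊) else 0))
      = fun x => ∑ f : Fin m → Fin D, (cell f).indicator (fun _ => g (fun i => (f i : ℕ))) x := by
    funext x
    by_cases hx : ∀ i, s < x i
    · rw [indicator_of_mem (by exact hx)]
      by_cases hD : ∀ i, ⌊(x i - s) / σ⌋₊ < D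
      · rw [if_pos hD, Finset.sum_eq_single (fun i => (⟨_, hD i⟩ : Fin D))]
        · rw [indicator_of_mem]
          rw [hmem]; exact fun i => ⟨hx i, rfl⟩
        · intro f _ hf
          refine indicator_of_notMem (fun h => hf ?_) _
          rw [hmem] at h
          funext i
          exact Fin.ext (h i).2.symm
        · simp
      · rw [if_neg hD]
        symm
        refine Finset.sum_eq_zero fun f _ => indicator_of_notMem (fun h => hD ?_) _
        rw [hmem] at h
        intro i
        rw [(h i).2]; exact (f i).2
    · rw [indicator_of_notMem (by exact hx)]
      symm
      refine Finset.sum_eq_zero fun f _ => indicator_of_notMem (fun h => hx ?_) _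
      rw [hmem] at h
      exact fun i => (h i).1
  rw [e, integral_finsetSum]
  · rw [Finset.mul_sum]
    refine Finset.sum_congr rfl fun f _ => ?_
    rw [integral_indicator_const _ (hcm f), smul_eq_mul, Measure.real, hcv, ENNReal.toReal_pow,
      ENNReal.toReal_ofReal hσ.le]
  · intro f _
    refine IntegrableOn.integrable_indicator (integrableOn_const ?_) (hcm f)
    rw [hcv]; simp

def KA (x y : ℝ) : ℝ := ∫ r in Ioi (0:ℝ), Ai (x + r) * Ai (y + r)

def FR (s : ℝ) : ℝ := 1 + ∑' m : ℕ, ((-1:ℝ) ^ (m + 1) / (m + 1).factorial) *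
  ∫ x in {x : Fin (m + 1) → ℝ | ∀ i, x i ∈ Ioi s}, (Matrix.of fun i j => KA (x i) (x j)).det

lemma FR_eq (s : ℝ) : fredholmDet airyKernel (Ioi s) = (FR s : ℂ) := by
  unfold fredholmDet FR
  have hd : ∀ (m : ℕ) (x : Fin m → ℝ), (Matrix.of fun i j => airyKernel (x i) (x j)).det
      = (((Matrix.of fun i j => KA (x i) (x j)).det : ℝ) : ℂ) := by
    intro m x
    have h1 := Complex.ofRealHom.map_det (Matrix.of fun i j => KA (x i) (x j))
    rw [Complex.ofRealHom_eq_coe] at h1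
    rw [h1]
    congr 1
    ext i j
    simp [airyKernel_eq, KA]
  simp_rw [hd]
  push_cast
  congr 2
  funext m
  rw [integral_complex_ofReal]

open Classical in
def Gm (b η θ uc ε s σ : ℝ) (M n D m : ℕ) (x : Fin m → ℝ) : ℝ :=
  if ∀ i, ⌊(x i - s) / σ⌋₊ < D then
    (Matrix.of fun i j => KK b η θ uc ε M (n + ⌊(x i - s) / σ⌋₊) (n + ⌊(x j - s) / σ⌋₊) / σ).det else 0

lemma det_scale {m : ℕ} (A : Matrix (Fin m) (Fin m) ℝ) (u w : Fin m → ℝ) (h : ∀ i, u i * w i = 1) :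
    (Matrix.of fun i j => A i j * (u i * w j)).det = A.det := by
  have e : (Matrix.of fun i j => A i j * (u i * w j)) =
      Matrix.of fun i j => u i * (Matrix.of (fun i j => w j * A i j)) i j := by
    ext i j; simp only [Matrix.of_apply]; ring
  rw [e, Matrix.det_mul_column, Matrix.det_mul_row, ← mul_assoc, ← Finset.prod_mul_distrib]
  simp [h]

lemma Gm_int (b η θ uc ε s : ℝ) {σ : ℝ} (hσ : 0 < σ) (M n D m : ℕ) :
    ∫ x in {x : Fin m → ℝ | ∀ i, x i ∈ Ioi s}, Gm b η θ uc ε s σ M n D m x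
      = ∑ f : Fin m → Fin D, (Matrix.of fun i j => kern (xs b (η * ε) M) (xs b (θ * ε) M)
          (n + M + (f i : ℕ)) (n + M + (f j : ℕ))).det := by
  have := cell_int m D s hσ (fun k => (Matrix.of fun i j => KK b η θ uc ε M (n + k i) (n + k j) / σ).det)
  unfold Gm
  rw [this, Finset.mul_sum]
  refine Finset.sum_congr rfl fun f _ => ?_
  have hk := det_scale (Matrix.of fun i j => kern (xs b (η * ε) M) (xs b (θ * ε) M)
          (n + M + (f i : ℕ)) (n + M + (f j : ℕ)))
    (fun i => Real.exp (-(f i : ℝ) * uc)) (fun i => Real.exp ((f i : ℝ) * uc))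
    (fun i => by rw [← Real.exp_add]; simp)
  rw [← hk]
  have e : (Matrix.of fun i j => KK b η θ uc ε M (n + (f i : ℕ)) (n + (f j : ℕ)) / σ) = σ⁻¹ •
      (Matrix.of fun i j => KK b η θ uc ε M (n + (f i : ℕ)) (n + (f j : ℕ))) := by
    ext i j
    simp only [Matrix.of_apply, Matrix.smul_apply, smul_eq_mul]; ring
  rw [e, Matrix.det_smul, Fintype.card_fin, ← mul_assoc, ← mul_pow, mul_inv_cancel₀ hσ.ne', one_pow, one_mul]
  congr 1
  ext i j
  simp only [Matrix.of_apply, KK]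
  rw [← Real.exp_add, show n + (f i : ℕ) + M = n + M + (f i : ℕ) by ring, show n + (f j : ℕ) + M = n + M + (f j : ℕ) by ring]
  congr 2
  push_cast; ring

lemma Gm_meas (b η θ uc ε s σ : ℝ) (M n D m : ℕ) : Measurable (Gm b η θ uc ε s σ M n D m) := by
  classical
  have h1 : Measurable fun k : Fin m → ℕ => if ∀ i, k i < D then
    (Matrix.of fun i j => KK b η θ uc ε M (n + k i) (n + k j) / σ).det else 0 := measurable_of_countable _
  have h2 : Measurable fun x : Fin m → ℝ => fun i => ⌊(x i - s) / σ⌋₊ :=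
    measurable_pi_lambda _ fun i => Nat.measurable_floor.comp
      (show Measurable fun x : Fin m → ℝ => (x i - s) / σ by fun_prop)
  have h3 := h1.comp h2
  have e : (Gm b η θ uc ε s σ M n D m) = (fun k : Fin m → ℕ => if ∀ i, k i < D then
    (Matrix.of fun i j => KK b η θ uc ε M (n + k i) (n + k j) / σ).det else 0) ∘
      (fun x : Fin m → ℝ => fun i => ⌊(x i - s) / σ⌋₊) := by
    funext x; simp only [Gm, Function.comp]
  rw [e]; exact h3

theorem SP.Gm_bound {b η θ uc v c : ℝ} (h : SP b η θ uc v c) (s : ℝ) :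
    ∃ C δ, 0 < C ∧ 0 < δ ∧ ∀ σ : ℝ, 0 < σ → σ ≤ δ → ∀ M n D m : ℕ, good η θ (c ^ 3 * σ ^ 3) M →
      s ≤ σ * ((n : ℝ) + 1 - v / (c ^ 3 * σ ^ 3)) → ∀ x : Fin m → ℝ, (∀ i, x i ∈ Ioi s) →
      ‖Gm b η θ uc (c ^ 3 * σ ^ 3) s σ M n D m x‖ ≤ (C * Real.sqrt m) ^ m * ∏ i, Real.exp (1 - x i) ^ 2 := by
  obtain ⟨C, δ, hC, hδ, hb⟩ := h.KK_bound |s| (abs_nonneg s)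
  refine ⟨C, min δ 1, hC, by positivity, ?_⟩
  intro σ hσ hσd M n D m hg hn x hx
  have hσ1 := hσd.trans (min_le_left _ _)
  have hσ2 := hσd.trans (min_le_right _ _)
  unfold Gm
  split_ifs
  · rw [Real.norm_eq_abs]
    refine hadamard' _ _ (fun i => Real.exp_pos _) C hC.le fun i j => ?_
    have hX : ∀ i, x i - 1 ≤ σ * (((n + ⌊(x i - s) / σ⌋₊ : ℕ) : ℝ) + 1 - v / (c ^ 3 * σ ^ 3)) ∧
        -|s| ≤ σ * (((n + ⌊(x i - s) / σ⌋₊ : ℕ) : ℝ) + 1 - v / (c ^ 3 * σ ^ 3)) := by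
      intro i
      have h1 : s < x i := hx i
      have h2 := floor_bd hσ (show 0 ≤ x i - s by linarith)
      have h3 : 0 ≤ σ * (⌊(x i - s) / σ⌋₊ : ℝ) := by positivity
      have e : σ * (((n + ⌊(x i - s) / σ⌋₊ : ℕ) : ℝ) + 1 - v / (c ^ 3 * σ ^ 3)) =
        σ * ((n : ℝ) + 1 - v / (c ^ 3 * σ ^ 3)) + σ * (⌊(x i - s) / σ⌋₊ : ℝ) := by push_cast; ring
      rw [e]
      refine ⟨by linarith [h2.1], by linarith [neg_abs_le s]⟩
    refine (hb σ hσ hσ1 M _ _ hg (hX i).2 (hX j).2).trans ?_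
    have := (hX i).1
    have := (hX j).1
    gcongr <;> linarith
  · rw [norm_zero]; positivity

theorem SP.Gm_lim {b η θ uc v c : ℝ} (h : SP b η θ uc v c) (s : ℝ) (M n D : ℝ → ℕ) (m : ℕ)
    (hM : ∀ᶠ σ in 𝓝[>] (0:ℝ), good η θ (c ^ 3 * σ ^ 3) (M σ))
    (hn : ∀ᶠ σ in 𝓝[>] (0:ℝ), s ≤ σ * ((n σ : ℝ) + 1 - v / (c ^ 3 * σ ^ 3)) ∧
      σ * ((n σ : ℝ) + 1 - v / (c ^ 3 * σ ^ 3)) ≤ s + σ)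
    (hD : ∀ᶠ σ in 𝓝[>] (0:ℝ), 1 / σ ^ 2 ≤ (D σ : ℝ)) :
    Tendsto (fun σ => ∫ x in {x : Fin m → ℝ | ∀ i, x i ∈ Ioi s},
      Gm b η θ uc (c ^ 3 * σ ^ 3) s σ (M σ) (n σ) (D σ) m x) (𝓝[>] 0)
      (𝓝 (∫ x in {x : Fin m → ℝ | ∀ i, x i ∈ Ioi s}, (Matrix.of fun i j => KA (x i) (x j)).det)) := by
  obtain ⟨C, δ, hC, hδ, hb⟩ := h.Gm_bound s
  have hσev : ∀ᶠ σ in 𝓝[>] (0:ℝ), σ ∈ Ioc 0 δ := Ioc_mem_nhdsGT hδ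
  have hSm : MeasurableSet {x : Fin m → ℝ | ∀ i, x i ∈ Ioi s} := by
    rw [setpi_eq]; exact MeasurableSet.univ_pi fun i => measurableSet_Ioi
  have hn0 : Tendsto (fun σ : ℝ => σ * ((n σ : ℝ) + 1 - v / (c ^ 3 * σ ^ 3))) (𝓝[>] 0) (𝓝 s) := by
    have hid : Tendsto (fun σ : ℝ => s + σ) (𝓝[>] 0) (𝓝 s) := by
      have : Tendsto (fun σ : ℝ => s + σ) (𝓝 0) (𝓝 (s + 0)) := (continuous_const.add continuous_id).tendsto 0
      rw [add_zero] at this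
      exact this.mono_left nhdsWithin_le_nhds
    exact tendsto_of_tendsto_of_tendsto_of_le_of_le' tendsto_const_nhds hid
      (hn.mono fun σ h => h.1) (hn.mono fun σ h => h.2)
  refine tendsto_integral_filter_of_dominated_convergence
    (fun x => (C * Real.sqrt m) ^ m * ∏ i, Real.exp (1 - x i) ^ 2) ?_ ?_ ((prod_int m s).1.const_mul _) ?_
  · exact Eventually.of_forall fun σ => (Gm_meas _ _ _ _ _ _ _ _ _ _ _).aestronglyMeasurable
  · filter_upwards [hM, hσev, hn] with σ h1 h2 h3
    exact (ae_restrict_iff' hSm).2 (Eventually.of_forall fun x hx =>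
      hb σ h2.1 h2.2 _ _ _ _ h1 h3.1 x hx)
  · refine (ae_restrict_iff' hSm).2 (Eventually.of_forall fun x hx => ?_)
    have hx' : ∀ i, s < x i := hx
    have hDe : ∀ᶠ σ in 𝓝[>] (0:ℝ), ∀ i, ⌊(x i - s) / σ⌋₊ < D σ := by
      refine eventually_all.2 fun i => ?_
      have : 0 < 1 / (x i - s) := by have := hx' i; apply one_div_pos.2; linarith
      have h1 : ∀ᶠ σ in 𝓝[>] (0:ℝ), σ ∈ Ioo 0 (1 / (x i - s)) := Ioo_mem_nhdsGT this
      filter_upwards [h1, hD] with σ h2 h3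
      have hσ := h2.1
      have hxs : 0 < x i - s := by linarith [hx' i]
      rw [Nat.floor_lt (by positivity)]
      refine lt_of_lt_of_le ?_ h3
      rw [div_lt_div_iff₀ hσ (by positivity)]
      have := (lt_div_iff₀ hxs).1 h2.2
      nlinarith
    have e : (fun σ : ℝ => Gm b η θ uc (c ^ 3 * σ ^ 3) s σ (M σ) (n σ) (D σ) m x) =ᶠ[𝓝[>] 0] fun σ =>
        (Matrix.of fun i j => KK b η θ uc (c ^ 3 * σ ^ 3) (M σ) (n σ + ⌊(x i - s) / σ⌋₊) (n σ + ⌊(x j - s) / σ⌋₊) / σ).det := by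
      filter_upwards [hDe] with σ hσ
      rw [Gm, if_pos hσ]
    rw [tendsto_congr' e]
    have hfl : ∀ i, Tendsto (fun σ : ℝ => σ * (((n σ + ⌊(x i - s) / σ⌋₊ : ℕ) : ℝ) + 1 - v / (c ^ 3 * σ ^ 3)))
        (𝓝[>] 0) (𝓝 (x i)) := by
      intro i
      have hr0 : 0 ≤ x i - s := by linarith [hx' i]
      have hfl : Tendsto (fun σ : ℝ => σ * (⌊(x i - s) / σ⌋₊ : ℝ)) (𝓝[>] 0) (𝓝 (x i - s)) := by
        have hid : Tendsto (fun σ : ℝ => (x i - s) - σ) (𝓝[>] 0) (𝓝 (x i - s)) := by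
          have : Tendsto (fun σ : ℝ => (x i - s) - σ) (𝓝 0) (𝓝 ((x i - s) - 0)) :=
            (continuous_const.sub continuous_id).tendsto 0
          rw [sub_zero] at this
          exact this.mono_left nhdsWithin_le_nhds
        refine tendsto_of_tendsto_of_tendsto_of_le_of_le' hid tendsto_const_nhds ?_ ?_
        · filter_upwards [self_mem_nhdsWithin] with σ hσ using (floor_bd hσ hr0).1
        · filter_upwards [self_mem_nhdsWithin] with σ hσ using (floor_bd hσ hr0).2
      have := hn0.add hfl
      rw [add_sub_cancel] at this
      refine this.congr fun σ => ?_
      push_cast; ring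
    have hdet : Continuous fun A : Matrix (Fin m) (Fin m) ℝ => A.det := continuous_id.matrix_det
    refine (hdet.tendsto _).comp ?_
    refine tendsto_pi_nhds.2 fun i => tendsto_pi_nhds.2 fun j => ?_
    exact h.KK_lim (x i) (x j) M _ _ hM (hfl i) (hfl j)

theorem SP.fred_lim {b η θ uc v c : ℝ} (h : SP b η θ uc v c) (s : ℝ) (M n D : ℝ → ℕ)
    (hM : ∀ᶠ σ in 𝓝[>] (0:ℝ), good η θ (c ^ 3 * σ ^ 3) (M σ))
    (hn : ∀ᶠ σ in 𝓝[>] (0:ℝ), s ≤ σ * ((n σ : ℝ) + 1 - v / (c ^ 3 * σ ^ 3)) ∧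
      σ * ((n σ : ℝ) + 1 - v / (c ^ 3 * σ ^ 3)) ≤ s + σ)
    (hD : ∀ᶠ σ in 𝓝[>] (0:ℝ), 1 / σ ^ 2 ≤ (D σ : ℝ)) :
    Tendsto (fun σ : ℝ => ∑ m ∈ Finset.range (D σ + 1), ((-1:ℝ)^m/m.factorial) * ∑ f : Fin m → Fin (D σ),
      (Matrix.of fun i j => kern (xs b (η * (c ^ 3 * σ ^ 3)) (M σ)) (xs b (θ * (c ^ 3 * σ ^ 3)) (M σ))
          (n σ + M σ + (f i : ℕ)) (n σ + M σ + (f j : ℕ))).det) (𝓝[>] 0) (𝓝 (FR s)) := by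
  obtain ⟨C, δ, hC, hδ, hb⟩ := h.Gm_bound s
  have hσev : ∀ᶠ σ in 𝓝[>] (0:ℝ), σ ∈ Ioc 0 δ := Ioc_mem_nhdsGT hδ
  set I0 := ∫ t in Ioi s, Real.exp (1 - t) ^ 2 with hI0
  have hI00 : 0 ≤ I0 := integral_nonneg fun t => by positivity
  have hSm : ∀ m, MeasurableSet {x : Fin m → ℝ | ∀ i, x i ∈ Ioi s} := by
    intro m
    rw [setpi_eq]; exact MeasurableSet.univ_pi fun i => measurableSet_Ioi
  set TT : ℝ → ℕ → ℝ := fun σ m => if m < D σ then ((-1:ℝ) ^ (m + 1) / (m + 1).factorial) *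
    ∫ x in {x : Fin (m + 1) → ℝ | ∀ i, x i ∈ Ioi s},
      Gm b η θ uc (c ^ 3 * σ ^ 3) s σ (M σ) (n σ) (D σ) (m + 1) x else 0 with hTT
  have e : ∀ σ : ℝ, 0 < σ → (∑ m ∈ Finset.range (D σ + 1), ((-1:ℝ)^m/m.factorial) * ∑ f : Fin m → Fin (D σ),
      (Matrix.of fun i j => kern (xs b (η * (c ^ 3 * σ ^ 3)) (M σ)) (xs b (θ * (c ^ 3 * σ ^ 3)) (M σ))
          (n σ + M σ + (f i : ℕ)) (n σ + M σ + (f j : ℕ))).det) = 1 + ∑' m, TT σ m := by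
    intro σ hσ
    rw [Finset.sum_range_succ', add_comm]
    congr 1
    · simp
    · rw [tsum_eq_sum (s := Finset.range (D σ))]
      · refine Finset.sum_congr rfl fun m hm => ?_
        rw [hTT]
        simp only
        rw [if_pos (Finset.mem_range.1 hm), Gm_int _ _ _ _ _ _ hσ]
      · intro m hm
        rw [hTT]
        simp only
        rw [if_neg (by simpa using hm)]
  have e' : (fun σ : ℝ => ∑ m ∈ Finset.range (D σ + 1), ((-1:ℝ)^m/m.factorial) * ∑ f : Fin m → Fin (D σ),
      (Matrix.of fun i j => kern (xs b (η * (c ^ 3 * σ ^ 3)) (M σ)) (xs b (θ * (c ^ 3 * σ ^ 3)) (M σ))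
          (n σ + M σ + (f i : ℕ)) (n σ + M σ + (f j : ℕ))).det) =ᶠ[𝓝[>] 0] fun σ => 1 + ∑' m, TT σ m := by
    filter_upwards [self_mem_nhdsWithin] with σ hσ using e σ hσ
  rw [tendsto_congr' e', FR]
  refine tendsto_const_nhds.add ?_
  have hsum := (summable_nat_add_iff 1).2 (had_summable (C * I0) (by positivity))
  refine tendsto_tsum_of_dominated_convergence hsum ?_ ?_
  · intro m
    have hDm : ∀ᶠ σ in 𝓝[>] (0:ℝ), m < D σ := by
      have h1 : ∀ᶠ σ in 𝓝[>] (0:ℝ), σ ∈ Ioo (0:ℝ) (1 / (m + 1)) := Ioo_mem_nhdsGT (by positivity)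
      filter_upwards [h1, hD] with σ h2 h3
      have hσ := h2.1
      have h4 : (m:ℝ) + 1 < 1 / σ := (lt_one_div (by positivity) hσ).2 h2.2
      have h5 : (m:ℝ) < D σ := by
        refine lt_of_lt_of_le ?_ h3
        rw [show 1 / σ ^ 2 = (1 / σ) * (1 / σ) by field_simp]
        nlinarith
      exact_mod_cast h5
    refine ((h.Gm_lim s M n D (m + 1) hM hn hD).const_mul _).congr' ?_
    filter_upwards [hDm] with σ hσ
    rw [hTT]; simp only; rw [if_pos hσ]
  · filter_upwards [hM, hσev, hn] with σ h1 h2 h3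
    intro m
    rw [hTT]
    simp only
    split_ifs
    · rw [norm_mul, norm_div, norm_pow, norm_neg, norm_one, one_pow, Real.norm_natCast, one_div]
      gcongr
      refine (norm_integral_le_of_norm_le ((prod_int (m + 1) s).1.const_mul _) ((ae_restrict_iff' (hSm _)).2
        (Eventually.of_forall fun x hx => hb σ h2.1 h2.2 _ _ _ _ h1 h3.1 x hx))).trans (le_of_eq ?_)
      rw [integral_const_mul, (prod_int (m + 1) s).2, ← hI0, ← mul_pow]
      congr 1; ring
    · rw [norm_zero]; positivity

lemma Li2_deriv {t : ℝ} (h0 : 0 < t) (h1 : t < 1) : HasDerivAt Li2 (-Real.log (1 - t) / t) t := by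
  obtain ⟨r, hr1, hr2⟩ := exists_between h1
  have hr0 : 0 < r := h0.trans hr1
  have key : HasDerivAt (fun z : ℝ => ∑' k : ℕ, z ^ (k + 1) / ((k : ℝ) + 1) ^ 2)
      (∑' k : ℕ, t ^ k / ((k : ℝ) + 1)) t := by
    refine hasDerivAt_tsum_of_isPreconnected (u := fun k => r ^ k) (t := Ioo (-r) r) (y₀ := 0)
      (g := fun (k : ℕ) (z : ℝ) => z ^ (k + 1) / ((k : ℝ) + 1) ^ 2)
      (g' := fun (k : ℕ) (z : ℝ) => z ^ k / ((k : ℝ) + 1))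
      (summable_geometric_of_lt_one hr0.le hr2) isOpen_Ioo isPreconnected_Ioo ?_ ?_ ⟨by linarith, hr0⟩ ?_ ⟨by linarith, hr1⟩
    · intro k y _
      have := (hasDerivAt_pow (k + 1) y).div_const (((k : ℝ) + 1) ^ 2)
      refine this.congr_deriv ?_
      have : (k:ℝ) + 1 ≠ 0 := by positivity
      push_cast
      field_simp
    · intro k y hy
      have hy' : |y| ≤ r := (abs_lt.2 hy).le
      rw [norm_div, norm_pow, Real.norm_eq_abs, Real.norm_eq_abs, abs_of_pos (by positivity : (0:ℝ) < (k:ℝ) + 1)]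
      have h2 : |y| ^ k ≤ r ^ k := by gcongr
      refine (div_le_self (by positivity) ?_).trans h2
      have : (0:ℝ) ≤ k := by positivity
      linarith
    · simp
  have e : (∑' k : ℕ, t ^ k / ((k : ℝ) + 1)) = -Real.log (1 - t) / t := by
    have h2 := Real.hasSum_pow_div_log_of_abs_lt_one (abs_lt.2 ⟨by linarith, h1⟩)
    rw [← (h2.div_const t).tsum_eq]
    refine tsum_congr fun k => ?_
    rw [pow_succ]; field_simp
  rw [← e]; exact key

lemma zc_facts {a η θ : ℝ} (ha0 : 0 < a) (ha1 : a < 1) (hη : 0 < η) (hθ : 0 < θ) :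
    0 < zc a η θ ∧ √a < zc a η θ ∧ √a * zc a η θ < 1 ∧
      θ * zc a η θ * (zc a η θ - √a) = η * (1 - √a * zc a η θ) := by
  have hb0 : 0 < √a := Real.sqrt_pos.2 ha0
  have hb2 : √a ^ 2 = a := Real.sq_sqrt ha0.le
  have hb1 : √a < 1 := by rw [Real.sqrt_lt' one_pos]; simpa using ha1
  have hr := Real.sq_sqrt (show 0 ≤ 4 * η * θ + a * (θ - η) ^ 2 by positivity)
  have hz : 2 * θ * zc a η θ = √a * (θ - η) + √(4 * η * θ + a * (θ - η) ^ 2) := by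
    unfold zc; field_simp
  have hlt : √a * |θ - η| < √(4 * η * θ + a * (θ - η) ^ 2) := by
    refine Real.lt_sqrt_of_sq_lt ?_
    rw [mul_pow, hb2, sq_abs]; have : 0 < η * θ := by positivity
    linarith
  have hz0 : 0 < zc a η θ := by
    have h1 : -|θ - η| ≤ θ - η := neg_abs_le _
    have : 0 < 2 * θ * zc a η θ := by rw [hz]; nlinarith
    exact pos_of_mul_pos_right this (by positivity)
  generalize zc a η θ = z at *
  generalize √(4 * η * θ + a * (θ - η) ^ 2) = R at *
  generalize √a = b at *
  have hR : R = 2 * θ * z - b * (θ - η) := by linarith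
  rw [hR, ← hb2] at hr
  have hq : θ * z * (z - b) = η * (1 - b * z) := by
    have : 4 * θ * (θ * z * (z - b)) = 4 * θ * (η * (1 - b * z)) := by linear_combination hr
    exact mul_left_cancel₀ (by positivity) this
  have hbz : b < z := by
    have : 0 < (z - b) * (θ * z + b * η) := by
      have : (z - b) * (θ * z + b * η) = η * (1 - b ^ 2) := by linear_combination hq
      rw [this]; have : b ^ 2 < 1 := by rw [hb2]; exact ha1
      exact mul_pos hη (by linarith)
    have := pos_of_mul_pos_left this (by positivity)
    linarith
  refine ⟨hz0, hbz, ?_, hq⟩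
  have : 0 < η * (1 - b * z) := by rw [← hq]; exact mul_pos (by positivity) (by linarith)
  have := pos_of_mul_pos_right this hη.le
  linarith

lemma S3 {a η θ : ℝ} (ha0 : 0 < a) (ha1 : a < 1) (hη : 0 < η) (hθ : 0 < θ) :
    ((fun f : ℝ → ℝ => fun z => z * deriv f z)^[3] (Sfun a η θ)) (zc a η θ) =
      η⁻¹ * (√a * zc a η θ / (1 - √a * zc a η θ) ^ 2) + θ⁻¹ * (√a / zc a η θ / (1 - √a / zc a η θ) ^ 2) := by
  obtain ⟨hz0, hbz, hbz1, -⟩ := zc_facts ha0 ha1 hη hθ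
  have hb0 : 0 < √a := Real.sqrt_pos.2 ha0
  have hU : IsOpen {z : ℝ | √a < z ∧ √a * z < 1} :=
    (isOpen_lt continuous_const continuous_id).inter (isOpen_lt (continuous_const.mul continuous_id) continuous_const)
  have hzU : zc a η θ ∈ {z : ℝ | √a < z ∧ √a * z < 1} := ⟨hbz, hbz1⟩
  set D : (ℝ → ℝ) → ℝ → ℝ := fun f z => z * deriv f z with hD
  have hdinv : ∀ z : ℝ, 0 < z → HasDerivAt (fun z => √a / z) (-(√a / z) / z) z := fun z hz => by
    have := (hasDerivAt_inv hz.ne').const_mul (√a)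
    refine (this.congr_of_eventuallyEq (Eventually.of_forall fun _ => by simp [div_eq_mul_inv])).congr_deriv ?_
    field_simp
  have hdm : ∀ z : ℝ, HasDerivAt (fun z => √a * z) (√a) z := fun z => by
    simpa using (hasDerivAt_id z).const_mul (√a)
  have hlt : ∀ z, √a < z → 0 < √a / z ∧ √a / z < 1 := fun z hz =>
    ⟨div_pos hb0 (hb0.trans hz), (div_lt_one (hb0.trans hz)).2 hz⟩
  have h1 : ∀ z ∈ {z : ℝ | √a < z ∧ √a * z < 1}, D (Sfun a η θ) z =
      η⁻¹ * (-Real.log (1 - √a * z)) + θ⁻¹ * (-Real.log (1 - √a / z)) - vc a η θ := by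
    rintro z ⟨hz1, hz2⟩
    have hz : 0 < z := hb0.trans hz1
    have d1 := ((Li2_deriv (mul_pos hb0 hz) hz2).comp z (hdm z)).const_mul η⁻¹
    have d2 := ((Li2_deriv (hlt z hz1).1 (hlt z hz1).2).comp z (hdinv z hz)).const_mul θ⁻¹
    have d3 := (Real.hasDerivAt_log hz.ne').const_mul (vc a η θ)
    have d : HasDerivAt (Sfun a η θ) _ z := (d1.sub d2).sub d3
    simp only [hD]
    rw [d.deriv]
    generalize Real.log (1 - √a * z) = L1
    generalize Real.log (1 - √a / z) = L2
    field_simp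
    ring
  have h2 : ∀ z ∈ {z : ℝ | √a < z ∧ √a * z < 1}, D (D (Sfun a η θ)) z =
      η⁻¹ * (√a * z / (1 - √a * z)) - θ⁻¹ * (√a / z / (1 - √a / z)) := by
    intro z hzz
    have ee : D (Sfun a η θ) =ᶠ[𝓝 z] fun z => η⁻¹ * (-Real.log (1 - √a * z)) +
        θ⁻¹ * (-Real.log (1 - √a / z)) - vc a η θ := by
      filter_upwards [hU.mem_nhds hzz] with y hy using h1 y hy
    obtain ⟨hz1, hz2⟩ := hzz
    have hz : 0 < z := hb0.trans hz1
    have hn1 : 1 - √a * z ≠ 0 := by linarith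
    have hn2 : 1 - √a / z ≠ 0 := by linarith [(hlt z hz1).2]
    have d1 := ((((hdm z).const_sub 1).log hn1).neg).const_mul η⁻¹
    have d2 := ((((hdinv z hz).const_sub 1).log hn2).neg).const_mul θ⁻¹
    have d := (d1.add d2).sub_const (vc a η θ)
    have : deriv (D (Sfun a η θ)) z = _ := ee.deriv_eq.trans d.deriv
    show z * deriv (D (Sfun a η θ)) z = _
    rw [this]
    generalize 1 - √a * z = X at *
    generalize 1 - √a / z = Y at *
    field_simp
    ring
  have ee : D (D (Sfun a η θ)) =ᶠ[𝓝 (zc a η θ)] fun z => η⁻¹ * (√a * z / (1 - √a * z)) - θ⁻¹ * (√a / z / (1 - √a / z)) := by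
    filter_upwards [hU.mem_nhds hzU] with y hy using h2 y hy
  show zc a η θ * deriv (D (D (Sfun a η θ))) (zc a η θ) = _
  generalize zc a η θ = z at *
  have hn1 : 1 - √a * z ≠ 0 := by linarith
  have hn2 : 1 - √a / z ≠ 0 := by linarith [(hlt z hbz).2]
  have d1 := ((hdm z).div ((hdm z).const_sub 1) hn1).const_mul η⁻¹
  have d2 := ((hdinv z hz0).div ((hdinv z hz0).const_sub 1) hn2).const_mul θ⁻¹
  have d := d1.sub d2
  have : deriv (D (D (Sfun a η θ))) z = _ := ee.deriv_eq.trans d.deriv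
  rw [this]
  have e1 : √a * z = 1 - (1 - √a * z) := by ring
  have e2 : √a / z = 1 - (1 - √a / z) := by ring
  have e3 : √a = (√a * z) / z := by field_simp
  have f1 : z * (η⁻¹ * ((√a * (1 - √a * z) - √a * z * -√a) / (1 - √a * z) ^ 2)) = η⁻¹ * (√a * z / (1 - √a * z) ^ 2) := by
    generalize hX : 1 - √a * z = X at *
    field_simp
    linear_combination (-1) * hX
  have f2 : z * (θ⁻¹ * ((-(√a / z) / z * (1 - √a / z) - √a / z * -(-(√a / z) / z)) / (1 - √a / z) ^ 2)) = - (θ⁻¹ * (√a / z / (1 - √a / z) ^ 2)) := by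
    generalize √a / z = X at *
    generalize hY : 1 - X = Y at *
    field_simp
    linear_combination X * hY
  rw [mul_sub, f1, f2]; ring

theorem SP_c {a η θ : ℝ} (ha0 : 0 < a) (ha1 : a < 1) (hη : 0 < η) (hθ : 0 < θ) :
    SP (√a) η θ (Real.log (zc a η θ)) (vc a η θ) (c2const a η θ) ∧ 0 < vc a η θ := by
  obtain ⟨hz0, hbz, hbz1, hq⟩ := zc_facts ha0 ha1 hη hθ
  have hb0 : 0 < √a := Real.sqrt_pos.2 ha0
  have hb1 : √a < 1 := by rw [Real.sqrt_lt' one_pos]; simpa using ha1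
  have hA0 : 0 < √a / zc a η θ := div_pos hb0 hz0
  have hA1 : √a / zc a η θ < 1 := (div_lt_one hz0).2 hbz
  have hB0 : 0 < √a * zc a η θ := mul_pos hb0 hz0
  have e1 : Real.exp (Real.log (zc a η θ)) = zc a η θ := Real.exp_log hz0
  have e2 : √a * Real.exp (-Real.log (zc a η θ)) = √a / zc a η θ := by rw [Real.exp_neg, e1]; rfl
  have hpos : 0 < η⁻¹ * (√a * zc a η θ / (1 - √a * zc a η θ) ^ 2) + θ⁻¹ * (√a / zc a η θ / (1 - √a / zc a η θ) ^ 2) := by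
    have : 0 < 1 - √a * zc a η θ := by linarith
    have : 0 < 1 - √a / zc a η θ := by linarith
    positivity
  have hc : c2const a η θ = ((1/2) * (η⁻¹ * (√a * zc a η θ / (1 - √a * zc a η θ) ^ 2) + θ⁻¹ * (√a / zc a η θ / (1 - √a / zc a η θ) ^ 2))) ^ ((1:ℝ)/3) := by
    rw [c2const, S3 ha0 ha1 hη hθ]
  refine ⟨⟨hb0, hb1.le, hη, hθ, ?_, ?_, ?_, ?_, ?_, ?_⟩, ?_⟩
  · rw [e1]; exact hbz1
  · rw [e2]; exact hA1
  · rw [e1, e2]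
    generalize zc a η θ = z at *
    have h1 : 1 - √a * z ≠ 0 := by linarith
    have h2 : z - √a ≠ 0 := by linarith
    rw [show √a / z / (1 - √a / z) = √a / (z - √a) by
      rw [div_div]; congr 1; field_simp]
    field_simp
    linear_combination hq
  · rw [e1, e2]; rfl
  · rw [hc]; positivity
  · rw [e1, e2, hc, ← Real.rpow_natCast, ← Real.rpow_mul (by positivity)]
    norm_num
    ring
  · unfold vc
    have h1 : Real.log (1 - √a * zc a η θ) < 0 := Real.log_neg (by linarith) (by linarith)
    have h2 : Real.log (1 - √a / zc a η θ) < 0 := Real.log_neg (by linarith) (by linarith)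
    have h3 := mul_pos (inv_pos.2 hη) (neg_pos.2 h1)
    have h4 := mul_pos (inv_pos.2 hθ) (neg_pos.2 h2)
    linarith

def Phi (b η θ ε : ℝ) (M n D : ℕ) : ℝ := ∑ m ∈ Finset.range (D + 1), ((-1:ℝ)^m/m.factorial) * ∑ f : Fin m → Fin D,
  (Matrix.of fun i j => kern (xs b (η * ε) M) (xs b (θ * ε) M) (n + M + (f i : ℕ)) (n + M + (f j : ℕ))).det

lemma exp_ev {h : ℝ} (hh : 0 < h) : ∀ᶠ M : ℕ in atTop, Real.exp (-(h * M)) ≤ h := by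
  have h1 : Tendsto (fun M : ℕ => Real.exp (-(h * M))) atTop (𝓝 0) := by
    refine Real.tendsto_exp_atBot.comp (tendsto_neg_atTop_atBot.comp ?_)
    exact tendsto_natCast_atTop_atTop.const_mul_atTop hh
  filter_upwards [(tendsto_order.1 h1).2 h hh] with M hM using hM.le

lemma choose_MD {a η θ : ℝ} (ha0 : 0 < a) (ha1 : a < 1) (hη : 0 < η) (hθ : 0 < θ) {ε σ : ℝ} (hε : 0 < ε) (hσ : 0 < σ)
    (n : ℕ) : ∃ M D : ℕ, (η * ε ≤ 1 → θ * ε ≤ 1 → good η θ ε M) ∧ 1 / σ ^ 2 ≤ (D : ℝ) ∧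
      |mbProb (Real.exp (-ε)) a η θ ⊤ ⊤ {Λ | Λ.part 0 0 ≤ n} - Phi (√a) η θ ε M n D| < σ := by
  have hb0 : 0 < √a := Real.sqrt_pos.2 ha0
  have eQ : ∀ h : ℝ, Real.exp (-ε) ^ h = Real.exp (-(h * ε)) := fun h => by
    rw [← Real.exp_mul]; congr 1; ring
  have ec : a * √(Real.exp (-(η * ε)) * Real.exp (-(θ * ε))) =
      (√a * Real.exp (-(η * ε) / 2)) * (√a * Real.exp (-(θ * ε) / 2)) := by
    have : √(Real.exp (-(η * ε)) * Real.exp (-(θ * ε))) = Real.exp (-(η * ε) / 2) * Real.exp (-(θ * ε) / 2) := by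
      rw [Real.sqrt_eq_iff_mul_self_eq (by positivity) (by positivity)]
      simp only [← Real.exp_add]; congr 1; ring
    rw [this]
    linear_combination (-(Real.exp (-(η * ε) / 2) * Real.exp (-(θ * ε) / 2))) * (Real.mul_self_sqrt ha0.le)
  have hηε : 0 < η * ε := by positivity
  have hθε : 0 < θ * ε := by positivity
  have hc1 : a * √(Real.exp (-(η * ε)) * Real.exp (-(θ * ε))) < 1 := by
    have h1 : √(Real.exp (-(η * ε)) * Real.exp (-(θ * ε))) ≤ 1 := by
      rw [Real.sqrt_le_one, ← Real.exp_add, Real.exp_le_one_iff]; linarith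
    nlinarith
  have main := fin_main (Real.exp (-(η * ε))) _ (Real.exp (-(θ * ε))) (√a * Real.exp (-(η * ε) / 2))
    (√a * Real.exp (-(θ * ε) / 2)) (Real.exp_pos _) (Real.exp_lt_one_iff.2 (by linarith)) (Real.exp_pos _)
    (Real.exp_lt_one_iff.2 (by linarith)) (by positivity) (by positivity) ec hc1 n σ hσ
  obtain ⟨M, hM, h1, h2⟩ := (main.and ((exp_ev hηε).and (exp_ev hθε))).exists
  obtain ⟨D, hD, h3⟩ := (hM.and (tendsto_natCast_atTop_atTop.eventually_ge_atTop (1 / σ ^ 2))).exists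
  refine ⟨M, D, fun u1 u2 => ⟨hε, u1, u2, h1, h2⟩, h3, ?_⟩
  have ew : ∀ Λ : PlanePartition ⊤ ⊤, mbWeight (Real.exp (-ε)) a η θ Λ = wgt (Real.exp (-(η * ε)))
      (a * √(Real.exp (-(η * ε)) * Real.exp (-(θ * ε)))) (Real.exp (-(θ * ε))) Λ := fun Λ => by
    unfold mbWeight wgt; rw [eQ, eQ]
  unfold mbProb Phi
  simp only [ew]
  exact hD

theorem sigma_lim {a η θ : ℝ} (ha0 : 0 < a) (ha1 : a < 1) (hη : 0 < η) (hθ : 0 < θ) (s : ℝ) :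
    Tendsto (fun σ : ℝ => mbProb (Real.exp (-((c2const a η θ) ^ 3 * σ ^ 3))) a η θ ⊤ ⊤
      {Λ | (Λ.part 0 0 : ℝ) < vc a η θ / ((c2const a η θ) ^ 3 * σ ^ 3) + s / σ}) (𝓝[>] 0) (𝓝 (FR s)) := by
  obtain ⟨h, hv⟩ := SP_c ha0 ha1 hη hθ
  have hc := h.hc
  set c := c2const a η θ
  set v := vc a η θ
  set n : ℝ → ℕ := fun σ => ⌈v / (c ^ 3 * σ ^ 3) + s / σ⌉₊ - 1 with hn
  have hex : ∀ σ : ℝ, ∃ M D : ℕ, 0 < σ → (η * (c ^ 3 * σ ^ 3) ≤ 1 → θ * (c ^ 3 * σ ^ 3) ≤ 1 → good η θ (c ^ 3 * σ ^ 3) M) ∧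
      1 / σ ^ 2 ≤ (D : ℝ) ∧
      |mbProb (Real.exp (-(c ^ 3 * σ ^ 3))) a η θ ⊤ ⊤ {Λ | Λ.part 0 0 ≤ n σ} - Phi (√a) η θ (c ^ 3 * σ ^ 3) M (n σ) D| < σ := by
    intro σ
    by_cases hσ : 0 < σ
    · obtain ⟨M, D, h1⟩ := choose_MD ha0 ha1 hη hθ (show 0 < c ^ 3 * σ ^ 3 by positivity) hσ (n σ)
      exact ⟨M, D, fun _ => h1⟩
    · exact ⟨0, 0, fun h => absurd h hσ⟩
  choose M D hMD using hex
  have hpos : ∀ᶠ σ in 𝓝[>] (0:ℝ), 0 < σ := self_mem_nhdsWithin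
  have small : ∀ k : ℝ, ∀ᶠ σ in 𝓝[>] (0:ℝ), k * (c ^ 3 * σ ^ 3) ≤ 1 := fun k => by
    have : Tendsto (fun σ : ℝ => k * (c ^ 3 * σ ^ 3)) (𝓝 0) (𝓝 (k * (c ^ 3 * 0 ^ 3))) :=
      Continuous.tendsto (by fun_prop) 0
    have h2 := (tendsto_order.1 this).2 1 (by norm_num)
    filter_upwards [nhdsWithin_le_nhds h2] with σ hσ using hσ.le
  have hx : ∀ᶠ σ in 𝓝[>] (0:ℝ), 0 < v / (c ^ 3 * σ ^ 3) + s / σ := by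
    have : Tendsto (fun σ : ℝ => v + s * c ^ 3 * σ ^ 2) (𝓝 0) (𝓝 (v + s * c ^ 3 * 0 ^ 2)) :=
      Continuous.tendsto (by fun_prop) 0
    have h2 := (tendsto_order.1 this).1 0 (by simpa using hv)
    filter_upwards [nhdsWithin_le_nhds h2, hpos] with σ h1 h0
    have : v / (c ^ 3 * σ ^ 3) + s / σ = (v + s * c ^ 3 * σ ^ 2) / (c ^ 3 * σ ^ 3) := by field_simp
    rw [this]; positivity
  have hn1 : ∀ σ : ℝ, 0 < v / (c ^ 3 * σ ^ 3) + s / σ → n σ + 1 = ⌈v / (c ^ 3 * σ ^ 3) + s / σ⌉₊ := fun σ hσ => by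
    have := Nat.ceil_pos.2 hσ
    simp only [hn]; omega
  have lim := h.fred_lim s M n D (by
      filter_upwards [small η, small θ, hpos] with σ h1 h2 h0 using (hMD σ h0).1 h1 h2) (by
      filter_upwards [hx, hpos] with σ h1 h0
      have h2 : ((n σ : ℝ) + 1) = (⌈v / (c ^ 3 * σ ^ 3) + s / σ⌉₊ : ℝ) := by exact_mod_cast hn1 σ h1
      have h3 := Nat.le_ceil (v / (c ^ 3 * σ ^ 3) + s / σ)
      have h4 := Nat.ceil_lt_add_one h1.le
      rw [h2]
      have e : σ * (s / σ) = s := by field_simp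
      constructor
      · calc s = σ * (s / σ) := e.symm
          _ ≤ _ := mul_le_mul_of_nonneg_left (by linarith) h0.le
      · calc _ ≤ σ * (s / σ + 1) := mul_le_mul_of_nonneg_left (by linarith) h0.le
          _ = s + σ := by rw [mul_add, e, mul_one]) (by
      filter_upwards [hpos] with σ h0 using (hMD σ h0).2.1)
  have hdiff : Tendsto (fun σ : ℝ => mbProb (Real.exp (-(c ^ 3 * σ ^ 3))) a η θ ⊤ ⊤ {Λ | Λ.part 0 0 ≤ n σ} -
      Phi (√a) η θ (c ^ 3 * σ ^ 3) (M σ) (n σ) (D σ)) (𝓝[>] 0) (𝓝 0) := by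
    refine squeeze_zero_norm' (a := fun σ => σ) ?_ (tendsto_id.mono_left nhdsWithin_le_nhds)
    filter_upwards [hpos] with σ h0 using (hMD σ h0).2.2.le
  have := hdiff.add lim
  rw [zero_add] at this
  refine this.congr' ?_
  filter_upwards [hx] with σ h1
  have e : {Λ : PlanePartition ⊤ ⊤ | (Λ.part 0 0 : ℝ) < v / (c ^ 3 * σ ^ 3) + s / σ} = {Λ | Λ.part 0 0 ≤ n σ} := by
    ext Λ
    simp only [Set.mem_ofPred_eq]
    rw [← Nat.lt_ceil, ← hn1 σ h1, Nat.lt_succ_iff]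
  rw [e]
  unfold Phi
  ring

theorem statement10 (a η θ : ℝ) (ha0 : 0 < a) (ha1 : a < 1) (hη : 0 < η) (hθ : 0 < θ) (s : ℝ) :
    Tendsto (fun ε : ℝ => ((mbProb (Real.exp (-ε)) a η θ ⊤ ⊤
      {Λ | ((Λ.part 0 0 : ℝ) - vc a η θ * ε⁻¹) / (c2const a η θ * ε ^ (-(1 : ℝ) / 3)) < s} : ℝ) : ℂ))
      (𝓝[>] 0) (𝓝 (fredholmDet airyKernel (Set.Ioi s))) := by
  rw [FR_eq]
  refine (Complex.continuous_ofReal.tendsto _).comp ?_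
  have hc := (SP_c ha0 ha1 hη hθ).1.hc
  have lim := sigma_lim ha0 ha1 hη hθ s
  have hpos : ∀ᶠ ε in 𝓝[>] (0:ℝ), 0 < ε := self_mem_nhdsWithin
  have hσ : Tendsto (fun ε : ℝ => ε ^ ((1:ℝ)/3) / c2const a η θ) (𝓝[>] 0) (𝓝[>] 0) := by
    refine tendsto_nhdsWithin_iff.2 ⟨?_, ?_⟩
    · have h1 := (Real.continuousAt_rpow_const 0 ((1:ℝ)/3) (Or.inr (by norm_num))).tendsto
      have h2 := h1.div_const (c2const a η θ)
      rw [Real.zero_rpow (by norm_num), zero_div] at h2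
      exact h2.mono_left nhdsWithin_le_nhds
    · filter_upwards [hpos] with ε hε
      exact div_pos (Real.rpow_pos_of_pos hε _) hc
  refine (lim.comp hσ).congr' ?_
  filter_upwards [hpos] with ε hε
  simp only [Function.comp]
  have hr := Real.rpow_pos_of_pos hε ((1:ℝ)/3)
  have e3 : (ε ^ ((1:ℝ)/3)) ^ 3 = ε := by
    rw [← Real.rpow_natCast, ← Real.rpow_mul hε.le]; norm_num
  have en : ε ^ (-(1:ℝ)/3) = (ε ^ ((1:ℝ)/3))⁻¹ := by
    rw [← Real.rpow_neg hε.le]; norm_num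
  have e4 : c2const a η θ ^ 3 * (ε ^ ((1:ℝ)/3) / c2const a η θ) ^ 3 = ε := by
    rw [div_pow, e3]; field_simp
  rw [e4]
  congr 1
  ext Λ
  simp only [Set.mem_ofPred_eq]
  rw [en]
  generalize ε ^ ((1:ℝ)/3) = r at *
  generalize c2const a η θ = c at *
  rw [div_lt_iff₀ (by positivity), show s / (r / c) = s * (c * r⁻¹) by field_simp, div_eq_mul_inv, sub_lt_iff_lt_add']

end
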